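/- If Γ is a graph of girth at least 5 on 26 vertices with 61 edges, then (δ(Γ), Δ(Γ)) = (4,5) and Γ has an embedded S_{5,[4,4,4,4,4]} star; that is, Γ has a vertex of degree 5 all five of whose neighbours have degree at least 5. -/

import Mathlib

open SimpleGraph

/-- `Γ` has girth at least 5: every cycle has length at least 5. -/
def GirthAtLeast5 {V : Type*} (G : SimpleGraph V) : Prop :=
  ∀ ⦃u : V⦄ (w : G.Walk u u), w.IsCycle → 5 ≤ w.length

/-- `G` has an embedded `S_{D,[e 0, …, e (D-1)]}` star: a vertex `x` of degree `D`
whose `D` neighbours can be enumerated as `y 0, …, y (D-1)` with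
`deg (y i) ≥ e i + 1` for each `i`. -/
def HasEmbeddedStar {V : Type*} [Fintype V] (G : SimpleGraph V) [DecidableRel G.Adj]
    (D : ℕ) (e : Fin D → ℕ) : Prop :=
  ∃ (x : V) (y : Fin D → V), G.degree x = D ∧ Function.Injective y ∧
    (∀ i, G.Adj x (y i)) ∧ ∀ i, e i + 1 ≤ G.degree (y i)

set_option linter.unusedVariables false
noncomputable section Engine

def tg (_ x : Nat) : Nat := x

def frc (t x : Nat) (f : Nat → Bool) : Bool :=
  Nat.rec (f (nat_lit 0)) (fun n _ => f (tg t (Nat.succ n))) x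

def bif' (b t e : Bool) : Bool := Bool.rec e t b

/-- columns marker: bits at multiples of 32 below 1024 -/
def COL : Nat := 0x100000001000000010000000100000001000000010000000100000001000000010000000100000001000000010000000100000001000000010000000100000001000000010000000100000001000000010000000100000001000000010000000100000001000000010000000100000001000000010000000100000001

def row (A i : Nat) : Nat :=
  Nat.land (Nat.shiftRight A (Nat.mul (nat_lit 32) i)) (nat_lit 4294967295)

def col (A i : Nat) : Nat := Nat.land (Nat.shiftRight A i) COL

/-- remove the bits of X from C -/
def rmv (C X : Nat) : Nat := Nat.xor (Nat.lor C X) X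

def clr (t : Nat) (C N u : Nat) (k : Nat → Bool) : Bool :=
  bif' (Nat.beq (row N u) (nat_lit 0))
    (frc t (Nat.lor (Nat.shiftLeft (nat_lit 4294967295) (Nat.mul (nat_lit 32) u))
      (Nat.shiftLeft COL u)) fun X => frc t (rmv C X) k) (k C)

def addX (A B u v : Nat) : Nat :=
  Nat.lor
    (Nat.lor
      (Nat.mul (Nat.lor (col A u) (Nat.shiftLeft (nat_lit 1) (Nat.mul (nat_lit 32) u)))
        (Nat.lor (row A v) (Nat.shiftLeft (nat_lit 1) v)))
      (Nat.mul (Nat.lor (col A v) (Nat.shiftLeft (nat_lit 1) (Nat.mul (nat_lit 32) v)))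
        (Nat.lor (row A u) (Nat.shiftLeft (nat_lit 1) u))))
    (Nat.lor
      (Nat.lor (Nat.shiftLeft (row B v) (Nat.mul (nat_lit 32) u)) (Nat.shiftLeft (col B v) u))
      (Nat.lor (Nat.shiftLeft (row B u) (Nat.mul (nat_lit 32) v)) (Nat.shiftLeft (col B u) v)))

def addB (A u v : Nat) : Nat :=
  Nat.lor
    (Nat.lor (Nat.shiftLeft (row A v) (Nat.mul (nat_lit 32) u)) (Nat.shiftLeft (col A v) u))
    (Nat.lor (Nat.shiftLeft (row A u) (Nat.mul (nat_lit 32) v)) (Nat.shiftLeft (col A u) v))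

def bit2 (u v : Nat) : Nat :=
  Nat.lor (Nat.shiftLeft (nat_lit 1) (Nat.add (Nat.mul (nat_lit 32) u) v))
    (Nat.shiftLeft (nat_lit 1) (Nat.add (Nat.mul (nat_lit 32) v) u))

def ndec (N u v : Nat) : Nat :=
  Nat.sub (Nat.sub N (Nat.shiftLeft (nat_lit 1) (Nat.mul (nat_lit 32) u)))
    (Nat.shiftLeft (nat_lit 1) (Nat.mul (nat_lit 32) v))

def add0 (t : Nat) (A C B N u v e X : Nat) (k : Nat → Nat → Nat → Nat → Bool) : Bool :=
  frc t (Nat.lor A e) fun A' => frc t (Nat.lor B (addB A u v)) fun B' =>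
  frc t (ndec N u v) fun N' => frc t (rmv C X) fun C1 =>
  clr t C1 N' u fun C2 => clr t C2 N' v fun C3 => k A' C3 B' N'

/-- add the edge uv -/
def add (t : Nat) (A C B N u v : Nat) (k : Nat → Nat → Nat → Nat → Bool) : Bool :=
  frc t (bit2 u v) fun e => bif' (Nat.beq (Nat.land C e) e)
    (frc t (addX A B u v) fun X => add0 t A C B N u v e X k) false

def popLe (t : Nat) (k : Nat) : Nat → Bool :=
  Nat.rec (fun c => Nat.beq c (nat_lit 0))
    (fun _ ih c => frc t (Nat.land c (Nat.sub c (nat_lit 1))) ih) k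

def chk (t : Nat) (A w : Nat) : Nat → Nat → Bool :=
  Nat.rec (fun c k => popLe t k c)
    (fun m ih c k => frc t (Nat.land c (Nat.shiftRight A (Nat.mul (nat_lit 32) (Nat.succ m))))
      fun x => bif' (Nat.beq x (nat_lit 0)) (ih c k)
        (bif' (Nat.beq k (nat_lit 0)) false
          (frc t (Nat.xor c x) fun c => frc t (Nat.sub k (nat_lit 1)) fun k => ih c k))) w

def vFail (t : Nat) (D A C N v : Nat) : Bool :=
  frc t (row N v) fun d => bif' (Nat.beq d (nat_lit 0)) false
    (frc t (row C v) fun c => frc t (Nat.sub d (nat_lit 1)) fun k => chk t A D c k)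

def vForce (t : Nat) (D A C N v u : Nat) : Bool :=
  frc t (row N v) fun d => bif' (Nat.beq d (nat_lit 0)) false
    (frc t (rmv (row C v) (Nat.shiftLeft (nat_lit 1) u)) fun c =>
      frc t (Nat.sub d (nat_lit 1)) fun k => chk t A D c k)

def vF (t : Nat) (k0 F HIC A C v : Nat) : Bool :=
  bif' (Nat.beq k0 (nat_lit 0)) false
    (bif' (Nat.beq (row HIC v) (nat_lit 0)) false
      (frc t (Nat.land (row (Nat.lor A C) v) F) fun c =>
        frc t (Nat.sub k0 (nat_lit 1)) fun k => popLe t k c))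

def eqOut (A u w m : Nat) : Bool := Nat.beq (Nat.lor (row A u) m) (Nat.lor (row A w) m)

def isTwin (t : Nat) (A C N F u w : Nat) : Bool :=
  bif' (Nat.beq (row N u) (row N w))
    (bif' (Nat.beq (Nat.land (Nat.shiftRight F u) (nat_lit 1))
        (Nat.land (Nat.shiftRight F w) (nat_lit 1)))
      (frc t (Nat.lor (Nat.shiftLeft (nat_lit 1) u) (Nat.shiftLeft (nat_lit 1) w)) fun m =>
        bif' (eqOut A u w m) (eqOut C u w m) false) false) false

/-- lookup tables for the position of a single bit -/
def TLO : Nat := 0xae0000000000d90086000000e500000000005500000025001400b100000000005e006c01100000000000a700bd0000000000000000000000000000011c002d002f003f0000006b000000000000001101110000008c0089000000000000000000160000005c000000360000004b00440029000000e8004500f0000000000000000000000000007f000000ac009500000000000000a300e00000000000220000000000000000005a0026000000000000000000b000de00000021000000f40053009f000500000000000700e100000017009000a80000003800b700430000000000000000000000fa00240000000000000000010e0000004100e90092002e000000870004006400f700470061006600000000000b00760000000000000000005400c6000000a2000001130000000000000000011b003400ff005200000000000d000e00000048000000a90000002300000000001c000001050001000000c30000000a000000c000000000001d0000000000c800fb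0000000000ce000000000000000000000000000000000000004d000000940000000000000000005700930000000000000000008400000051006d000000000000000000cb000000000082000000d80049007b0000010900b8006000000000004c0000000000ba00af0000008e00330000007c00ca0000000000020000000000d1000000000000003200000000000000f600000000000000bc000000bb00000000000000000000010000000088007400e200b600a400000000000000000000000000e300000003009c00cc00000000002b000000000077004f000001020027000000000000011d000000da000001040000011700b90000000000000000000001140000010f006800f50059008000000112000000b20050001000000000008f00dc0000001b00fc0072000000ef00f800000091009700000000005d0000000000000000000000a100d200000083000000000000000000ec000000000000003d000000e700f100000040011500e600cd00000000003100000019005800c500c100000000006a00ea00b50006000000960000008a00b3005f002800d60101010d007d003c0000001300cf00000000001f00670000003900b40000003e00000073000001180000000000d400000108004a0000004e00000106000000c70000000000d000df000000000000000000690056002c006f0000009e000000ee00000000001e007a0035007000000000000800eb0000000000000000000000000000007500000000000000000079000000f300aa0071000c0000000000d7005b00f2002a00f900000000000000e4000000000000010a00000000010b00c4000000000000000000200000001a00000000001200810015007800000000009a000000bf0085000000c900ab000000000065011900180000000000ed000000dd00be00db00fe00a5003b000000000000009b0000000000000009000001070000007e0000011600460098003000000000009d0000000000990000011a0000010c0000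0000000000000042003a00a000c200ad00d3008d000000000103006300000000000000a6006e000000000000000f0000006200d50000008b00000000003700fd000000000000

def TBI : Nat := 0x1213081405090e1500060c0a1d0f1f1619001107040d000b1c1e181003001b17021a010000

def low (x : Nat) : Nat := Nat.xor x (Nat.land x (Nat.sub x (nat_lit 1)))

def idx (x : Nat) : Nat :=
  Nat.land (Nat.shiftRight TBI (Nat.mul (nat_lit 8) (Nat.mod (low x) (nat_lit 37)))) (nat_lit 31)

def lidx (x : Nat) : Nat :=
  Nat.land (Nat.shiftRight TLO (Nat.mul (nat_lit 16) (Nat.mod (low x) (nat_lit 587)))) (nat_lit 65535)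

def twins (t : Nat) (A C N F u : Nat) (k : Nat → Nat → Bool) (fuel : Nat) : Nat → Nat → Nat → Bool :=
  Nat.rec (fun _ r q => k r q)
    (fun _ ih c r q => bif' (Nat.beq c (nat_lit 0)) (k r q)
      (frc t (idx c) fun w => frc t (Nat.land c (Nat.sub c (nat_lit 1))) fun c' =>
        bif' (isTwin t A C N F u w)
          (frc t (Nat.lor r (Nat.shiftLeft (nat_lit 1) w)) fun r' =>
            frc t (Nat.lor q (Nat.shiftLeft (nat_lit 1) (Nat.mul (nat_lit 32) w))) fun q' =>
              ih c' r' q')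
          (ih c' r q))) fuel

def outC (C v r q : Nat) : Nat :=
  rmv C (Nat.lor (Nat.shiftLeft r (Nat.mul (nat_lit 32) v)) (Nat.shiftLeft q v))

inductive Stk where
  | nil : Stk
  | cons : Nat → Nat → Nat → Nat → Stk → Stk

def popS (ih : Nat → Nat → Nat → Nat → Nat → Stk → Bool) (h : Nat) (st : Stk) : Bool :=
  Stk.rec true (fun A C B N st' _ => ih A C B N h st') st

/-- candidates for twins (heuristic) -/
def cand (D A C v u : Nat) : Nat :=
  rmv (Nat.land (row C v) (row A (idx (Nat.land (row A u)
    (Nat.sub (Nat.shiftLeft (nat_lit 2) D) (nat_lit 1)))))) (Nat.shiftLeft (nat_lit 1) u)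

def brn (t : Nat) (D F A C B N v u h : Nat) (st : Stk)
    (ih : Nat → Nat → Nat → Nat → Nat → Stk → Bool) : Bool :=
  frc t (cand D A C v u) fun c =>
  twins t A C N F u (fun r q => frc t (outC C v r q) fun C' =>
    add t A C B N v u fun A1 C1 B1 N1 => ih A1 C1 B1 N1 h (Stk.cons A C' B N st))
    (nat_lit 32) c (Nat.shiftLeft (nat_lit 1) u) (Nat.shiftLeft (nat_lit 1) (Nat.mul (nat_lit 32) u))

def nz (X C7 ONES : Nat) : Nat := Nat.land (Nat.shiftRight (Nat.add X C7) (nat_lit 31)) ONES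

def COL26 : Nat := 0x100000001000000010000000100000001000000010000000100000001000000010000000100000001000000010000000100000001000000010000000100000001000000010000000100000001000000010000000100000001000000010000000100000001

def P832 : Nat := 0xffffffffffffffffffffffffffffffffffffffffffffffffffffffffffffffffffffffffffffffffffffffffffffffffffffffffffffffffffffffffffffffffffffffffffffffffffffffffffffffffffffffffffffffffffffffffffffffffffffffffffffffff

def K255 : Nat := 0xff000000ff000000ff000000ff000000ff000000ff000000ff000000ff000000ff000000ff000000ff000000ff000000ff000000ff000000ff000000ff000000ff000000ff000000ff000000ff000000ff000000ff000000ff000000ff000000ff000000ff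

def K256 : Nat := Nat.mul (nat_lit 256) COL26
def K7 : Nat := Nat.mul (nat_lit 2147483647) COL26

def fpop (k : Nat) : Nat → Nat :=
  Nat.rec (fun Y => Y) (fun _ ih Y => ih (Nat.land Y (Nat.sub Y (nz Y K7 COL26)))) k

def pick3 (t : Nat) (k0 HIC FM A C : Nat) (kFF : Nat → Bool) (kE : Bool) : Bool :=
  bif' (Nat.beq k0 (nat_lit 0)) kE
    (frc t (Nat.land (Nat.lor A C) FM) fun Y =>
    frc t (fpop (Nat.sub k0 (nat_lit 1)) Y) fun Y =>
    frc t (Nat.xor HIC (nz Y K7 COL26)) fun q => bif' (Nat.beq q (nat_lit 0)) kE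
      (frc t (lidx q) kFF))

def pick2 (t : Nat) (REP ONES C7 X Z T : Nat) (kG : Nat → Nat → Bool) (kE : Bool) : Bool :=
  frc t (Nat.land (Nat.mul (Nat.xor (Nat.land (Nat.shiftRight (Nat.add (Nat.land T K255) K255)
      (nat_lit 8)) COL26) COL26) REP)
    (Nat.xor Z (nz (Nat.land X (Nat.sub X Z)) C7 ONES))) fun Q =>
  bif' (Nat.beq Q (nat_lit 0)) kE
    (frc t (lidx Q) fun p => frc t (Nat.mod p (nat_lit 26)) fun v =>
      frc t (idx (Nat.land (Nat.shiftRight X (Nat.mul (nat_lit 32) p)) (nat_lit 4294967295))) fun u => kG v u)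

def pick1 (t : Nat) (REP M ONES C7 C N : Nat) (kF : Nat → Bool) (kG : Nat → Nat → Bool)
    (kE : Bool) : Bool :=
  frc t (Nat.land (Nat.mul C REP) M) fun X => frc t (nz X C7 ONES) fun Z =>
  frc t (Nat.sub (Nat.add (Nat.mod Z P832) K256) N) fun T =>
  frc t (Nat.xor (Nat.land (Nat.shiftRight T (nat_lit 8)) COL26) COL26) fun fl =>
  bif' (Nat.beq fl (nat_lit 0)) (pick2 t REP ONES C7 X Z T kG kE)
    (frc t (lidx fl) kF)

def loop (D k0 F REP M ONES C7 HIC FM : Nat) (leaf : Nat → Bool) (fuel : Nat) :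
    Nat → Nat → Nat → Nat → Nat → Stk → Bool :=
  Nat.rec (fun _ _ _ _ _ _ => false) (fun t ih A C B N h st =>
    pick1 t REP M ONES C7 C N
      (fun v => bif' (vFail t D A C N v) (popS ih h st) false)
      (fun v u => bif' (vForce t D A C N v u)
        (add t A C B N v u fun A C B N => ih A C B N h st) false)
      (pick3 t k0 HIC FM A C
        (fun v => bif' (vF t k0 F HIC A C v) (popS ih h st) false)
        (bif' (Nat.beq C (nat_lit 0)) (bif' (leaf A) (popS ih h st) false)
          (frc t (Nat.land (Nat.shiftRight h (nat_lit 5)) (nat_lit 31)) fun v =>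
            frc t (Nat.land h (nat_lit 31)) fun u =>
            frc t (Nat.shiftRight h (nat_lit 10)) fun h => brn t D F A C B N v u h st ih)))) fuel

def addAll (es : List (Nat × Nat)) (k : Nat → Nat → Nat → Nat → Bool) :
    Nat → Nat → Nat → Nat → Bool :=
  List.rec k (fun e _ ih A C B N => add (nat_lit 0) A C B N e.1 e.2 ih) es

def lanes (n : Nat) (g : Nat → Nat) : Nat :=
  Nat.rec 0 (fun i acc => acc + g i * 2 ^ (32 * i)) n

def msk (n : Nat) (g : Nat → Bool) : Nat :=
  Nat.rec 0 (fun i acc => acc + (bif g i then 1 else 0) * 2 ^ i) n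

/-- leaf sizes/labels -/
def groupLabs (lo hi : Nat) (sz : Nat) (keys : List Nat) : List Nat :=
  keys.flatMap fun k => List.replicate k lo ++ List.replicate (sz - k) hi

def gEdges : Nat → Nat → List Nat → List (Nat × Nat)
  | _, _, [] => []
  | i, s, m :: ms => (List.range' s m).map (fun j => (i, j)) ++ gEdges (i + 1) (s + m) ms

def gMasks : Nat → List Nat → List Nat
  | _, [] => []
  | s, m :: ms => (2 ^ (s + m) - 2 ^ s) :: gMasks (s + m) ms

structure Cas where
  n : Nat
  D : Nat
  lo : Nat
  hi : Nat
  ar : Nat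
  nl : Nat
  noll : Bool
  k0 : Nat

def Cas.r (c : Cas) : Nat := c.n - 1 - c.hi * (c.D - c.ar) - c.lo * c.ar

def Cas.labs (c : Cas) (H L : List Nat) : List Nat :=
  [c.D] ++ List.replicate (c.D - c.ar) c.hi ++ List.replicate c.ar c.lo
    ++ groupLabs c.lo c.hi (c.hi - 1) H ++ groupLabs c.lo c.hi (c.lo - 1) L
    ++ List.replicate (c.nl - c.ar - H.sum - L.sum) c.lo
    ++ List.replicate (c.r - (c.nl - c.ar - H.sum - L.sum)) c.hi

def Cas.sizes (c : Cas) : List Nat :=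
  List.replicate (c.D - c.ar) (c.hi - 1) ++ List.replicate c.ar (c.lo - 1)

def Cas.edges (c : Cas) : List (Nat × Nat) :=
  (List.range' 1 c.D).map (fun j => (0, j)) ++ gEdges 1 (1 + c.D) c.sizes

def Cas.F (c : Cas) (ls : List Nat) : Nat := msk c.n fun i => Nat.beq (ls.getD i 0) c.lo

def initC (n : Nat) (noll : Bool) (F : Nat) : Nat := lanes n fun i =>
  rmv (2 ^ n - 1) (Nat.lor (2 ^ i) (bif noll && F.testBit i then F else 0))

def Cas.REP (c : Cas) : Nat := (2 ^ (832 * (c.D + c.r)) - 1) / (2 ^ 832 - 1)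

def Cas.masks (c : Cas) : List Nat :=
  gMasks (1 + c.D) (c.sizes ++ List.replicate c.r 1)

def Cas.M (c : Cas) : Nat :=
  c.masks.foldr (fun m acc => m * COL26 + 2 ^ 832 * acc) 0

def Cas.HIC (c : Cas) (F : Nat) : Nat := lanes c.n fun i => bif F.testBit i then 0 else 1

def Cas.run (c : Cas) (leaf : Nat → Nat → Bool) (H L : List Nat) (h : Nat) : Bool :=
  frc 0 (c.F (c.labs H L)) fun F =>
  frc 0 (initC c.n c.noll F) fun C => frc 0 (lanes c.n fun i => (c.labs H L).getD i 0) fun N =>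
  frc 0 c.REP fun REP => frc 0 c.M fun M => frc 0 (REP * COL26) fun ONES =>
  frc 0 (2147483647 * ONES) fun C7 => frc 0 (c.HIC F) fun HIC => frc 0 (HIC * F) fun FM =>
  addAll c.edges (fun A C B N =>
    loop c.D c.k0 F REP M ONES C7 HIC FM (leaf F) 20000 A C B N h Stk.nil) 0 C 0 N

def gen : List Nat → Nat → List (List Nat)
  | [], d => Nat.rec [[]] (fun _ _ => []) d
  | k :: ks, d => Nat.rec [[]] (fun d ih => ih.map (fun l => k :: l) ++ gen ks (d + 1)) d

def Cas.types (c : Cas) (hk lk : List Nat) : List (List Nat × List Nat) :=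
  ((gen hk (c.D - c.ar)).flatMap fun H => (gen lk c.ar).map fun L => (H, L)).filter
    fun t => Nat.ble (c.ar + t.1.sum + t.2.sum) c.nl &&
      Nat.ble (c.nl - c.ar - t.1.sum - t.2.sum) c.r

def Cas.all (c : Cas) (leaf : Nat → Nat → Bool) : List (List Nat × List Nat) → List Nat → Bool
  | [], _ => true
  | t :: ts, hs => c.run leaf t.1 t.2 (hs.headD 0) && Cas.all c leaf ts hs.tail

def allLt (n : Nat) (p : Nat → Bool) : Bool :=
  Nat.rec true (fun i ih => bif' (p i) ih false) n

def noLeaf (_ _ : Nat) : Bool := false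

def djB (A a b : Nat) : Bool :=
  Nat.beq (Nat.land (Nat.lor (row A a) (Nat.shiftLeft 1 a))
    (Nat.lor (row A b) (Nat.shiftLeft 1 b))) 0

def naB (A a b : Nat) : Bool :=
  Nat.beq (Nat.land (Nat.lor (row A a) (Nat.shiftLeft 1 a)) (Nat.shiftLeft 1 b)) 0

def finB (F A m : Nat) : Bool :=
  bif' (Nat.beq (Nat.land m F) m)
    (not (allLt 24 fun v => not (bif' (Nat.beq (Nat.land F (Nat.shiftLeft 1 v)) 0)
      (Nat.beq (Nat.lor (Nat.land (row A v) F) m) m) false))) false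

def ifB (b c : Bool) : Bool := bif' b c true

def leafB (F A : Nat) : Bool :=
  allLt 24 fun a => allLt 24 fun b => ifB (djB A a b) (allLt 24 fun c =>
    ifB (djB A a c) (ifB (djB A b c) (
    allLt 24 fun d => ifB (naB A a d) (ifB (naB A b d) (ifB (naB A c d) (
    allLt 24 fun e => ifB (djB A d e) (ifB (naB A a e) (ifB (naB A b e) (ifB (naB A c e) (
    allLt 24 fun f => ifB (djB A d f) (ifB (djB A e f) (
      ifB (naB A a f) (ifB (naB A b f) (ifB (naB A c f) (
        frc 0 (Nat.lor (Nat.lor (Nat.lor (Nat.shiftLeft 1 a) (Nat.shiftLeft 1 b))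
          (Nat.lor (Nat.shiftLeft 1 c) (Nat.shiftLeft 1 d)))
          (Nat.lor (Nat.shiftLeft 1 e) (Nat.shiftLeft 1 f))) fun m => finB F A m)))))))))))))))

end Engine

section Sound1

theorem frc_eq (t x : ℕ) (f : ℕ → Bool) : frc t x f = f x := by cases x <;> rfl

theorem bif_true {b t e : Bool} (h : bif' b t e = true) :
    (b = true ∧ t = true) ∨ (b = false ∧ e = true) := by
  cases b
  · exact Or.inr ⟨rfl, h⟩
  · exact Or.inl ⟨rfl, h⟩

theorem bif_f {b t : Bool} (h : bif' b t false = true) : b = true ∧ t = true := by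
  cases b
  · cases h
  · exact ⟨rfl, h⟩

theorem bif_nf {b e : Bool} (h : bif' b false e = true) : b = false ∧ e = true := by
  cases b
  · exact ⟨rfl, h⟩
  · cases h

theorem beq_t {a b : ℕ} (h : Nat.beq a b = true) : a = b := Nat.eq_of_beq_eq_true h
theorem beq_fl {a b : ℕ} (h : Nat.beq a b = false) : a ≠ b := Nat.ne_of_beq_eq_false h

/-- matrix entry -/
def bt (A i j : ℕ) : Prop := A.testBit (32 * i + j) = true

theorem row_tb (A i j : ℕ) : (row A i).testBit j = (decide (j < 32) && A.testBit (32 * i + j)) := by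
  show (Nat.land (Nat.shiftRight A (32 * i)) (2 ^ 32 - 1)).testBit j = _
  change ((A >>> (32 * i)) &&& (2 ^ 32 - 1)).testBit j = _
  rw [Nat.testBit_and, Nat.testBit_shiftRight, Nat.testBit_two_pow_sub_one, Bool.and_comm]

theorem row_bt {A i j : ℕ} (hj : j < 32) : (row A i).testBit j = true ↔ bt A i j := by
  rw [row_tb]; simp [hj, bt]

theorem row_lt (A i : ℕ) : row A i < 2 ^ 32 :=
  Nat.and_lt_two_pow _ (by norm_num : 4294967295 < 2 ^ 32)

theorem row_eq (A i : ℕ) : row A i = A / 2 ^ (32 * i) % 2 ^ 32 := by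
  show ((A >>> (32 * i)) &&& (2 ^ 32 - 1)) = _
  rw [Nat.and_two_pow_sub_one_eq_mod, Nat.shiftRight_eq_div_pow]

set_option exponentiation.threshold 2000 in
theorem COL_tb (p : ℕ) : COL.testBit p = true ↔ p % 32 = 0 ∧ p < 1024 := by
  by_cases h : p < 1024
  · have : ∀ p < 1024, (COL.testBit p = true ↔ p % 32 = 0) := by decide +kernel
    simp [this p h, h]
  · simp only [h, and_false, iff_false, Bool.not_eq_true]
    apply Nat.testBit_lt_two_pow
    exact lt_of_lt_of_le (by decide +kernel : COL < 2 ^ 1024) (Nat.pow_le_pow_right (by norm_num) (by omega))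

theorem col_tb (A i p : ℕ) : (col A i).testBit p = true ↔ A.testBit (i + p) = true ∧ p % 32 = 0 ∧ p < 1024 := by
  change ((A >>> i) &&& COL).testBit p = true ↔ _
  rw [Nat.testBit_and, Nat.testBit_shiftRight, Bool.and_eq_true, COL_tb]

theorem col_bt {A i k : ℕ} (hk : k < 32) : (col A i).testBit (32 * k) = true ↔ bt A k i := by
  rw [col_tb, bt, Nat.add_comm]
  constructor
  · exact fun h => h.1
  · exact fun h => ⟨h, by omega, by omega⟩

theorem lor_bt {A B i j : ℕ} : bt (Nat.lor A B) i j ↔ bt A i j ∨ bt B i j := by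
  change (A ||| B).testBit _ = true ↔ _
  rw [Nat.testBit_or, Bool.or_eq_true]; rfl

theorem lor_tb {A B p : ℕ} : (Nat.lor A B).testBit p = true ↔ A.testBit p = true ∨ B.testBit p = true := by
  change (A ||| B).testBit _ = true ↔ _
  rw [Nat.testBit_or, Bool.or_eq_true]

theorem land_tb {A B p : ℕ} : (Nat.land A B).testBit p = true ↔ A.testBit p = true ∧ B.testBit p = true := by
  change (A &&& B).testBit _ = true ↔ _
  rw [Nat.testBit_and, Bool.and_eq_true]

theorem rmv_tb {A B p : ℕ} : (rmv A B).testBit p = true ↔ A.testBit p = true ∧ ¬ B.testBit p = true := by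
  change ((A ||| B) ^^^ B).testBit _ = true ↔ _
  rw [Nat.testBit_xor, Nat.testBit_or]
  cases A.testBit p <;> cases B.testBit p <;> simp

theorem rmv_bt {A B i j : ℕ} : bt (rmv A B) i j ↔ bt A i j ∧ ¬ bt B i j := rmv_tb

theorem shl_tb {x k p : ℕ} : (Nat.shiftLeft x k).testBit p = true ↔ k ≤ p ∧ x.testBit (p - k) = true := by
  change (x <<< k).testBit p = true ↔ _
  rw [Nat.testBit_shiftLeft, Bool.and_eq_true, decide_eq_true_iff]

theorem one_tb {p : ℕ} : (1 : ℕ).testBit p = true ↔ p = 0 := Nat.testBit_one_eq_true_iff_self_eq_zero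

theorem shl1_tb {k p : ℕ} : (Nat.shiftLeft (nat_lit 1) k).testBit p = true ↔ p = k := by
  rw [shl_tb]
  change _ ∧ (1 : ℕ).testBit _ = true ↔ _
  rw [one_tb]; omega

/-- a 32-bit row placed at row u -/
theorem shrow_bt {r u i j : ℕ} (hr : r < 2 ^ 32) (hj : j < 32) :
    bt (Nat.shiftLeft r (Nat.mul (nat_lit 32) u)) i j ↔ i = u ∧ r.testBit j = true := by
  rw [bt, shl_tb]
  change 32 * u ≤ _ ∧ r.testBit (_ - 32 * u) = true ↔ _
  constructor
  · rintro ⟨h1, h2⟩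
    by_cases h : 32 * i + j - 32 * u < 32
    · have : i = u := by omega
      subst this
      exact ⟨rfl, by simpa using h2⟩
    · rw [Nat.testBit_lt_two_pow (lt_of_lt_of_le hr (Nat.pow_le_pow_right (by norm_num) (by omega)))] at h2
      cases h2
  · rintro ⟨rfl, h⟩
    exact ⟨by omega, by simpa using h⟩

/-- a column (bits at multiples of 32) placed at column u -/
theorem shcol_bt {q u i j : ℕ} (hq : ∀ p, q.testBit p = true → p % 32 = 0) (hu : u < 32) (hj : j < 32) :
    bt (Nat.shiftLeft q u) i j ↔ j = u ∧ q.testBit (32 * i) = true := by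
  rw [bt, shl_tb]
  constructor
  · rintro ⟨h1, h2⟩
    have := hq _ h2
    have h3 : j = u := by omega
    subst h3
    exact ⟨rfl, by simpa using h2⟩
  · rintro ⟨rfl, h⟩
    exact ⟨by omega, by simpa using h⟩

theorem col_m (A i : ℕ) : ∀ p, (col A i).testBit p = true → p % 32 = 0 := by
  intro p h; exact ((col_tb _ _ _).1 h).2.1

theorem prod_bt {r : ℕ} (hr : r < 2 ^ 32) {j : ℕ} (hj : j < 32) (i : ℕ) : ∀ S : ℕ,
    (∀ p, S.testBit p = true → p % 32 = 0) →
    (bt (Nat.mul S r) i j ↔ S.testBit (32 * i) = true ∧ r.testBit j = true) := by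
  change ∀ S : ℕ, _ → (bt (S * r) i j ↔ _)
  have key : ∀ S : ℕ, (∀ p, S.testBit p = true → p % 32 = 0) → S % 2 ^ 32 = (S.testBit 0).toNat := by
    intro S hS
    apply Nat.eq_of_testBit_eq
    intro p
    rw [Nat.testBit_mod_two_pow]
    by_cases hp : p = 0
    · subst hp; cases S.testBit 0 <;> simp
    · have h2 : (S.testBit 0).toNat.testBit p = false := by
        cases S.testBit 0
        · simp
        · simp only [Bool.toNat_true]
          by_contra h; exact hp (one_tb.1 (by simpa using h))
      rw [h2]
      by_cases hp2 : p < 32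
      · have : ¬ S.testBit p = true := fun h => by have := hS p h; omega
        simp [this]
      · simp [hp2]
  have dec : ∀ S : ℕ, (∀ p, S.testBit p = true → p % 32 = 0) →
      S * r = 2 ^ 32 * ((S >>> 32) * r) + (S.testBit 0).toNat * r ∧ (S.testBit 0).toNat * r < 2 ^ 32 := by
    intro S hS
    have := key S hS
    have h2 := Nat.div_add_mod S (2 ^ 32)
    rw [Nat.shiftRight_eq_div_pow]
    constructor
    · conv_lhs => rw [← h2]
      rw [← this]; ring
    · cases S.testBit 0
      · simp
      · simpa using hr
  induction i with
  | zero =>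
    intro S hS
    obtain ⟨h1, h2⟩ := dec S hS
    rw [bt, h1, Nat.testBit_two_pow_mul_add _ h2]
    simp only [Nat.mul_zero, Nat.zero_add, hj, if_true]
    cases S.testBit 0 <;> simp
  | succ i ih =>
    intro S hS
    obtain ⟨h1, h2⟩ := dec S hS
    rw [bt, h1, Nat.testBit_two_pow_mul_add _ h2]
    rw [if_neg (by omega), show 32 * (i + 1) + j - 32 = 32 * i + j by omega]
    have := ih (S >>> 32) (by
      intro p hp
      rw [Nat.testBit_shiftRight] at hp
      have := hS _ hp; omega)
    rw [bt] at this
    rw [this, Nat.testBit_shiftRight, show 32 + 32 * i = 32 * (i + 1) by ring]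

theorem row_sub {N u : ℕ} (h : 1 ≤ row N u) (i : ℕ) :
    row (N - 2 ^ (32 * u)) i = row N i - (if i = u then 1 else 0) := by
  simp only [row_eq] at *
  obtain ⟨q, hq⟩ : ∃ q, q = N / 2 ^ (32 * u) := ⟨_, rfl⟩
  obtain ⟨c, hc⟩ : ∃ c, c = N % 2 ^ (32 * u) := ⟨_, rfl⟩
  have hcl : c < 2 ^ (32 * u) := by rw [hc]; exact Nat.mod_lt _ (by positivity)
  have hN : N = 2 ^ (32 * u) * q + c := by rw [hq, hc, Nat.div_add_mod]
  rw [← hq] at h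
  have hq1 : 1 ≤ q := by
    rcases Nat.eq_zero_or_pos q with h0 | h0
    · simp [h0] at h
    · exact h0
  obtain ⟨q', rfl⟩ : ∃ q', q = q' + 1 := ⟨q - 1, by omega⟩
  have hN' : N - 2 ^ (32 * u) = 2 ^ (32 * u) * q' + c := by rw [hN, Nat.mul_succ]; omega
  rw [hN', hN]
  clear hN' hN hq hc
  rcases lt_or_ge i u with hi | hi
  · rw [if_neg (by omega), Nat.sub_zero]
    obtain ⟨d, rfl⟩ : ∃ d, u = i + 1 + d := ⟨u - i - 1, by omega⟩
    have e : ∀ q, (2 ^ (32 * (i + 1 + d)) * q + c) / 2 ^ (32 * i) % 2 ^ 32 = c / 2 ^ (32 * i) % 2 ^ 32 := by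
      intro q
      have : 2 ^ (32 * (i + 1 + d)) * q + c = c + 2 ^ (32 * i) * (2 ^ 32 * (2 ^ (32 * d) * q)) := by
        rw [show 32 * (i + 1 + d) = 32 * i + 32 + 32 * d by ring, pow_add, pow_add]; ring
      rw [this, Nat.add_mul_div_left _ _ (by positivity), Nat.add_mul_mod_self_left]
    rw [e, e]
  · obtain ⟨d, rfl⟩ : ∃ d, i = u + d := ⟨i - u, by omega⟩
    have e : ∀ q, (2 ^ (32 * u) * q + c) / 2 ^ (32 * (u + d)) = q / 2 ^ (32 * d) := by
      intro q
      rw [Nat.mul_add, pow_add, ← Nat.div_div_eq_div_mul, Nat.add_comm, Nat.add_mul_div_left _ _ (by positivity),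
        Nat.div_eq_of_lt hcl, Nat.zero_add]
    rw [e, e]
    rcases Nat.eq_zero_or_pos d with rfl | hd
    · simp only [Nat.add_zero, if_true, Nat.mul_zero, pow_zero, Nat.div_one]
      omega
    · rw [if_neg (by omega), Nat.sub_zero]
      obtain ⟨d, rfl⟩ : ∃ e, d = e + 1 := ⟨d - 1, by omega⟩
      rw [show 32 * (d + 1) = 32 + 32 * d by ring, pow_add, ← Nat.div_div_eq_div_mul, ← Nat.div_div_eq_div_mul]
      congr 2
      omega

theorem pop_bit : ∀ c : ℕ, ∃ l, ∀ j, j ≠ l → c.testBit j = true → (c &&& (c - 1)).testBit j = true := by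
  intro c
  induction c using Nat.strong_induction_on with
  | _ c ih =>
    rcases Nat.eq_zero_or_pos c with rfl | hc
    · exact ⟨0, by simp⟩
    rcases Nat.even_or_odd' c with ⟨m, rfl | rfl⟩
    · obtain ⟨l, hl⟩ := ih m (by omega)
      refine ⟨l + 1, fun j hj h => ?_⟩
      cases j with
      | zero => simp at h
      | succ j =>
        rw [Nat.testBit_and, Bool.and_eq_true]
        refine ⟨h, ?_⟩
        rw [Nat.testBit_succ] at h ⊢
        have h1 : (2 * m) / 2 = m := by omega
        have h2 : (2 * m - 1) / 2 = m - 1 := by omega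
        rw [h1] at h
        rw [h2]
        have := hl j (by omega) h
        rw [Nat.testBit_and, Bool.and_eq_true] at this
        exact this.2
    · refine ⟨0, fun j hj h => ?_⟩
      cases j with
      | zero => omega
      | succ j =>
        rw [Nat.testBit_and, Bool.and_eq_true]
        refine ⟨h, ?_⟩
        rw [Nat.testBit_succ] at h ⊢
        have h1 : (2 * m + 1) / 2 = m := by omega
        have h2 : (2 * m + 1 - 1) / 2 = m := by omega
        rw [h1] at h
        rwa [h2]

theorem popLe_sound (t k : ℕ) : ∀ (c : ℕ), popLe t k c = true → ∀ S : Finset ℕ,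
    (∀ j ∈ S, c.testBit j = true) → S.card ≤ k := by
  induction k with
  | zero =>
    intro c h S hS
    have : c = 0 := beq_t h
    subst this
    rw [Nat.le_zero, Finset.card_eq_zero, Finset.eq_empty_iff_forall_notMem]
    intro j hj
    simpa using hS j hj
  | succ k ih =>
    intro c h S hS
    have h' : popLe t k (c &&& (c - 1)) = true := by
      have : frc t (Nat.land c (Nat.sub c (nat_lit 1))) (popLe t k) = true := h
      rwa [frc_eq] at this
    obtain ⟨l, hl⟩ := pop_bit c
    have := ih _ h' (S.erase l) (fun j hj => by
      rw [Finset.mem_erase] at hj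
      exact hl j hj.1 (hS j hj.2))
    have := Finset.pred_card_le_card_erase (s := S) (a := l)
    omega

end Sound1

section Sound2

structure GE (n : ℕ) (E : ℕ → ℕ → Prop) : Prop where
  symm : ∀ i j, E i j → E j i
  irr : ∀ i, ¬ E i i
  supp : ∀ i j, E i j → i < n
  tri : ∀ i j k, E i j → E j k → E k i → False
  c4 : ∀ i j k l, E i j → E j k → E k l → E l i → i = k ∨ j = l

theorem GE.supp2 {n : ℕ} {E : ℕ → ℕ → Prop} (h : GE n E) {i j : ℕ} (e : E i j) : j < n :=
  h.supp _ _ (h.symm _ _ e)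

open Classical in
noncomputable def cntS (E : ℕ → ℕ → Prop) (C i : ℕ) : Finset ℕ :=
  (Finset.range 32).filter fun j => E i j ∧ bt C i j

theorem mem_cntS {E : ℕ → ℕ → Prop} {C i j : ℕ} : j ∈ cntS E C i ↔ j < 32 ∧ E i j ∧ bt C i j := by
  simp [cntS]

open Classical in
noncomputable def nbF (E : ℕ → ℕ → Prop) (F i : ℕ) : Finset ℕ :=
  (Finset.range 32).filter fun j => E i j ∧ F.testBit j = true

theorem mem_nbF {E : ℕ → ℕ → Prop} {C i j : ℕ} :
    j ∈ nbF E C i ↔ j < 32 ∧ E i j ∧ C.testBit j = true := by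
  simp [nbF]

structure Gd (n F k0 : ℕ) (P : (ℕ → ℕ → Prop) → Prop) (E : ℕ → ℕ → Prop) : Prop extends GE n E where
  kf : ∀ v < n, F.testBit v = false → k0 ≤ (nbF E F v).card
  p : P E

structure Wf (n A C B : ℕ) : Prop where
  aS : ∀ i < 32, ∀ j < 32, bt A i j → bt A j i
  bS : ∀ i < 32, ∀ j < 32, bt B i j → bt B j i
  cS : ∀ i < 32, ∀ j < 32, bt C i j → bt C j i
  cI : ∀ i < 32, ¬ bt C i i
  cN : ∀ p, C.testBit p = true → p / 32 < n ∧ p % 32 < n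
  dis : ∀ i < 32, ∀ j < 32, bt A i j → ¬ bt C i j
  bB : ∀ i < 32, ∀ j < 32, bt B i j → i ≠ j ∧ ∃ k < 32, bt A i k ∧ bt A k j

structure St (E : ℕ → ℕ → Prop) (A C N : ℕ) : Prop where
  aE : ∀ i < 32, ∀ j < 32, bt A i j → E i j
  ec : ∀ i j, E i j → bt A i j ∨ bt C i j
  cnt : ∀ i, (cntS E C i).card = row N i

/-- removing from the candidates pairs that are no edges -/
theorem St.rmv {n : ℕ} {E : ℕ → ℕ → Prop} {A C N : ℕ} (hn : n ≤ 32) (g : GE n E) (s : St E A C N) (X : ℕ)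
    (h : ∀ i < 32, ∀ j < 32, bt X i j → bt C i j → ¬ E i j) : St E A (rmv C X) N := by
  have key : ∀ i j, E i j → (bt (_root_.rmv C X) i j ↔ bt C i j) := by
    intro i j e
    rw [rmv_bt]
    have h1 := g.supp _ _ e
    have h2 := g.supp2 e
    exact ⟨fun x => x.1, fun x => ⟨x, fun y => h i (by omega) j (by omega) y x e⟩⟩
  refine ⟨s.aE, fun i j e => ?_, fun i => ?_⟩
  · rw [key i j e]; exact s.ec i j e
  · rw [← s.cnt i]
    congr 1
    ext j
    rw [mem_cntS, mem_cntS]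
    constructor
    · rintro ⟨a, b, c⟩; exact ⟨a, b, (key _ _ b).1 c⟩
    · rintro ⟨a, b, c⟩; exact ⟨a, b, (key _ _ b).2 c⟩

theorem Wf.rmv {n A C B : ℕ} (w : Wf n A C B) (X : ℕ)
    (h : ∀ i < 32, ∀ j < 32, bt X i j → bt X j i) : Wf n A (rmv C X) B := by
  refine ⟨w.aS, w.bS, ?_, ?_, ?_, ?_, w.bB⟩
  · intro i hi j hj
    rw [rmv_bt, rmv_bt]
    exact fun x => ⟨w.cS i hi j hj x.1, fun y => x.2 (h j hj i hi y)⟩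
  · intro i hi; rw [rmv_bt]; exact fun x => w.cI i hi x.1
  · intro p hp; rw [rmv_tb] at hp; exact w.cN p hp.1
  · intro i hi j hj a; rw [rmv_bt]; exact fun x => w.dis i hi j hj a x.1

theorem clrX_bt {u : ℕ} (hu : u < 32) {i j : ℕ} (hi : i < 32) (hj : j < 32) :
    bt (Nat.lor (Nat.shiftLeft (nat_lit 4294967295) (Nat.mul (nat_lit 32) u))
      (Nat.shiftLeft COL u)) i j ↔ i = u ∨ j = u := by
  rw [lor_bt, shrow_bt (by norm_num) hj, shcol_bt (fun p h => ((COL_tb p).1 h).1) hu hj, COL_tb]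
  have : (4294967295 : ℕ).testBit j = true := by
    rw [show (4294967295 : ℕ) = 2 ^ 32 - 1 by norm_num, Nat.testBit_two_pow_sub_one]; simpa using hj
  constructor
  · rintro (h | h)
    · exact Or.inl h.1
    · exact Or.inr h.1
  · rintro (h | h)
    · exact Or.inl ⟨h, this⟩
    · exact Or.inr ⟨h, by omega, by omega⟩

theorem clr_sound {n : ℕ} (hn : n ≤ 32) {t A C B N u : ℕ} (hu : u < 32) (k : ℕ → Bool)
    (h : clr t C N u k = true) (w : Wf n A C B) :
    ∃ C', k C' = true ∧ Wf n A C' B ∧ ∀ E, GE n E → St E A C N → St E A C' N := by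
  rcases bif_true h with ⟨h1, h2⟩ | ⟨h1, h2⟩
  · rw [frc_eq, frc_eq] at h2
    refine ⟨_, h2, w.rmv _ ?_, fun E g s => s.rmv hn g _ ?_⟩
    · intro i hi j hj
      rw [clrX_bt hu hi hj, clrX_bt hu hj hi]; tauto
    · intro i hi j hj x c e
      rw [clrX_bt hu hi hj] at x
      have h0 := s.cnt u
      rw [beq_t h1] at h0
      have h0 : (cntS E C u).card = 0 := h0
      rw [Finset.card_eq_zero] at h0
      rcases x with rfl | rfl
      · have : j ∈ cntS E C i := mem_cntS.2 ⟨hj, e, c⟩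
        rw [h0] at this; simp at this
      · have : i ∈ cntS E C j := mem_cntS.2 ⟨hi, g.symm _ _ e, w.cS _ hi _ hj c⟩
        rw [h0] at this; simp at this
  · exact ⟨C, h2, w, fun E _ s => s⟩

theorem bit2_tb {u v p : ℕ} : (bit2 u v).testBit p = true ↔ p = 32 * u + v ∨ p = 32 * v + u := by
  rw [bit2, lor_tb, shl1_tb, shl1_tb]; rfl

theorem bit2_bt {u v i j : ℕ} (hu : u < 32) (hv : v < 32) (hj : j < 32) :
    bt (bit2 u v) i j ↔ (i = u ∧ j = v) ∨ (i = v ∧ j = u) := by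
  rw [bt, bit2_tb]; omega

theorem addB_bt {A u v i j : ℕ} (hu : u < 32) (hv : v < 32) (hi : i < 32) (hj : j < 32) :
    bt (addB A u v) i j ↔ (i = u ∧ bt A v j ∨ j = u ∧ bt A i v) ∨ (i = v ∧ bt A u j ∨ j = v ∧ bt A i u) := by
  rw [addB, lor_bt, lor_bt, lor_bt, shrow_bt (row_lt _ _) hj, shrow_bt (row_lt _ _) hj,
    shcol_bt (col_m _ _) hu hj, shcol_bt (col_m _ _) hv hj, row_bt hj, row_bt hj, col_bt hi, col_bt hi]

theorem addX1 {A u v i j : ℕ} (hv : v < 32) (hi : i < 32) (hj : j < 32) :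
    bt (Nat.mul (Nat.lor (col A u) (Nat.shiftLeft (nat_lit 1) (Nat.mul (nat_lit 32) u)))
        (Nat.lor (row A v) (Nat.shiftLeft (nat_lit 1) v))) i j ↔ (bt A i u ∨ i = u) ∧ (bt A v j ∨ j = v) := by
  have hr : Nat.lor (row A v) (Nat.shiftLeft (nat_lit 1) v) < 2 ^ 32 := by
    apply Nat.or_lt_two_pow (row_lt _ _)
    change 1 <<< v < 2 ^ 32
    rw [Nat.shiftLeft_eq, Nat.one_mul]
    exact Nat.pow_lt_pow_right (by norm_num) hv
  rw [prod_bt hr hj i _ ?_, lor_tb, lor_tb, col_bt hi, row_bt hj, shl1_tb, shl1_tb]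
  · have : 32 * i = Nat.mul 32 u ↔ i = u := by
      change 32 * i = 32 * u ↔ _; omega
    rw [this]
  · intro p hp
    rw [lor_tb, shl1_tb] at hp
    rcases hp with hp | hp
    · exact col_m _ _ _ hp
    · rw [hp]; change 32 * u % 32 = 0; omega

theorem addX_bt {A B u v i j : ℕ} (hu : u < 32) (hv : v < 32) (hi : i < 32) (hj : j < 32) :
    bt (addX A B u v) i j ↔
      (((bt A i u ∨ i = u) ∧ (bt A v j ∨ j = v)) ∨ ((bt A i v ∨ i = v) ∧ (bt A u j ∨ j = u))) ∨
      ((i = u ∧ bt B v j ∨ j = u ∧ bt B i v) ∨ (i = v ∧ bt B u j ∨ j = v ∧ bt B i u)) := by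
  rw [← addB_bt hu hv hi hj, addX, lor_bt, lor_bt, addX1 hv hi hj, addX1 hu hi hj]
  rfl

theorem ndec_row {N u v : ℕ} (huv : u ≠ v) (h1 : 1 ≤ row N u) (h2 : 1 ≤ row N v) (i : ℕ) :
    row (ndec N u v) i = row N i - (if i = u then 1 else 0) - (if i = v then 1 else 0) := by
  change row (N - 1 <<< (32 * u) - 1 <<< (32 * v)) i = _
  rw [Nat.shiftLeft_eq, Nat.shiftLeft_eq, Nat.one_mul, Nat.one_mul, row_sub, row_sub h1]
  rw [row_sub h1, if_neg huv.symm]; exact h2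

set_option maxHeartbeats 1000000 in
theorem add_sound {n : ℕ} (hn : n ≤ 32) {t A C B N u v : ℕ} {k : ℕ → ℕ → ℕ → ℕ → Bool}
    (h : add t A C B N u v k = true) (w : Wf n A C B) :
    u < n ∧ v < n ∧ bt C u v ∧
    ∃ A' C' B' N', k A' C' B' N' = true ∧ Wf n A' C' B' ∧
      ∀ E, GE n E → E u v → St E A C N → St E A' C' N' := by
  rw [add, frc_eq] at h
  obtain ⟨h1, h2⟩ := bif_f h
  have h1 := beq_t h1
  have hC : ∀ p, (p = 32 * u + v ∨ p = 32 * v + u) → C.testBit p = true := by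
    intro p hp
    have h3 : (Nat.land C (bit2 u v)).testBit p = true := by rw [h1, bit2_tb]; exact hp
    rw [land_tb] at h3; exact h3.1
  have c1 := hC (32 * u + v) (Or.inl rfl)
  have c2 := hC (32 * v + u) (Or.inr rfl)
  have r1 := w.cN _ c1
  have r2 := w.cN _ c2
  have hu' : u < n := by omega
  have hv' : v < n := by omega
  have hu : u < 32 := by omega
  have hv : v < 32 := by omega
  have c1 : bt C u v := c1
  have c2 : bt C v u := c2
  refine ⟨hu', hv', c1, ?_⟩
  have huv : u ≠ v := by rintro rfl; exact w.cI u hu c1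
  rw [frc_eq, add0, frc_eq, frc_eq, frc_eq, frc_eq] at h2
  have nA1 : ¬ bt A u v := fun x => w.dis u hu v hv x c1
  have nA2 : ¬ bt A v u := fun x => w.dis v hv u hu x c2
  have aS : ∀ i < 32, ∀ j < 32, bt A i j ↔ bt A j i := fun i hi j hj => ⟨w.aS i hi j hj, w.aS j hj i hi⟩
  have bS : ∀ i < 32, ∀ j < 32, bt B i j ↔ bt B j i := fun i hi j hj => ⟨w.bS i hi j hj, w.bS j hj i hi⟩
  have wf1 : Wf n (Nat.lor A (bit2 u v)) (rmv C (addX A B u v)) (Nat.lor B (addB A u v)) := by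
    have w0 := w.rmv (addX A B u v) (by
      intro i hi j hj
      rw [addX_bt hu hv hi hj, addX_bt hu hv hj hi, aS i hi u hu, aS v hv j hj, aS i hi v hv, aS u hu j hj,
        bS v hv j hj, bS i hi v hv, bS u hu j hj, bS i hi u hu]
      rintro ((⟨a, b⟩ | ⟨a, b⟩) | ((x | x) | (x | x)))
      · exact Or.inl (Or.inr ⟨b, a⟩)
      · exact Or.inl (Or.inl ⟨b, a⟩)
      · exact Or.inr (Or.inl (Or.inr x))
      · exact Or.inr (Or.inl (Or.inl x))
      · exact Or.inr (Or.inr (Or.inr x))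
      · exact Or.inr (Or.inr (Or.inl x)))
    refine ⟨?_, ?_, w0.cS, w0.cI, w0.cN, ?_, ?_⟩
    · intro i hi j hj
      rw [lor_bt, lor_bt, bit2_bt hu hv hj, bit2_bt hu hv hi, aS i hi j hj]; tauto
    · intro i hi j hj
      rw [lor_bt, lor_bt, addB_bt hu hv hi hj, addB_bt hu hv hj hi, bS i hi j hj, aS v hv j hj, aS i hi v hv,
        aS u hu j hj, aS i hi u hu]
      rintro (a | ((x | x) | (x | x)))
      · exact Or.inl a
      · exact Or.inr (Or.inl (Or.inr x))
      · exact Or.inr (Or.inl (Or.inl x))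
      · exact Or.inr (Or.inr (Or.inr x))
      · exact Or.inr (Or.inr (Or.inl x))
    · intro i hi j hj
      rw [lor_bt, bit2_bt hu hv hj]
      rintro (a | a) x
      · exact w0.dis i hi j hj a x
      · rw [rmv_bt, addX_bt hu hv hi hj] at x
        apply x.2
        rcases a with a | a
        · exact Or.inl (Or.inl ⟨Or.inr a.1, Or.inr a.2⟩)
        · exact Or.inl (Or.inr ⟨Or.inr a.1, Or.inr a.2⟩)
    · intro i hi j hj
      rw [lor_bt, addB_bt hu hv hi hj]
      have e1 : bt (bit2 u v) u v := by rw [bit2_bt hu hv hv]; tauto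
      have e2 : bt (bit2 u v) v u := by rw [bit2_bt hu hv hu]; tauto
      rintro (b | ((⟨rfl, a⟩ | ⟨rfl, a⟩) | (⟨rfl, a⟩ | ⟨rfl, a⟩)))
      · obtain ⟨h1, k, hk, h3, h4⟩ := w.bB i hi j hj b
        exact ⟨h1, k, hk, lor_bt.2 (Or.inl h3), lor_bt.2 (Or.inl h4)⟩
      · exact ⟨fun x => nA2 (x ▸ a), v, hv, lor_bt.2 (Or.inr e1), lor_bt.2 (Or.inl a)⟩
      · exact ⟨fun x => nA1 (x ▸ a), v, hv, lor_bt.2 (Or.inl a), lor_bt.2 (Or.inr e2)⟩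
      · exact ⟨fun x => nA1 (x ▸ a), u, hu, lor_bt.2 (Or.inr e2), lor_bt.2 (Or.inl a)⟩
      · exact ⟨fun x => nA2 (x ▸ a), u, hu, lor_bt.2 (Or.inl a), lor_bt.2 (Or.inr e1)⟩
  obtain ⟨C2, h3, wf2, s2⟩ := clr_sound hn hu _ h2 wf1
  obtain ⟨C3, h4, wf3, s3⟩ := clr_sound hn hv _ h3 wf2
  refine ⟨_, _, _, _, h4, wf3, fun E g e s => s3 E g (s2 E g ?_)⟩
  have e' := g.symm _ _ e
  have kill : ∀ i < 32, ∀ j < 32, bt (addX A B u v) i j → bt C i j → E i j →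
      (i = u ∧ j = v) ∨ (i = v ∧ j = u) := by
    intro i hi j hj x c f
    have f' := g.symm _ _ f
    have half : ∀ u < 32, ∀ v < 32, E u v → ¬ bt A u v → ¬ bt A v u →
        (bt A i u ∨ i = u) ∧ (bt A v j ∨ j = v) → i = u ∧ j = v := by
      intro u hu v hv e n1 n2 hx
      rcases hx with ⟨a | rfl, b | rfl⟩
      · rcases g.c4 i u v j (s.aE _ hi _ hu a) e (s.aE _ hv _ hj b) f' with rfl | rfl
        · exact (n2 a).elim
        · exact (n2 b).elim
      · exact (g.tri i u j (s.aE _ hi _ hu a) e f').elim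
      · exact (g.tri i v j e (s.aE _ hv _ hj b) f').elim
      · exact ⟨rfl, rfl⟩
    have hB : ∀ u < 32, ∀ v < 32, ∀ j < 32, E u v → E u j → ¬ bt A v u → ¬ bt B v j := by
      intro u hu v hv j hj e f n2 b
      obtain ⟨hne, k, hk, a1, a2⟩ := w.bB v hv j hj b
      rcases g.c4 v k j u (s.aE _ hv _ hk a1) (s.aE _ hk _ hj a2) (g.symm _ _ f) e with rfl | rfl
      · exact hne rfl
      · exact n2 a1
    rw [addX_bt hu hv hi hj] at x
    rcases x with (x | x) | ((⟨rfl, x⟩ | ⟨rfl, x⟩) | (⟨rfl, x⟩ | ⟨rfl, x⟩))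
    · exact Or.inl (half u hu v hv e nA1 nA2 x)
    · exact Or.inr (half v hv u hu e' nA2 nA1 x)
    · exact (hB i hu v hv j hj e f nA2 x).elim
    · exact (hB j hu v hv i hi e f' nA2 (w.bS _ hi _ hv x)).elim
    · exact (hB i hv u hu j hj e' f nA1 x).elim
    · exact (hB j hv u hu i hi e' f' nA1 (w.bS _ hi _ hu x)).elim
  have m1 : v ∈ cntS E C u := mem_cntS.2 ⟨hv, e, c1⟩
  have m2 : u ∈ cntS E C v := mem_cntS.2 ⟨hu, e', c2⟩
  have k1 : 1 ≤ row N u := by rw [← s.cnt]; exact Finset.card_pos.2 ⟨_, m1⟩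
  have k2 : 1 ≤ row N v := by rw [← s.cnt]; exact Finset.card_pos.2 ⟨_, m2⟩
  have keep : ∀ i j, E i j → (bt (rmv C (addX A B u v)) i j ↔
      bt C i j ∧ ¬ ((i = u ∧ j = v) ∨ (i = v ∧ j = u))) := by
    intro i j f
    have hi : i < 32 := lt_of_lt_of_le (g.supp _ _ f) hn
    have hj : j < 32 := lt_of_lt_of_le (g.supp2 f) hn
    rw [rmv_bt]
    constructor
    · rintro ⟨a, b⟩
      refine ⟨a, fun hx => b ?_⟩
      rw [addX_bt hu hv hi hj]
      rcases hx with a | a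
      · exact Or.inl (Or.inl ⟨Or.inr a.1, Or.inr a.2⟩)
      · exact Or.inl (Or.inr ⟨Or.inr a.1, Or.inr a.2⟩)
    · rintro ⟨a, b⟩
      exact ⟨a, fun hx => b (kill i hi j hj hx a f)⟩
  refine ⟨?_, ?_, ?_⟩
  · intro i hi j hj
    rw [lor_bt, bit2_bt hu hv hj]
    rintro (a | ⟨rfl, rfl⟩ | ⟨rfl, rfl⟩)
    · exact s.aE i hi j hj a
    · exact e
    · exact e'
  · intro i j f
    have hj : j < 32 := lt_of_lt_of_le (g.supp2 f) hn
    rw [lor_bt, keep i j f, bit2_bt hu hv hj]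
    have := s.ec i j f
    tauto
  · intro i
    rw [ndec_row huv k1 k2]
    rcases eq_or_ne i u with rfl | hiu
    · have : cntS E (rmv C (addX A B i v)) i = (cntS E C i).erase v := by
        ext j
        rw [Finset.mem_erase, mem_cntS, mem_cntS]
        constructor
        · rintro ⟨a, b, c⟩
          rw [keep _ _ b] at c
          exact ⟨fun x => c.2 (Or.inl ⟨rfl, x⟩), a, b, c.1⟩
        · rintro ⟨a, b, c, d⟩
          refine ⟨b, c, (keep _ _ c).2 ⟨d, ?_⟩⟩
          rintro (x | x)
          · exact a x.2
          · exact huv x.1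
      rw [this, Finset.card_erase_of_mem m1, s.cnt, if_pos rfl, if_neg huv]; rfl
    · rcases eq_or_ne i v with rfl | hiv
      · have : cntS E (rmv C (addX A B u i)) i = (cntS E C i).erase u := by
          ext j
          rw [Finset.mem_erase, mem_cntS, mem_cntS]
          constructor
          · rintro ⟨a, b, c⟩
            rw [keep _ _ b] at c
            exact ⟨fun x => c.2 (Or.inr ⟨rfl, x⟩), a, b, c.1⟩
          · rintro ⟨a, b, c, d⟩
            refine ⟨b, c, (keep _ _ c).2 ⟨d, ?_⟩⟩
            rintro (x | x)
            · exact hiu x.1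
            · exact a x.2
        rw [this, Finset.card_erase_of_mem m2, s.cnt, if_pos rfl, if_neg hiu]; rfl
      · have : cntS E (rmv C (addX A B u v)) i = cntS E C i := by
          ext j
          rw [mem_cntS, mem_cntS]
          constructor
          · rintro ⟨a, b, c⟩
            rw [keep _ _ b] at c
            exact ⟨a, b, c.1⟩
          · rintro ⟨b, c, d⟩
            exact ⟨b, c, (keep _ _ c).2 ⟨d, by tauto⟩⟩
        rw [this, s.cnt, if_neg hiu, if_neg hiv]; rfl

end Sound2

section Sound3

theorem chk_sound {n : ℕ} {E : ℕ → ℕ → Prop} (g : GE n E) {t A v : ℕ}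
    (aE : ∀ i < 32, ∀ j < 32, bt A i j → E i j) (w : ℕ) (hw : w < 32) :
    ∀ c k : ℕ, (∀ j < 32, c.testBit j = true → ¬ bt A v j) → chk t A w c k = true →
    ∀ S : Finset ℕ, (∀ j ∈ S, j < 32 ∧ E v j ∧ c.testBit j = true) → S.card ≤ k := by
  induction w with
  | zero => intro c k _ h S hS; exact popLe_sound t k c h S fun j hj => (hS j hj).2.2
  | succ w ih =>
    intro c k hc h S hS
    have h : frc t (Nat.land c (Nat.shiftRight A (32 * (w + 1))))
      (fun x => bif' (Nat.beq x (nat_lit 0)) (chk t A w c k)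
        (bif' (Nat.beq k (nat_lit 0)) false
          (frc t (Nat.xor c x) fun c => frc t (Nat.sub k (nat_lit 1)) fun k => chk t A w c k))) = true := h
    rw [frc_eq] at h
    rcases bif_true h with ⟨_, h⟩ | ⟨_, h⟩
    · exact ih (by omega) c k hc h S hS
    · obtain ⟨hk, h⟩ := bif_nf h
      have hk : k ≠ 0 := beq_fl hk
      rw [frc_eq, frc_eq] at h
      change chk t A w (c ^^^ (c &&& (A >>> (32 * (w + 1))))) (k - 1) = true at h
      classical
      have h1 := ih (by omega) _ _ (fun j hj hb => hc j hj (by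
        rw [Nat.testBit_xor, Nat.testBit_and] at hb
        cases hcj : c.testBit j
        · simp [hcj] at hb
        · rfl)) h (S.filter fun j => ¬ bt A (w + 1) j) (fun j hj => by
          rw [Finset.mem_filter] at hj
          obtain ⟨a, b, d⟩ := hS j hj.1
          refine ⟨a, b, ?_⟩
          have h2 : A.testBit (32 * (w + 1) + j) = false := by simpa [bt] using hj.2
          rw [Nat.testBit_xor, Nat.testBit_and, Nat.testBit_shiftRight, h2, d]; rfl)
      have h2 : (S.filter fun j => bt A (w + 1) j).card ≤ 1 := by
        rw [Finset.card_le_one]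
        intro a ha b hb
        rw [Finset.mem_filter] at ha hb
        obtain ⟨a1, a2, a3⟩ := hS a ha.1
        obtain ⟨b1, b2, b3⟩ := hS b hb.1
        rcases g.c4 v a (w + 1) b a2 (g.symm _ _ (aE _ hw _ a1 ha.2)) (aE _ hw _ b1 hb.2) (g.symm _ _ b2) with h | h
        · exact (hc a a1 a3 (h ▸ ha.2)).elim
        · exact h
      have := Finset.card_filter_add_card_filter_not (s := S) (fun j => bt A (w + 1) j)
      omega

theorem vFail_sound {n : ℕ} {E : ℕ → ℕ → Prop} (g : GE n E) (hn : n ≤ 32) {t D A C B N v : ℕ} (hD : D < 32)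
    (w : Wf n A C B) (s : St E A C N) (h : vFail t D A C N v = true) : False := by
  rw [vFail, frc_eq] at h
  obtain ⟨h1, h⟩ := bif_nf h
  have h1 : row N v ≠ 0 := beq_fl h1
  rw [frc_eq, frc_eq] at h
  have hv : v < 32 := by
    by_contra hv
    apply h1
    rw [← s.cnt v, Finset.card_eq_zero, Finset.eq_empty_iff_forall_notMem]
    intro j hj
    have := g.supp _ _ (mem_cntS.1 hj).2.1
    omega
  have := chk_sound g s.aE D hD _ _ (fun j hj hb => fun ha => w.dis v hv j hj ha ((row_bt hj).1 hb)) h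
    (cntS E C v) (fun j hj => by
      obtain ⟨a, b, c⟩ := mem_cntS.1 hj
      exact ⟨a, b, (row_bt a).2 c⟩)
  rw [s.cnt] at this
  change _ ≤ row N v - 1 at this
  omega

theorem vForce_sound {n : ℕ} {E : ℕ → ℕ → Prop} (g : GE n E) (hn : n ≤ 32) {t D A C B N v u : ℕ} (hD : D < 32)
    (w : Wf n A C B) (s : St E A C N) (h : vForce t D A C N v u = true) : E v u := by
  rw [vForce, frc_eq] at h
  obtain ⟨h1, h⟩ := bif_nf h
  have h1 : row N v ≠ 0 := beq_fl h1
  rw [frc_eq, frc_eq] at h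
  have hv : v < 32 := by
    by_contra hv
    apply h1
    rw [← s.cnt v, Finset.card_eq_zero, Finset.eq_empty_iff_forall_notMem]
    intro j hj
    have := g.supp _ _ (mem_cntS.1 hj).2.1
    omega
  by_contra hne
  have := chk_sound g s.aE D hD _ _ (fun j hj hb => fun ha =>
      w.dis v hv j hj ha ((row_bt hj).1 (rmv_tb.1 hb).1)) h
    (cntS E C v) (fun j hj => by
      obtain ⟨a, b, c⟩ := mem_cntS.1 hj
      refine ⟨a, b, rmv_tb.2 ⟨(row_bt a).2 c, ?_⟩⟩
      rw [shl1_tb]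
      rintro rfl
      exact hne b)
  rw [s.cnt] at this
  change _ ≤ row N v - 1 at this
  omega

theorem vF_sound {n F k0 : ℕ} {P : (ℕ → ℕ → Prop) → Prop} {E : ℕ → ℕ → Prop} (g : Gd n F k0 P E)
    {HIC : ℕ} (hH : ∀ v, row HIC v ≠ 0 → v < n ∧ F.testBit v = false)
    {t A C N v : ℕ} (s : St E A C N) (h : vF t k0 F HIC A C v = true) : False := by
  rw [vF] at h
  obtain ⟨h1, h⟩ := bif_nf h
  obtain ⟨h2, h⟩ := bif_nf h
  rw [frc_eq, frc_eq] at h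
  have h1 : k0 ≠ 0 := beq_fl h1
  obtain ⟨a, b⟩ := hH v (beq_fl h2)
  have h3 := g.kf v a b
  have := popLe_sound _ _ _ h (nbF E F v) (fun j hj => by
    rw [mem_nbF] at hj
    rw [land_tb, row_bt hj.1, lor_bt]
    exact ⟨s.ec _ _ hj.2.1, hj.2.2⟩)
  change _ ≤ k0 - 1 at this
  omega

theorem eqOut_sound {A u w m : ℕ} (hm : ∀ p, m.testBit p = true ↔ p = u ∨ p = w)
    (h : eqOut A u w m = true) : ∀ j < 32, j ≠ u → j ≠ w → (bt A u j ↔ bt A w j) := by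
  intro j hj h1 h2
  have h := beq_t h
  have h3 : (Nat.lor (row A u) m).testBit j = (Nat.lor (row A w) m).testBit j := by rw [h]
  have h4 := Bool.eq_iff_iff.1 h3
  rw [lor_tb, lor_tb, hm, row_bt hj, row_bt hj] at h4
  tauto

theorem isTwin_sound {t A C N F u w : ℕ} (h : isTwin t A C N F u w = true) :
    row N u = row N w ∧ (F.testBit u = F.testBit w) ∧
    (∀ j < 32, j ≠ u → j ≠ w → (bt A u j ↔ bt A w j)) ∧
    (∀ j < 32, j ≠ u → j ≠ w → (bt C u j ↔ bt C w j)) := by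
  rw [isTwin] at h
  obtain ⟨h1, h⟩ := bif_f h
  obtain ⟨h2, h⟩ := bif_f h
  rw [frc_eq] at h
  obtain ⟨h3, h4⟩ := bif_f h
  have hm : ∀ p, (Nat.lor (Nat.shiftLeft (nat_lit 1) u) (Nat.shiftLeft (nat_lit 1) w)).testBit p = true ↔
      p = u ∨ p = w := by
    intro p; rw [lor_tb, shl1_tb, shl1_tb]
  refine ⟨beq_t h1, ?_, eqOut_sound hm h3, eqOut_sound hm h4⟩
  have h2 : (F >>> u) &&& 1 = (F >>> w) &&& 1 := beq_t h2
  have h5 : ((F >>> u) &&& 1).testBit 0 = ((F >>> w) &&& 1).testBit 0 := by rw [h2]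
  rw [Nat.testBit_and, Nat.testBit_and, Nat.testBit_shiftRight, Nat.testBit_shiftRight] at h5
  simpa using h5

def swE (u w : ℕ) (E : ℕ → ℕ → Prop) : ℕ → ℕ → Prop :=
  fun i j => E (Equiv.swap u w i) (Equiv.swap u w j)

theorem swap_lt {u w m i : ℕ} (hu : u < m) (hw : w < m) : Equiv.swap u w i < m ↔ i < m := by
  rcases eq_or_ne i u with rfl | h1
  · rw [Equiv.swap_apply_left]; tauto
  · rcases eq_or_ne i w with rfl | h2
    · rw [Equiv.swap_apply_right]; tauto
    · rw [Equiv.swap_apply_of_ne_of_ne h1 h2]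

theorem swap_inv {R : ℕ → ℕ → Prop} {u w : ℕ} (hu : u < 32) (hw : w < 32)
    (hs : ∀ i < 32, ∀ j < 32, R i j → R j i) (hi : ∀ i < 32, ¬ R i i)
    (hr : ∀ j < 32, j ≠ u → j ≠ w → (R u j ↔ R w j)) {i j : ℕ} (h1 : i < 32) (h2 : j < 32) :
    R (Equiv.swap u w i) (Equiv.swap u w j) ↔ R i j := by
  have hs' : ∀ i < 32, ∀ j < 32, (R i j ↔ R j i) := fun i hi j hj => ⟨hs i hi j hj, hs j hj i hi⟩
  have c3 : ∀ i : ℕ, i = u ∨ i = w ∨ (i ≠ u ∧ i ≠ w) := by intro i; omega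
  rcases c3 i with rfl | rfl | ⟨a, b⟩ <;> rcases c3 j with rfl | rfl | ⟨c, d⟩
  all_goals try simp only [Equiv.swap_apply_left, Equiv.swap_apply_right]
  · have := hi w hw; have := hi _ hu; tauto
  · exact hs' _ hw _ hu
  · rw [Equiv.swap_apply_of_ne_of_ne c d]; exact (hr j h2 c d).symm
  · exact hs' _ hu _ hw
  · have := hi _ hw; have := hi _ hu; tauto
  · rw [Equiv.swap_apply_of_ne_of_ne c d]; exact (hr j h2 c d)
  · rw [Equiv.swap_apply_of_ne_of_ne a b, hs' i h1 w hw, hs' i h1 _ hu]; exact (hr i h1 a b).symm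
  · rw [Equiv.swap_apply_of_ne_of_ne a b, hs' i h1 u hu, hs' i h1 _ hw]; exact (hr i h1 a b)
  · rw [Equiv.swap_apply_of_ne_of_ne c d, Equiv.swap_apply_of_ne_of_ne a b]

theorem swGE {n u w : ℕ} {E : ℕ → ℕ → Prop} (g : GE n E) (hu : u < n) (hw : w < n) : GE n (swE u w E) := by
  refine ⟨fun i j e => g.symm _ _ e, fun i e => g.irr _ e, fun i j e => ?_, fun i j k a b c => g.tri _ _ _ a b c,
    fun i j k l a b c d => ?_⟩
  · exact (swap_lt hu hw).1 (g.supp _ _ e)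
  · rcases g.c4 _ _ _ _ a b c d with h | h
    · exact Or.inl ((Equiv.swap u w).injective h)
    · exact Or.inr ((Equiv.swap u w).injective h)

theorem swCard (σ : Equiv.Perm ℕ) {S T : Finset ℕ} (h : ∀ j, j ∈ S ↔ σ j ∈ T) : S.card = T.card := by
  rw [← Finset.card_map σ.toEmbedding (s := S)]
  congr 1
  ext j
  rw [Finset.mem_map_equiv, h, Equiv.apply_symm_apply]

theorem swGd {n F k0 u w : ℕ} {P : (ℕ → ℕ → Prop) → Prop} {E : ℕ → ℕ → Prop} (g : Gd n F k0 P E) (hn : n ≤ 32)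
    (hP : ∀ E u w, u < n → w < n → F.testBit u = F.testBit w → P E → P (swE u w E))
    (hu : u < n) (hw : w < n) (hF : F.testBit u = F.testBit w) : Gd n F k0 P (swE u w E) := by
  refine ⟨swGE g.toGE hu hw, fun v hv hf => ?_, hP E u w hu hw hF g.p⟩
  have hF' : ∀ j, F.testBit (Equiv.swap u w j) = F.testBit j := by
    intro j
    rcases eq_or_ne j u with rfl | h1
    · rw [Equiv.swap_apply_left, hF]
    · rcases eq_or_ne j w with rfl | h2
      · rw [Equiv.swap_apply_right, hF]
      · rw [Equiv.swap_apply_of_ne_of_ne h1 h2]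
  have h := g.kf (Equiv.swap u w v) ((swap_lt hu hw).2 hv) (by rw [hF', hf])
  rw [swCard (Equiv.swap u w) (T := nbF E F (Equiv.swap u w v))]
  · exact h
  · intro j
    rw [mem_nbF, mem_nbF, hF', swap_lt (by omega) (by omega)]; rfl

theorem swSt {n u w : ℕ} {E : ℕ → ℕ → Prop} (g : GE n E) (hn : n ≤ 32) (hu : u < n) (hw : w < n)
    {A C B N : ℕ} (wf : Wf n A C B) (s : St E A C N) (hN : row N u = row N w)
    (hA : ∀ j < 32, j ≠ u → j ≠ w → (bt A u j ↔ bt A w j))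
    (hC : ∀ j < 32, j ≠ u → j ≠ w → (bt C u j ↔ bt C w j)) : St (swE u w E) A C N := by
  have hu' : u < 32 := by omega
  have hw' : w < 32 := by omega
  have aI : ∀ {i j : ℕ}, i < 32 → j < 32 → (bt A (Equiv.swap u w i) (Equiv.swap u w j) ↔ bt A i j) :=
    fun h1 h2 => swap_inv hu' hw' wf.aS (fun i hi h => g.irr i (s.aE i hi i hi h)) hA h1 h2
  have cI : ∀ {i j : ℕ}, i < 32 → j < 32 → (bt C (Equiv.swap u w i) (Equiv.swap u w j) ↔ bt C i j) :=
    fun h1 h2 => swap_inv hu' hw' wf.cS wf.cI hC h1 h2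
  have lt : ∀ i, Equiv.swap u w i < 32 ↔ i < 32 := fun i => swap_lt hu' hw'
  refine ⟨fun i hi j hj a => ?_, fun i j e => ?_, fun i => ?_⟩
  · exact s.aE _ ((lt i).2 hi) _ ((lt j).2 hj) ((aI hi hj).2 a)
  · have g' := swGE g hu hw
    have hi : i < 32 := lt_of_lt_of_le (g'.supp _ _ e) hn
    have hj : j < 32 := lt_of_lt_of_le (g'.supp2 e) hn
    have := s.ec _ _ e
    rwa [aI hi hj, cI hi hj] at this
  · rw [swCard (Equiv.swap u w) (T := cntS E C (Equiv.swap u w i)), s.cnt]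
    · rcases eq_or_ne i u with rfl | h1
      · rw [Equiv.swap_apply_left, hN]
      · rcases eq_or_ne i w with rfl | h2
        · rw [Equiv.swap_apply_right, hN]
        · rw [Equiv.swap_apply_of_ne_of_ne h1 h2]
    · intro j
      rw [mem_cntS, mem_cntS, lt]
      constructor
      · rintro ⟨a, b, c⟩
        have hi : i < 32 := lt_of_lt_of_le ((swGE g hu hw).supp _ _ b) hn
        exact ⟨a, b, (cI hi a).2 c⟩
      · rintro ⟨a, b, c⟩
        have hi : i < 32 := lt_of_lt_of_le ((swGE g hu hw).supp i j b) hn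
        exact ⟨a, b, (cI hi a).1 c⟩

theorem idx_lt (c : ℕ) : idx c < 32 := Nat.and_lt_two_pow _ (by norm_num : 31 < 2 ^ 5)

theorem twins_sound {t A C N F u : ℕ} (k : ℕ → ℕ → Bool) (fuel : ℕ) : ∀ c r q : ℕ,
    twins t A C N F u k fuel c r q = true →
    (∀ w, r.testBit w = true → w < 32 ∧ (w = u ∨ isTwin t A C N F u w = true)) →
    (∀ p, q.testBit p = true ↔ p % 32 = 0 ∧ r.testBit (p / 32) = true) →
    ∃ r q, k r q = true ∧ (∀ w, r.testBit w = true → w < 32 ∧ (w = u ∨ isTwin t A C N F u w = true)) ∧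
    (∀ p, q.testBit p = true ↔ p % 32 = 0 ∧ r.testBit (p / 32) = true) := by
  induction fuel with
  | zero => intro c r q h h1 h2; exact ⟨r, q, h, h1, h2⟩
  | succ f ih =>
    intro c r q h h1 h2
    have h : bif' (Nat.beq c (nat_lit 0)) (k r q)
      (frc t (idx c) fun w => frc t (Nat.land c (Nat.sub c (nat_lit 1))) fun c' =>
        bif' (isTwin t A C N F u w)
          (frc t (Nat.lor r (Nat.shiftLeft (nat_lit 1) w)) fun r' =>
            frc t (Nat.lor q (Nat.shiftLeft (nat_lit 1) (Nat.mul (nat_lit 32) w))) fun q' =>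
              twins t A C N F u k f c' r' q')
          (twins t A C N F u k f c' r q)) = true := h
    rcases bif_true h with ⟨_, h⟩ | ⟨_, h⟩
    · exact ⟨r, q, h, h1, h2⟩
    · rw [frc_eq, frc_eq] at h
      rcases bif_true h with ⟨ht, h⟩ | ⟨_, h⟩
      · rw [frc_eq, frc_eq] at h
        refine ih _ _ _ h ?_ ?_
        · intro w hw
          rw [lor_tb, shl1_tb] at hw
          rcases hw with hw | rfl
          · exact h1 w hw
          · exact ⟨idx_lt c, Or.inr ht⟩
        · intro p
          rw [lor_tb, lor_tb, shl1_tb, shl1_tb, h2]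
          change _ ∨ p = 32 * idx c ↔ _
          have e : p = 32 * idx c ↔ p % 32 = 0 ∧ p / 32 = idx c := by omega
          rw [e]; tauto
      · exact ih _ _ _ h h1 h2

def USat (n F k0 : ℕ) (P : (ℕ → ℕ → Prop) → Prop) (A C N : ℕ) : Prop :=
  ∀ E, Gd n F k0 P E → ¬ St E A C N

def okS (n F k0 : ℕ) (P : (ℕ → ℕ → Prop) → Prop) : Stk → Prop
  | .nil => True
  | .cons A C _ N st => USat n F k0 P A C N ∧ okS n F k0 P st

def wfS (n : ℕ) : Stk → Prop
  | .nil => True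
  | .cons A C B _ st => Wf n A C B ∧ wfS n st

theorem popS_sound {n F k0 : ℕ} {P : (ℕ → ℕ → Prop) → Prop} {ih : ℕ → ℕ → ℕ → ℕ → ℕ → Stk → Bool} {h : ℕ} {st : Stk}
    (hih : ∀ A C B N h st, ih A C B N h st = true → Wf n A C B → wfS n st →
      USat n F k0 P A C N ∧ okS n F k0 P st)
    (e : popS ih h st = true) (w : wfS n st) : okS n F k0 P st := by
  cases st with
  | nil => trivial
  | cons A C B N st => exact hih A C B N h st e w.1 w.2

theorem brn_sound {n F k0 : ℕ} {P : (ℕ → ℕ → Prop) → Prop} (hn : n ≤ 32)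
    (hP : ∀ E u w, u < n → w < n → F.testBit u = F.testBit w → P E → P (swE u w E))
    {ih : ℕ → ℕ → ℕ → ℕ → ℕ → Stk → Bool}
    (hih : ∀ A C B N h st, ih A C B N h st = true → Wf n A C B → wfS n st →
      USat n F k0 P A C N ∧ okS n F k0 P st)
    {t D A C B N v u h : ℕ} {st : Stk} (hu : u < 32)
    (e : brn t D F A C B N v u h st ih = true) (w : Wf n A C B) (ws : wfS n st) :
    USat n F k0 P A C N ∧ okS n F k0 P st := by
  rw [brn, frc_eq] at e
  obtain ⟨r, q, e, h1, h2⟩ := twins_sound _ _ _ _ _ e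
    (by intro w hw; rw [shl1_tb] at hw; exact ⟨by omega, Or.inl hw⟩)
    (by
      intro p; rw [shl1_tb, shl1_tb]
      change p = 32 * u ↔ _; omega)
  simp only [frc_eq] at e
  obtain ⟨hvn, hun, hcv, A1, C1, B1, N1, e, w1, s1⟩ := add_sound hn e w
  have hv : v < 32 := by omega
  have hr : r < 2 ^ 32 := by
    apply Nat.lt_pow_two_of_testBit
    intro i hi
    by_contra hc
    have := (h1 i (by simpa using hc)).1
    omega
  have hX : ∀ i < 32, ∀ j < 32, bt (Nat.lor (Nat.shiftLeft r (Nat.mul (nat_lit 32) v)) (Nat.shiftLeft q v)) i j ↔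
      (i = v ∧ r.testBit j = true) ∨ (j = v ∧ r.testBit i = true) := by
    intro i hi j hj
    rw [lor_bt, shrow_bt hr hj, shcol_bt (fun p hp => ((h2 p).1 hp).1) hv hj, h2]
    have e1 : 32 * i % 32 = 0 := by omega
    have e2 : 32 * i / 32 = i := by omega
    rw [e1, e2]; tauto
  have wo : Wf n A (outC C v r q) B := w.rmv _ (by
    intro i hi j hj; rw [hX i hi j hj, hX j hj i hi]; tauto)
  obtain ⟨u1, u2, u3⟩ := hih _ _ _ _ _ _ e w1 ⟨wo, ws⟩
  refine ⟨fun E g s => ?_, u3⟩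
  by_cases hex : ∃ w, r.testBit w = true ∧ E v w
  · obtain ⟨x, hx, ex⟩ := hex
    rcases (h1 x hx).2 with rfl | tw
    · exact u1 E g (s1 E g.toGE ex s)
    · obtain ⟨t1, t2, t3, t4⟩ := isTwin_sound tw
      have hxn := g.supp2 ex
      have hvu : v ≠ u := by rintro rfl; exact w.cI _ hv hcv
      have hvx : v ≠ x := by rintro rfl; exact g.irr _ ex
      have g' := swGd g hn hP hun hxn t2
      refine u1 _ g' (s1 _ g'.toGE ?_ (swSt g.toGE hn hun hxn w s t1 t3 t4))
      rw [swE, Equiv.swap_apply_left, Equiv.swap_apply_of_ne_of_ne hvu hvx]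
      exact ex
  · push Not at hex
    refine u2 E g (s.rmv hn g.toGE _ ?_)
    intro i hi j hj hx _ f
    rcases (hX i hi j hj).1 hx with ⟨rfl, b⟩ | ⟨rfl, b⟩
    · exact hex j b f
    · exact hex i b (g.symm _ _ f)

theorem pick3_sound {t k0 HIC FM A C : ℕ} {kFF : ℕ → Bool} {kE : Bool}
    (h : pick3 t k0 HIC FM A C kFF kE = true) : (∃ v, kFF v = true) ∨ kE = true := by
  rw [pick3] at h
  rcases bif_true h with ⟨_, h⟩ | ⟨_, h⟩
  · exact Or.inr h
  · rw [frc_eq, frc_eq, frc_eq] at h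
    rcases bif_true h with ⟨_, h⟩ | ⟨_, h⟩
    · exact Or.inr h
    · rw [frc_eq] at h; exact Or.inl ⟨_, h⟩

theorem pick2_sound {t REP ONES C7 X Z T : ℕ} {kG : ℕ → ℕ → Bool} {kE : Bool}
    (h : pick2 t REP ONES C7 X Z T kG kE = true) : (∃ v u, kG v u = true) ∨ kE = true := by
  rw [pick2, frc_eq] at h
  rcases bif_true h with ⟨_, h⟩ | ⟨_, h⟩
  · exact Or.inr h
  · rw [frc_eq, frc_eq, frc_eq] at h
    exact Or.inl ⟨_, _, h⟩

theorem pick1_sound {t REP M ONES C7 C N : ℕ} {kF : ℕ → Bool} {kG : ℕ → ℕ → Bool} {kE : Bool}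
    (h : pick1 t REP M ONES C7 C N kF kG kE = true) :
    (∃ v, kF v = true) ∨ (∃ v u, kG v u = true) ∨ kE = true := by
  rw [pick1, frc_eq, frc_eq, frc_eq, frc_eq] at h
  rcases bif_true h with ⟨_, h⟩ | ⟨_, h⟩
  · exact Or.inr (pick2_sound h)
  · rw [frc_eq] at h; exact Or.inl ⟨_, h⟩

theorem loop_sound {n D k0 F REP M ONES C7 HIC FM : ℕ} {leaf : ℕ → Bool} {P : (ℕ → ℕ → Prop) → Prop}
    (hn : n ≤ 32) (hD : D < 32)
    (hH : ∀ v, row HIC v ≠ 0 → v < n ∧ F.testBit v = false)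
    (hP : ∀ E u w, u < n → w < n → F.testBit u = F.testBit w → P E → P (swE u w E))
    (hleaf : ∀ A E, leaf A = true → GE n E → (∀ i < 32, ∀ j < 32, (E i j ↔ bt A i j)) → ¬ P E) (fuel : ℕ) :
    ∀ A C B N h st, loop D k0 F REP M ONES C7 HIC FM leaf fuel A C B N h st = true → Wf n A C B → wfS n st →
      USat n F k0 P A C N ∧ okS n F k0 P st := by
  induction fuel with
  | zero => intro A C B N h st e; cases e
  | succ t ih =>
    intro A C B N h st e w ws
    have e : pick1 t REP M ONES C7 C N
      (fun v => bif' (vFail t D A C N v) (popS (loop D k0 F REP M ONES C7 HIC FM leaf t) h st) false)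
      (fun v u => bif' (vForce t D A C N v u)
        (add t A C B N v u fun A C B N => loop D k0 F REP M ONES C7 HIC FM leaf t A C B N h st) false)
      (pick3 t k0 HIC FM A C
        (fun v => bif' (vF t k0 F HIC A C v) (popS (loop D k0 F REP M ONES C7 HIC FM leaf t) h st) false)
        (bif' (Nat.beq C (nat_lit 0)) (bif' (leaf A) (popS (loop D k0 F REP M ONES C7 HIC FM leaf t) h st) false)
          (frc t (Nat.land (Nat.shiftRight h (nat_lit 5)) (nat_lit 31)) fun v =>
            frc t (Nat.land h (nat_lit 31)) fun u =>
            frc t (Nat.shiftRight h (nat_lit 10)) fun h => brn t D F A C B N v u h st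
              (loop D k0 F REP M ONES C7 HIC FM leaf t)))) = true := e
    rcases pick1_sound e with ⟨v, e⟩ | ⟨v, u, e⟩ | e
    · obtain ⟨e1, e2⟩ := bif_f e
      exact ⟨fun E g s => vFail_sound g.toGE hn hD w s e1, popS_sound ih e2 ws⟩
    · obtain ⟨e1, e2⟩ := bif_f e
      obtain ⟨_, _, _, A1, C1, B1, N1, e2, w1, s1⟩ := add_sound hn e2 w
      obtain ⟨u1, u2⟩ := ih _ _ _ _ _ _ e2 w1 ws
      exact ⟨fun E g s => u1 E g (s1 E g.toGE (vForce_sound g.toGE hn hD w s e1) s), u2⟩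
    · rcases pick3_sound e with ⟨v, e⟩ | e
      · obtain ⟨e1, e2⟩ := bif_f e
        exact ⟨fun E g s => vF_sound g hH s e1, popS_sound ih e2 ws⟩
      · rcases bif_true e with ⟨e1, e⟩ | ⟨_, e⟩
        · obtain ⟨e3, e2⟩ := bif_f e
          refine ⟨fun E g s => hleaf A E e3 g.toGE ?_ g.p, popS_sound ih e2 ws⟩
          have hC : C = 0 := beq_t e1
          intro i hi j hj
          refine ⟨fun f => ?_, s.aE i hi j hj⟩
          rcases s.ec i j f with x | x
          · exact x
          · rw [hC] at x; simp [bt] at x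
        · rw [frc_eq, frc_eq, frc_eq] at e
          exact brn_sound hn hP ih (Nat.and_lt_two_pow _ (by norm_num : 31 < 2 ^ 5)) e w ws

theorem addAll_sound {n : ℕ} (hn : n ≤ 32) {k : ℕ → ℕ → ℕ → ℕ → Bool} (es : List (ℕ × ℕ)) :
    ∀ A C B N, addAll es k A C B N = true → Wf n A C B →
    ∃ A' C' B' N', k A' C' B' N' = true ∧ Wf n A' C' B' ∧
      ∀ E, GE n E → (∀ e ∈ es, E e.1 e.2) → St E A C N → St E A' C' N' := by
  induction es with
  | nil => intro A C B N h w; exact ⟨A, C, B, N, h, w, fun _ _ _ s => s⟩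
  | cons e es ih =>
    intro A C B N h w
    have h : add (nat_lit 0) A C B N e.1 e.2 (addAll es k) = true := h
    obtain ⟨_, _, _, A1, C1, B1, N1, h, w1, s1⟩ := add_sound hn h w
    obtain ⟨A2, C2, B2, N2, h, w2, s2⟩ := ih _ _ _ _ h w1
    refine ⟨_, _, _, _, h, w2, fun E g he s => s2 E g (fun x hx => he x (List.mem_cons_of_mem _ hx))
      (s1 E g (he e List.mem_cons_self) s)⟩

end Sound3

section Sound4

theorem lanes_succ (n : ℕ) (g : ℕ → ℕ) : lanes (n + 1) g = lanes n g + g n * 2 ^ (32 * n) := rfl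

theorem lanes_lt (n : ℕ) (g : ℕ → ℕ) (hg : ∀ i < n, g i < 2 ^ 32) : lanes n g < 2 ^ (32 * n) := by
  induction n with
  | zero => change 0 < 2 ^ (32 * 0); simp
  | succ n ih =>
    have h1 := ih fun i hi => hg i (by omega)
    have h2 := hg n (by omega)
    rw [lanes_succ, show 32 * (n + 1) = 32 * n + 32 by ring, pow_add]
    have : g n + 1 ≤ 2 ^ 32 := h2
    have := Nat.mul_le_mul_left (2 ^ (32 * n)) this
    nlinarith

theorem row_zero_of_lt {A i : ℕ} (h : A < 2 ^ (32 * i)) : row A i = 0 := by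
  rw [row_eq, Nat.div_eq_of_lt h]; rfl

theorem row_lanes (n : ℕ) (g : ℕ → ℕ) (hg : ∀ i < n, g i < 2 ^ 32) (i : ℕ) :
    row (lanes n g) i = if i < n then g i else 0 := by
  induction n with
  | zero => exact row_zero_of_lt (by change 0 < _; positivity)
  | succ n ih =>
    have h0 := ih fun i hi => hg i (by omega)
    have h1 := lanes_lt n g fun i hi => hg i (by omega)
    rcases lt_trichotomy i n with h | h | h
    · rw [if_pos (by omega)]
      rw [if_pos h] at h0
      rw [← h0, lanes_succ, row_eq, row_eq]
      obtain ⟨d, rfl⟩ : ∃ d, n = i + 1 + d := ⟨n - i - 1, by omega⟩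
      have : lanes (i + 1 + d) g + g (i + 1 + d) * 2 ^ (32 * (i + 1 + d)) =
          lanes (i + 1 + d) g + 2 ^ (32 * i) * (2 ^ 32 * (2 ^ (32 * d) * g (i + 1 + d))) := by
        rw [show 32 * (i + 1 + d) = 32 * i + 32 + 32 * d by ring, pow_add, pow_add]; ring
      rw [this, Nat.add_mul_div_left _ _ (by positivity), Nat.add_mul_mod_self_left]
    · subst h
      rw [if_pos (by omega), lanes_succ, row_eq, Nat.add_mul_div_right _ _ (by positivity), Nat.div_eq_of_lt h1,
        Nat.zero_add, Nat.mod_eq_of_lt (hg i (by omega))]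
    · rw [if_neg (by omega)]
      apply row_zero_of_lt
      exact lt_of_lt_of_le (lanes_lt _ _ hg) (Nat.pow_le_pow_right (by norm_num) (by omega))

theorem lanes_bt {n : ℕ} {g : ℕ → ℕ} (hg : ∀ i < n, g i < 2 ^ 32) {i j : ℕ} (hj : j < 32) :
    bt (lanes n g) i j ↔ i < n ∧ (g i).testBit j = true := by
  rw [← row_bt hj, row_lanes n g hg]
  split_ifs with h <;> simp [h]

theorem msk_lt (n : ℕ) (g : ℕ → Bool) : msk n g < 2 ^ n := by
  induction n with
  | zero => change 0 < _; simp
  | succ n ih =>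
    change msk n g + (bif g n then 1 else 0) * 2 ^ n < 2 ^ (n + 1)
    rw [pow_succ]
    cases g n
    · simp; omega
    · simp; omega

theorem msk_tb (n : ℕ) (g : ℕ → Bool) (i : ℕ) : (msk n g).testBit i = true ↔ i < n ∧ g i = true := by
  induction n with
  | zero => change (0 : ℕ).testBit i = true ↔ _; simp
  | succ n ih =>
    have e : msk (n + 1) g = 2 ^ n * (bif g n then 1 else 0) + msk n g := by
      change msk n g + (bif g n then 1 else 0) * 2 ^ n = _; ring
    rw [e, Nat.testBit_two_pow_mul_add _ (msk_lt n g)]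
    rcases lt_trichotomy i n with h | h | h
    · rw [if_pos h, ih]; simp [h]; omega
    · subst h; rw [if_neg (by omega)]; cases g i <;> simp
    · rw [if_neg (by omega)]
      have : ¬ i < n + 1 := by omega
      simp only [this, false_and, iff_false]
      cases g n
      · simp
      · simp only [cond_true]; rw [one_tb]; omega

theorem initC_tb {n F : ℕ} {noll : Bool} (hn : n ≤ 32) {i j : ℕ} (hj : j < 32) :
    bt (initC n noll F) i j ↔ i < n ∧ j < n ∧ j ≠ i ∧
      ¬ (noll = true ∧ F.testBit i = true ∧ F.testBit j = true) := by
  have hg : ∀ i < n, rmv (2 ^ n - 1) (Nat.lor (2 ^ i) (bif noll && F.testBit i then F else 0)) < 2 ^ 32 := by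
    intro i _
    apply Nat.lt_pow_two_of_testBit
    intro p hp
    rw [Bool.eq_false_iff, Ne, rmv_tb, Nat.testBit_two_pow_sub_one, decide_eq_true_iff]
    omega
  rw [initC, lanes_bt hg hj, rmv_tb, Nat.testBit_two_pow_sub_one, lor_tb, decide_eq_true_iff,
    Nat.testBit_two_pow, decide_eq_true_iff]
  have : (bif noll && F.testBit i then F else 0).testBit j = true ↔
      (noll = true ∧ F.testBit i = true ∧ F.testBit j = true) := by
    cases noll <;> cases F.testBit i <;> simp
  rw [this, not_or]
  constructor
  · rintro ⟨a, b, c, d⟩; exact ⟨a, b, fun h => c h.symm, d⟩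
  · rintro ⟨a, b, c, d⟩; exact ⟨a, b, fun h => c h.symm, d⟩

theorem initC_lt {n F : ℕ} {noll : Bool} (hn : n ≤ 32) : initC n noll F < 2 ^ (32 * n) := by
  apply lanes_lt
  intro i _
  apply Nat.lt_pow_two_of_testBit
  intro p hp
  rw [Bool.eq_false_iff, Ne, rmv_tb, Nat.testBit_two_pow_sub_one, decide_eq_true_iff]
  omega

theorem zero_bt {i j : ℕ} : ¬ bt 0 i j := by simp [bt]

theorem F_tb (c : Cas) (ls : List ℕ) (i : ℕ) : (c.F ls).testBit i = true ↔ i < c.n ∧ ls.getD i 0 = c.lo := by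
  rw [Cas.F, msk_tb]
  exact and_congr_right fun _ => ⟨beq_t, fun h => by rw [h]; exact Nat.beq_refl _⟩

open Classical in
theorem run_sound (c : Cas) (leaf : ℕ → ℕ → Bool) (P : ℕ → (ℕ → ℕ → Prop) → Prop) (H L : List ℕ) (h : ℕ)
    (hrun : c.run leaf H L h = true) (hn : c.n ≤ 32) (hD : c.D < 32)
    (hP : ∀ F E u w, u < c.n → w < c.n → F.testBit u = F.testBit w → P F E → P F (swE u w E))
    (hleaf : ∀ F A E, leaf F A = true → GE c.n E → (∀ i < 32, ∀ j < 32, (E i j ↔ bt A i j)) → ¬ P F E)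
    (E : ℕ → ℕ → Prop) (g : Gd c.n (c.F (c.labs H L)) c.k0 (P (c.F (c.labs H L))) E)
    (he : ∀ e ∈ c.edges, E e.1 e.2)
    (hdeg : ∀ i < c.n, ((Finset.range 32).filter (E i)).card = (c.labs H L).getD i 0)
    (hno : c.noll = true → ∀ i j, E i j → (c.F (c.labs H L)).testBit i = true →
      (c.F (c.labs H L)).testBit j = true → False) : False := by
  rw [Cas.run] at hrun
  simp only [frc_eq] at hrun
  obtain ⟨F, hF⟩ : ∃ F, F = c.F (c.labs H L) := ⟨_, rfl⟩
  rw [← hF] at hrun g hno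
  have w0 : Wf c.n 0 (initC c.n c.noll F) 0 := by
    refine ⟨fun _ _ _ _ h => (zero_bt h).elim, fun _ _ _ _ h => (zero_bt h).elim, ?_, ?_, ?_,
      fun _ _ _ _ h => (zero_bt h).elim, fun _ _ _ _ h => (zero_bt h).elim⟩
    · intro i hi j hj
      rw [initC_tb hn hj, initC_tb hn hi]
      rintro ⟨a, b, e, d⟩
      exact ⟨b, a, fun h => e h.symm, fun h => d ⟨h.1, h.2.2, h.2.1⟩⟩
    · intro i hi
      rw [initC_tb hn hi]; tauto
    · intro p hp
      have e : p = 32 * (p / 32) + p % 32 := by omega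
      have hp' : bt (initC c.n c.noll F) (p / 32) (p % 32) := by rw [bt, ← e]; exact hp
      rw [initC_tb hn (by omega)] at hp'
      exact ⟨hp'.1, hp'.2.1⟩
  obtain ⟨A, C, B, N, hk, w1, s1⟩ := addAll_sound hn _ _ _ _ _ hrun w0
  have hH : ∀ v, row (c.HIC F) v ≠ 0 → v < c.n ∧ F.testBit v = false := by
    intro v hv
    rw [Cas.HIC, row_lanes _ _ (by intro i _; cases F.testBit i <;> simp)] at hv
    split_ifs at hv with h
    · refine ⟨h, ?_⟩
      cases hf : F.testBit v
      · rfl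
      · simp [hf] at hv
    · exact absurd rfl hv
  obtain ⟨u1, _⟩ := loop_sound hn hD hH (hP F) (hleaf F) _ _ _ _ _ _ _ hk w1 trivial
  refine u1 E g (s1 E g.toGE he ?_)
  have hb : ∀ i j, E i j → bt (initC c.n c.noll F) i j := by
    intro i j e
    have h1 := g.supp _ _ e
    have h2 := g.supp2 e
    rw [initC_tb hn (by omega)]
    exact ⟨h1, h2, fun h => g.irr _ (h ▸ e), fun h => hno h.1 i j e h.2.1 h.2.2⟩
  refine ⟨fun _ _ _ _ h => (zero_bt h).elim, fun i j e => Or.inr (hb i j e), fun i => ?_⟩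
  have e1 : cntS E (initC c.n c.noll F) i = (Finset.range 32).filter (E i) := by
    ext j
    rw [mem_cntS, Finset.mem_filter, Finset.mem_range]
    exact ⟨fun h => ⟨h.1, h.2.1⟩, fun h => ⟨h.1, h.2, hb i j h.2⟩⟩
  rw [e1, row_lanes]
  · split_ifs with hi
    · exact hdeg i hi
    · rw [Finset.card_eq_zero, Finset.eq_empty_iff_forall_notMem]
      intro j hj
      rw [Finset.mem_filter] at hj
      exact hi (g.supp _ _ hj.2)
  · intro i hi
    rw [← hdeg i hi]
    refine lt_of_le_of_lt (Finset.card_filter_le _ _) ?_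
    simp

theorem all_mem (c : Cas) (leaf : ℕ → ℕ → Bool) : ∀ (ts : List (List ℕ × List ℕ)) (hs : List ℕ),
    c.all leaf ts hs = true → ∀ t ∈ ts, ∃ h, c.run leaf t.1 t.2 h = true := by
  intro ts
  induction ts with
  | nil => intro hs _ t ht; simp at ht
  | cons t ts ih =>
    intro hs h x hx
    rw [Cas.all, Bool.and_eq_true] at h
    rcases List.mem_cons.1 hx with rfl | hx
    · exact ⟨_, h.1⟩
    · exact ih _ h.2 x hx

theorem gen_succ (k : ℕ) (ks : List ℕ) (d : ℕ) :
    gen (k :: ks) (d + 1) = (gen (k :: ks) d).map (fun l => k :: l) ++ gen ks (d + 1) := by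
  simp only [gen]

theorem gen_zero (ks : List ℕ) : gen ks 0 = [[]] := by
  cases ks
  · simp only [gen]; rfl
  · simp only [gen]; rfl

theorem gen_mem (ks : List ℕ) : ∀ (d : ℕ) (l : List ℕ), l.length = d → (∀ a ∈ l, a ∈ ks) →
    ∃ l' ∈ gen ks d, l'.Perm l := by
  induction ks with
  | nil =>
    intro d l hd hl
    have : l = [] := List.eq_nil_iff_forall_not_mem.2 fun a ha => by simpa using hl a ha
    subst this
    subst hd
    exact ⟨[], by rw [List.length_nil, gen_zero]; simp, List.Perm.refl _⟩
  | cons k ks ih =>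
    intro d
    induction d with
    | zero =>
      intro l hd _
      rw [List.length_eq_zero_iff] at hd
      subst hd
      exact ⟨[], by rw [gen_zero]; simp, List.Perm.refl _⟩
    | succ d ihd =>
      intro l hd hl
      rw [gen_succ]
      by_cases hk : k ∈ l
      · obtain ⟨l', h1, h2⟩ := ihd (l.erase k) (by rw [List.length_erase_of_mem hk]; omega)
          fun a ha => hl a (List.mem_of_mem_erase ha)
        refine ⟨k :: l', ?_, ?_⟩
        · rw [List.mem_append]; exact Or.inl (List.mem_map.2 ⟨l', h1, rfl⟩)
        · exact (h2.cons k).trans (List.perm_cons_erase hk).symm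
      · obtain ⟨l', h1, h2⟩ := ih (d + 1) l hd fun a ha => by
          rcases List.mem_cons.1 (hl a ha) with rfl | h
          · exact (hk ha).elim
          · exact h
        exact ⟨l', List.mem_append.2 (Or.inr h1), h2⟩

theorem perm_lift {α : Type*} (key : α → ℕ) (l' : List ℕ) (ys : List α) (h : l'.Perm (ys.map key)) :
    ∃ zs : List α, zs.Perm ys ∧ zs.map key = l' := by
  have h2 : List.Forall₂ (fun (a : ℕ) (b : α) => key b = a) (ys.map key) ys := by
    rw [List.forall₂_map_left_iff, List.forall₂_same]; intros; rfl
  obtain ⟨m, h3, h4⟩ := List.perm_comp_forall₂ h h2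
  refine ⟨m, h4, ?_⟩
  clear h h2 h4
  induction h3 with
  | nil => rfl
  | cons a _ ih => rw [List.map_cons, a, ih]

end Sound4

section Emb

open Classical in
noncomputable def nb {V : Type} [Fintype V] (G : SimpleGraph V) (v : V) : Finset V :=
  Finset.univ.filter fun w => G.Adj v w

theorem mem_nb {V : Type} [Fintype V] {G : SimpleGraph V} {v w : V} : w ∈ nb G v ↔ G.Adj v w := by
  simp [nb]

noncomputable def dg {V : Type} [Fintype V] (G : SimpleGraph V) (v : V) : ℕ := (nb G v).card

noncomputable def sd {V : Type} [Fintype V] (G : SimpleGraph V) : ℕ := ∑ v, dg G v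

noncomputable def lonb {V : Type} [Fintype V] (G : SimpleGraph V) (lo : ℕ) (v : V) : ℕ :=
  ((nb G v).filter fun w => dg G w = lo).card

structure C4F {V : Type} (G : SimpleGraph V) : Prop where
  tri : ∀ a b c, G.Adj a b → G.Adj b c → G.Adj c a → False
  c4 : ∀ a b c d, G.Adj a b → G.Adj b c → G.Adj c d → G.Adj d a → a = c ∨ b = d

def EL {V : Type} (G : SimpleGraph V) (Ls : List V) (i j : ℕ) : Prop :=
  ∃ a b, Ls[i]? = some a ∧ Ls[j]? = some b ∧ G.Adj a b

theorem nd_inj {V : Type} {Ls : List V} (h : Ls.Nodup) {i j : ℕ} {a : V} (hi : Ls[i]? = some a)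
    (hj : Ls[j]? = some a) : i = j := by
  obtain ⟨h1, h2⟩ := List.getElem?_eq_some_iff.1 hi
  obtain ⟨h3, h4⟩ := List.getElem?_eq_some_iff.1 hj
  exact (h.getElem_inj_iff (hi := h1) (hj := h3)).1 (h2.trans h4.symm)

theorem card_idx {V : Type} (Ls : List V) (hnd : Ls.Nodup) (hc : ∀ v, v ∈ Ls)
    (hl : Ls.length ≤ 32) (S : Finset V) (R : Finset ℕ)
    (hR : ∀ j, j ∈ R ↔ j < 32 ∧ ∃ b, Ls[j]? = some b ∧ b ∈ S) :
    R.card = S.card := by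
  classical
  symm
  have hx : ∀ v, Ls[Ls.idxOf v]? = some v := fun v => by
    have := List.idxOf_lt_length_iff.2 (hc v)
    rw [List.getElem?_eq_getElem this, List.getElem_idxOf this]
  apply Finset.card_bij (fun v _ => Ls.idxOf v)
  · intro v hv
    rw [hR]
    have := List.idxOf_lt_length_iff.2 (hc v)
    exact ⟨by omega, v, hx v, hv⟩
  · intro a _ b _ h
    have h1 := hx a
    have h2 := hx b
    rw [h] at h1
    rw [h1] at h2
    exact Option.some_injective _ h2
  · intro j hj
    rw [hR] at hj
    obtain ⟨_, b, h1, h2⟩ := hj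
    exact ⟨b, h2, nd_inj hnd (hx b) h1⟩

theorem EL_GE {V : Type} {G : SimpleGraph V} (hG : C4F G) {Ls : List V} (hnd : Ls.Nodup) :
    GE Ls.length (EL G Ls) := by
  refine ⟨?_, ?_, ?_, ?_, ?_⟩
  · rintro i j ⟨a, b, h1, h2, h3⟩; exact ⟨b, a, h2, h1, h3.symm⟩
  · rintro i ⟨a, b, h1, h2, h3⟩
    rw [h1] at h2
    exact h3.ne (Option.some_injective _ h2)
  · rintro i j ⟨a, b, h1, h2, h3⟩; exact (List.getElem?_eq_some_iff.1 h1).1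
  · rintro i j k ⟨a, b, h1, h2, h3⟩ ⟨b', c, h4, h5, h6⟩ ⟨c', a', h7, h8, h9⟩
    obtain rfl : b = b' := Option.some_injective _ (h2.symm.trans h4)
    obtain rfl : c = c' := Option.some_injective _ (h5.symm.trans h7)
    obtain rfl : a = a' := Option.some_injective _ (h1.symm.trans h8)
    exact hG.tri a b c h3 h6 h9
  · rintro i j k l ⟨a, b, h1, h2, h3⟩ ⟨b', c, h4, h5, h6⟩ ⟨c', d, h7, h8, h9⟩ ⟨d', a', h10, h11, h12⟩
    obtain rfl : b = b' := Option.some_injective _ (h2.symm.trans h4)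
    obtain rfl : c = c' := Option.some_injective _ (h5.symm.trans h7)
    obtain rfl : d = d' := Option.some_injective _ (h8.symm.trans h10)
    obtain rfl : a = a' := Option.some_injective _ (h1.symm.trans h11)
    rcases hG.c4 a b c d h3 h6 h9 h12 with rfl | rfl
    · exact Or.inl (nd_inj hnd h1 h5)
    · exact Or.inr (nd_inj hnd h2 h8)

theorem gEdges_sound {V : Type} (Ls : List V) (grp : V → List V) : ∀ (ws : List V) (i s : ℕ) (p q : List V),
    Ls.drop i = ws ++ p → Ls.drop s = ws.flatMap grp ++ q →
    ∀ e ∈ gEdges i s (ws.map fun w => (grp w).length),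
      ∃ a b, Ls[e.1]? = some a ∧ Ls[e.2]? = some b ∧ a ∈ ws ∧ b ∈ grp a := by
  intro ws
  induction ws with
  | nil => intro i s p q _ _ e he; simp [gEdges] at he
  | cons w ws ih =>
    intro i s p q hp hq e he
    rw [List.map_cons, gEdges, List.mem_append] at he
    rcases he with he | he
    · obtain ⟨j, hj, rfl⟩ := List.mem_map.1 he
      rw [List.mem_range'_1] at hj
      obtain ⟨d, rfl⟩ : ∃ d, j = s + d := ⟨j - s, by omega⟩
      have hd : d < (grp w).length := by omega
      refine ⟨w, (grp w)[d], ?_, ?_, by simp, List.getElem_mem _⟩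
      · have : (Ls.drop i)[0]? = some w := by rw [hp]; rfl
        rw [List.getElem?_drop] at this
        simpa using this
      · have : (Ls.drop s)[d]? = some (grp w)[d] := by
          rw [hq, List.flatMap_cons, List.append_assoc, List.getElem?_append_left hd,
            List.getElem?_eq_getElem hd]
        rw [List.getElem?_drop] at this
        exact this
    · obtain ⟨a, b, h1, h2, h3, h4⟩ := ih (i + 1) (s + (grp w).length) p q
        (by rw [← List.drop_drop, hp]; rfl)
        (by rw [← List.drop_drop, hq, List.flatMap_cons, List.append_assoc, List.drop_left]) e he
      exact ⟨a, b, h1, h2, List.mem_cons_of_mem _ h3, h4⟩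

theorem groupLabs_count {lo hi : ℕ} (h : lo ≠ hi) (sz : ℕ) (keys : List ℕ) :
    (groupLabs lo hi sz keys).count lo = keys.sum := by
  induction keys with
  | nil => rfl
  | cons k ks ih =>
    rw [groupLabs, List.flatMap_cons, List.count_append]
    rw [groupLabs] at ih
    rw [ih, List.count_append, List.count_replicate_self, List.count_replicate, List.sum_cons]
    simp [h.symm]

theorem map_const {V : Type} (f : V → ℕ) (l : List V) (k : ℕ) (h : ∀ v ∈ l, f v = k) :
    l.map f = List.replicate l.length k := by
  rw [List.eq_replicate_iff]
  refine ⟨by simp, fun b hb => ?_⟩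
  obtain ⟨v, hv, rfl⟩ := List.mem_map.1 hb
  exact h v hv

open Classical in
noncomputable def grp {V : Type} [Fintype V] (G : SimpleGraph V) (x : V) (lo : ℕ) (y : V) : List V :=
  ((nb G y).filter fun w => dg G w = lo).toList ++ ((nb G y).filter fun w => dg G w ≠ lo ∧ w ≠ x).toList

theorem mem_grp {V : Type} [Fintype V] {G : SimpleGraph V} {x : V} {lo : ℕ} (hx : dg G x ≠ lo) {y w : V} :
    w ∈ grp G x lo y ↔ G.Adj y w ∧ w ≠ x := by
  simp only [grp, List.mem_append, Finset.mem_toList, Finset.mem_filter, mem_nb]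
  by_cases h : dg G w = lo
  · simp only [h, and_true, ne_eq, not_true, false_and, and_false, or_false]
    exact ⟨fun a => ⟨a, fun e => hx (e ▸ h)⟩, fun a => a.1⟩
  · simp [h]

theorem grp_nodup {V : Type} [Fintype V] {G : SimpleGraph V} {x : V} {lo : ℕ} {y : V} :
    (grp G x lo y).Nodup := by
  refine List.Nodup.append (Finset.nodup_toList _) (Finset.nodup_toList _) ?_
  intro a h1 h2
  simp only [Finset.mem_toList, Finset.mem_filter] at h1 h2
  exact h2.2.1 h1.2

theorem grp_len {V : Type} [Fintype V] {G : SimpleGraph V} {x : V} {lo : ℕ} (hx : dg G x ≠ lo) {y : V}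
    (h : G.Adj x y) : (grp G x lo y).length + 1 = dg G y := by
  classical
  have e : nb G y = insert x (grp G x lo y).toFinset := by
    ext w
    rw [mem_nb, Finset.mem_insert, List.mem_toFinset, mem_grp hx]
    constructor
    · intro h; by_cases hw : w = x
      · exact Or.inl hw
      · exact Or.inr ⟨h, hw⟩
    · rintro (rfl | h')
      · exact h.symm
      · exact h'.1
  rw [dg, e, Finset.card_insert_of_notMem, List.toFinset_card_of_nodup grp_nodup]
  rw [List.mem_toFinset, mem_grp hx]
  exact fun h => h.2 rfl

theorem grp_map {V : Type} [Fintype V] {G : SimpleGraph V} {x : V} {lo hi : ℕ} (hx : dg G x ≠ lo)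
    (hd : ∀ v, v ≠ x → dg G v = lo ∨ dg G v = hi) {y : V} (h : G.Adj x y) :
    (grp G x lo y).map (dg G) =
      List.replicate (lonb G lo y) lo ++ List.replicate (dg G y - 1 - lonb G lo y) hi := by
  classical
  have h1 := grp_len hx h
  rw [grp, List.length_append, Finset.length_toList, Finset.length_toList] at h1
  rw [grp, List.map_append, map_const _ _ lo, map_const _ _ hi, Finset.length_toList, Finset.length_toList]
  · congr 2
    rw [lonb]
    omega
  · intro v hv
    rw [Finset.mem_toList, Finset.mem_filter] at hv
    exact (hd v hv.2.2).resolve_left hv.2.1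
  · intro v hv
    rw [Finset.mem_toList, Finset.mem_filter] at hv
    exact hv.2

theorem flat_map {V : Type} [Fintype V] {G : SimpleGraph V} {x : V} {lo hi : ℕ} (hx : dg G x ≠ lo)
    (hd : ∀ v, v ≠ x → dg G v = lo ∨ dg G v = hi) (sz : ℕ) (ys : List V)
    (h : ∀ y ∈ ys, G.Adj x y ∧ dg G y = sz) :
    (ys.flatMap (grp G x lo)).map (dg G) = groupLabs lo hi (sz - 1) (ys.map (lonb G lo)) := by
  induction ys with
  | nil => rfl
  | cons y ys ih =>
    have h0 := h y (by simp)
    rw [List.flatMap_cons, List.map_append, ih fun z hz => h z (by simp [hz]), List.map_cons, groupLabs,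
      groupLabs, List.flatMap_cons, grp_map hx hd h0.1, h0.2]

end Emb

section NoGraph

theorem sizes_arith {n p ar hi lo r1 r2 : ℕ} (hhi : 1 ≤ hi) (hlo : 1 ≤ lo)
    (e : 1 + (p + ar) + (p * (hi - 1) + ar * (lo - 1)) + (r1 + r2) = n) :
    n - 1 - hi * p - lo * ar = r1 + r2 := by
  obtain ⟨a, rfl⟩ : ∃ a, hi = a + 1 := ⟨hi - 1, by omega⟩
  obtain ⟨b, rfl⟩ : ∃ b, lo = b + 1 := ⟨lo - 1, by omega⟩
  simp only [Nat.add_sub_cancel] at e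
  subst e
  have e1 : (a + 1) * p = p * a + p := by ring
  have e2 : (b + 1) * ar = ar * b + ar := by ring
  rw [e1, e2]
  omega

theorem no_graph (c : Cas) (leaf : ℕ → ℕ → Bool) (P : ℕ → (ℕ → ℕ → Prop) → Prop) (hk lk : List ℕ)
    (hs : List ℕ) (hall : c.all leaf (c.types hk lk) hs = true)
    (hn : c.n ≤ 32) (hD : c.D < 32) (har : c.ar ≤ c.D) (hlo : 1 ≤ c.lo) (hhi : 1 ≤ c.hi)
    (hDlo : c.D ≠ c.lo) (hlh : c.lo ≠ c.hi)
    (hP : ∀ F E u w, u < c.n → w < c.n → F.testBit u = F.testBit w → P F E → P F (swE u w E))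
    (hleaf : ∀ F A E, leaf F A = true → GE c.n E → (∀ i < 32, ∀ j < 32, (E i j ↔ bt A i j)) → ¬ P F E)
    {V : Type} [Fintype V] {G : SimpleGraph V} (hG : C4F G) (hV : Fintype.card V = c.n) (x : V)
    (hx : dg G x = c.D) (hd : ∀ v, v ≠ x → dg G v = c.lo ∨ dg G v = c.hi)
    (hax : lonb G c.lo x = c.ar)
    (hnl : (Finset.univ.filter fun v => dg G v = c.lo).card = c.nl)
    (hno : c.noll = true → ∀ v w, G.Adj v w → dg G v = c.lo → dg G w = c.lo → False)
    (hk0 : ∀ v, dg G v ≠ c.lo → c.k0 ≤ lonb G c.lo v)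
    (hhk : ∀ v, G.Adj x v → dg G v = c.hi → lonb G c.lo v ∈ hk)
    (hlk : ∀ v, G.Adj x v → dg G v = c.lo → lonb G c.lo v ∈ lk)
    (hP0 : ∀ Ls : List V, Ls.Nodup → (∀ v, v ∈ Ls) → ∀ F : ℕ,
      (∀ i v, Ls[i]? = some v → (F.testBit i = true ↔ dg G v = c.lo)) → P F (EL G Ls)) : False := by
  classical
  have hxlo : dg G x ≠ c.lo := by rw [hx]; exact hDlo
  -- the two classes of neighbours
  have hYZ : ((nb G x).filter fun w => dg G w = c.hi).card = c.D - c.ar := by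
    have h1 := Finset.card_filter_add_card_filter_not (s := nb G x) (fun w => dg G w = c.lo)
    have h2 : ((nb G x).filter fun w => ¬ dg G w = c.lo) = (nb G x).filter fun w => dg G w = c.hi := by
      apply Finset.filter_congr
      intro w hw
      rw [mem_nb] at hw
      have := hd w hw.ne'
      constructor
      · intro h; exact this.resolve_left h
      · intro h h'; exact hlh (h'.symm.trans h)
    rw [h2] at h1
    rw [lonb] at hax
    rw [dg] at hx
    omega
  obtain ⟨H, hH, hHp⟩ := gen_mem hk (c.D - c.ar)
    ((((nb G x).filter fun w => dg G w = c.hi).toList).map (lonb G c.lo)) (by simp [hYZ]) (by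
      intro a ha
      obtain ⟨v, hv, rfl⟩ := List.mem_map.1 ha
      rw [Finset.mem_toList, Finset.mem_filter, mem_nb] at hv
      exact hhk v hv.1 hv.2)
  obtain ⟨L, hL, hLp⟩ := gen_mem lk c.ar
    ((((nb G x).filter fun w => dg G w = c.lo).toList).map (lonb G c.lo)) (by
      rw [List.length_map, Finset.length_toList]; exact hax) (by
      intro a ha
      obtain ⟨v, hv, rfl⟩ := List.mem_map.1 ha
      rw [Finset.mem_toList, Finset.mem_filter, mem_nb] at hv
      exact hlk v hv.1 hv.2)
  obtain ⟨ys, hys, rfl⟩ := perm_lift _ _ _ hHp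
  obtain ⟨zs, hzs, rfl⟩ := perm_lift _ _ _ hLp
  have mys : ∀ v, v ∈ ys ↔ G.Adj x v ∧ dg G v = c.hi := fun v => by
    rw [hys.mem_iff, Finset.mem_toList, Finset.mem_filter, mem_nb]
  have mzs : ∀ v, v ∈ zs ↔ G.Adj x v ∧ dg G v = c.lo := fun v => by
    rw [hzs.mem_iff, Finset.mem_toList, Finset.mem_filter, mem_nb]
  have ndys : ys.Nodup := hys.nodup_iff.2 (Finset.nodup_toList _)
  have ndzs : zs.Nodup := hzs.nodup_iff.2 (Finset.nodup_toList _)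
  have lys : ys.length = c.D - c.ar := by rw [hys.length_eq, Finset.length_toList, hYZ]
  have lzs : zs.length = c.ar := by rw [hzs.length_eq, Finset.length_toList]; exact hax
  have mws : ∀ v, v ∈ ys ++ zs ↔ G.Adj x v := fun v => by
    rw [List.mem_append, mys, mzs, ← and_or_left]
    exact ⟨fun h => h.1, fun h => ⟨h, (hd v h.ne').symm⟩⟩
  have ndws : (ys ++ zs).Nodup := ndys.append ndzs fun a h1 h2 =>
    hlh (((mzs a).1 h2).2.symm.trans ((mys a).1 h1).2)
  obtain ⟨ws, hws⟩ : ∃ ws, ws = ys ++ zs := ⟨_, rfl⟩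
  rw [← hws] at mws ndws
  obtain ⟨pre, hpre⟩ : ∃ pre, pre = x :: (ws ++ ws.flatMap (grp G x c.lo)) := ⟨_, rfl⟩
  have ndpre : pre.Nodup := by
    rw [hpre, List.nodup_cons]
    constructor
    · rw [List.mem_append, mws, List.mem_flatMap]
      rintro (h | ⟨w, _, h⟩)
      · exact h.ne rfl
      · exact ((mem_grp hxlo).1 h).2 rfl
    · refine ndws.append ?_ ?_
      · rw [List.nodup_flatMap]
        refine ⟨fun _ _ => grp_nodup, ?_⟩
        refine List.Pairwise.imp_of_mem ?_ ndws
        intro a b ha hb hab w h1 h2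
        rw [mws] at ha hb
        rw [mem_grp hxlo] at h1 h2
        rcases hG.c4 a w b x h1.1 h2.1.symm hb.symm ha with h | h
        · exact hab h
        · exact h1.2 h
      · intro w h1 h2
        obtain ⟨a, ha, h2⟩ := List.mem_flatMap.1 h2
        rw [mws] at ha h1
        rw [mem_grp hxlo] at h2
        exact hG.tri x a w ha h2.1 h1.symm
  obtain ⟨Rl, hRl⟩ : ∃ l : List V, l = (Finset.univ.filter fun v => v ∉ pre ∧ dg G v = c.lo).toList :=
    ⟨_, rfl⟩
  obtain ⟨Rh, hRh⟩ : ∃ l : List V, l = (Finset.univ.filter fun v => v ∉ pre ∧ dg G v ≠ c.lo).toList :=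
    ⟨_, rfl⟩
  have mRl : ∀ v, v ∈ Rl ↔ v ∉ pre ∧ dg G v = c.lo := fun v => by
    rw [hRl, Finset.mem_toList, Finset.mem_filter]; simp
  have mRh : ∀ v, v ∈ Rh ↔ v ∉ pre ∧ dg G v ≠ c.lo := fun v => by
    rw [hRh, Finset.mem_toList, Finset.mem_filter]; simp
  obtain ⟨Ls, hLs⟩ : ∃ Ls, Ls = pre ++ (Rl ++ Rh) := ⟨_, rfl⟩
  have nd : Ls.Nodup := by
    rw [hLs]
    refine ndpre.append (List.Nodup.append ?_ ?_ ?_) ?_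
    · rw [hRl]; exact Finset.nodup_toList _
    · rw [hRh]; exact Finset.nodup_toList _
    · intro a h1 h2; exact ((mRh a).1 h2).2 ((mRl a).1 h1).2
    · intro a h1 h2
      rcases List.mem_append.1 h2 with h2 | h2
      · exact ((mRl a).1 h2).1 h1
      · exact ((mRh a).1 h2).1 h1
  have cov : ∀ v, v ∈ Ls := by
    intro v
    rw [hLs, List.mem_append, List.mem_append, mRl, mRh]
    tauto
  have len : Ls.length = c.n := by
    rw [← hV, ← Finset.card_univ, ← List.toFinset_card_of_nodup nd]
    congr 1
    ext v; simp [cov]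
  have hmap : Ls.map (dg G) = [c.D] ++ List.replicate (c.D - c.ar) c.hi ++ List.replicate c.ar c.lo
      ++ groupLabs c.lo c.hi (c.hi - 1) (ys.map (lonb G c.lo))
      ++ groupLabs c.lo c.hi (c.lo - 1) (zs.map (lonb G c.lo))
      ++ List.replicate Rl.length c.lo ++ List.replicate Rh.length c.hi := by
    rw [hLs, hpre, hws]
    simp only [List.map_append, List.map_cons, List.flatMap_append, hx]
    rw [flat_map hxlo hd c.hi ys fun y hy => (mys y).1 hy, flat_map hxlo hd c.lo zs fun y hy => (mzs y).1 hy,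
      map_const (dg G) ys c.hi fun y hy => ((mys y).1 hy).2,
      map_const (dg G) zs c.lo fun y hy => ((mzs y).1 hy).2,
      map_const (dg G) Rl c.lo fun y hy => ((mRl y).1 hy).2,
      map_const (dg G) Rh c.hi, lys, lzs]
    · simp only [List.append_assoc, List.cons_append, List.nil_append]
    · intro v hv
      rw [mRh] at hv
      refine (hd v ?_).resolve_left hv.2
      rintro rfl
      exact hv.1 (by rw [hpre]; simp)
  have hsz : ws.map (fun w => (grp G x c.lo w).length) = c.sizes := by
    rw [hws, Cas.sizes, List.map_append, map_const _ ys (c.hi - 1), map_const _ zs (c.lo - 1), lys, lzs]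
    · intro v hv
      rw [mzs] at hv
      have := grp_len hxlo hv.1
      omega
    · intro v hv
      rw [mys] at hv
      have := grp_len hxlo hv.1
      omega
  have hcnt : c.ar + (ys.map (lonb G c.lo)).sum + (zs.map (lonb G c.lo)).sum + Rl.length = c.nl := by
    have h1 : (Ls.map (dg G)).count c.lo = c.nl := by
      rw [← hnl, List.count, List.countP_map, List.countP_eq_length_filter,
        ← List.toFinset_card_of_nodup (nd.filter _)]
      congr 1
      ext v
      simp [cov]
    rw [hmap] at h1
    simp only [List.count_append, groupLabs_count hlh, List.count_replicate_self] at h1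
    rw [List.count_replicate, List.count_replicate, List.count_singleton] at h1
    simp only [beq_iff_eq, hDlo, hlh.symm, if_false] at h1
    omega
  have hflen : (ws.flatMap (grp G x c.lo)).length = (c.D - c.ar) * (c.hi - 1) + c.ar * (c.lo - 1) := by
    rw [List.length_flatMap, hsz, Cas.sizes]
    simp
  have hr : c.r = Rl.length + Rh.length := by
    rw [Cas.r]
    apply sizes_arith hhi hlo
    rw [← len, hLs, hpre]
    simp only [List.length_append, List.length_cons]
    rw [hflen, hws, List.length_append, lys, lzs]
    omega
  have hlabs : c.labs (ys.map (lonb G c.lo)) (zs.map (lonb G c.lo)) = Ls.map (dg G) := by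
    rw [hmap, Cas.labs, hr]
    have e1 : c.nl - c.ar - (ys.map (lonb G c.lo)).sum - (zs.map (lonb G c.lo)).sum = Rl.length := by omega
    rw [e1, show Rl.length + Rh.length - Rl.length = Rh.length by omega]
  have hmem : (ys.map (lonb G c.lo), zs.map (lonb G c.lo)) ∈ c.types hk lk := by
    rw [Cas.types, List.mem_filter]
    constructor
    · rw [List.mem_flatMap]
      exact ⟨_, hH, List.mem_map.2 ⟨_, hL, rfl⟩⟩
    · rw [Bool.and_eq_true]
      refine ⟨Nat.ble_eq_true_of_le ?_, Nat.ble_eq_true_of_le ?_⟩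
      · simp only; omega
      · simp only; rw [hr]; omega
  obtain ⟨h, hrun⟩ := all_mem c leaf _ _ hall _ hmem
  have hFi : ∀ i v, Ls[i]? = some v →
      ((c.F (c.labs (ys.map (lonb G c.lo)) (zs.map (lonb G c.lo)))).testBit i = true ↔ dg G v = c.lo) := by
    intro i v hv
    obtain ⟨h1, h2⟩ := List.getElem?_eq_some_iff.1 hv
    rw [F_tb, hlabs, List.getD_eq_getElem?_getD, List.getElem?_map, hv, ← len]
    simp [h1]
  have hge : GE c.n (EL G Ls) := by rw [← len]; exact EL_GE hG nd
  refine run_sound c leaf P _ _ h hrun hn hD hP hleaf (EL G Ls) ⟨hge, ?_, hP0 Ls nd cov _ hFi⟩ ?_ ?_ ?_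
  · intro i hi hf
    rw [← len] at hi
    have hv : Ls[i]? = some Ls[i] := List.getElem?_eq_getElem hi
    have h1 : dg G Ls[i] ≠ c.lo := fun h => by
      rw [← hFi i _ hv, hf] at h; cases h
    refine le_trans (hk0 _ h1) (le_of_eq ?_)
    symm
    rw [lonb]
    apply card_idx Ls nd cov (by omega)
    intro j
    rw [mem_nbF]
    constructor
    · rintro ⟨a, ⟨u, w, e1, e2, e3⟩, d⟩
      refine ⟨a, w, e2, ?_⟩
      rw [Finset.mem_filter, mem_nb]
      rw [hv] at e1
      obtain rfl := Option.some_injective _ e1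
      exact ⟨e3, (hFi j w e2).1 d⟩
    · rintro ⟨a, w, e2, d⟩
      rw [Finset.mem_filter, mem_nb] at d
      exact ⟨a, ⟨_, w, hv, e2, d.1⟩, (hFi j w e2).2 d.2⟩
  · intro e he
    rw [Cas.edges, List.mem_append] at he
    rcases he with he | he
    · obtain ⟨j, hj, rfl⟩ := List.mem_map.1 he
      rw [List.mem_range'_1] at hj
      obtain ⟨d, rfl⟩ : ∃ d, j = d + 1 := ⟨j - 1, by omega⟩
      have hdw : d < ws.length := by rw [hws, List.length_append]; omega
      refine ⟨x, ws[d], by rw [hLs, hpre]; rfl, ?_, (mws _).1 (List.getElem_mem _)⟩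
      rw [hLs, hpre]
      simp only [List.cons_append, List.getElem?_cons_succ, List.append_assoc]
      rw [List.getElem?_append_left hdw, List.getElem?_eq_getElem hdw]
    · rw [← hsz] at he
      have hlw : ws.length = c.D := by rw [hws, List.length_append]; omega
      obtain ⟨a, b, h1, h2, h3, h4⟩ := gEdges_sound Ls (grp G x c.lo) ws 1 (1 + c.D)
        (ws.flatMap (grp G x c.lo) ++ (Rl ++ Rh)) (Rl ++ Rh) (by rw [hLs, hpre]; simp)
        (by rw [← List.drop_drop, hLs, hpre, ← hlw]; simp) e he
      exact ⟨a, b, h1, h2, ((mem_grp hxlo).1 h4).1⟩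
  · intro i hi
    rw [← len] at hi
    have hv : Ls[i]? = some Ls[i] := List.getElem?_eq_getElem hi
    rw [hlabs, List.getD_eq_getElem?_getD, List.getElem?_map, hv]
    change _ = dg G Ls[i]
    rw [dg]
    apply card_idx Ls nd cov (by omega)
    intro j
    rw [Finset.mem_filter, Finset.mem_range]
    constructor
    · rintro ⟨a, u, w, e1, e2, e3⟩
      rw [hv] at e1
      obtain rfl := Option.some_injective _ e1
      exact ⟨a, w, e2, mem_nb.2 e3⟩
    · rintro ⟨a, w, e2, d⟩
      exact ⟨a, _, w, hv, e2, mem_nb.1 d⟩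
  · rintro hnoll i j ⟨a, b, h1, h2, h3⟩ hf1 hf2
    exact hno hnoll a b h3 ((hFi _ _ h1).1 hf1) ((hFi _ _ h2).1 hf2)

end NoGraph

section Leaf

def dj (E : ℕ → ℕ → Prop) (a b : ℕ) : Prop := a ≠ b ∧ ¬ E a b ∧ ∀ k, E a k → E b k → False
def na (E : ℕ → ℕ → Prop) (a b : ℕ) : Prop := a ≠ b ∧ ¬ E a b

def P24 (F : ℕ) (E : ℕ → ℕ → Prop) : Prop :=
  ∃ t : Fin 6 → ℕ, (∀ i, t i < 24) ∧
    (∀ i j : Fin 6, i ≠ j → i.val / 3 = j.val / 3 → dj E (t i) (t j)) ∧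
    (∀ i j : Fin 6, i.val / 3 ≠ j.val / 3 → na E (t i) (t j)) ∧
    ¬ ((∀ i, F.testBit (t i) = true) ∧ ∃ v < 24, F.testBit v = false ∧
      ∀ w, E v w → F.testBit w = true → ∃ i, w = t i)

theorem P24_sw : ∀ F E u w, u < 24 → w < 24 → F.testBit u = F.testBit w → P24 F E → P24 F (swE u w E) := by
  rintro F E u w hu hw hF ⟨t, h1, h2, h3, h4⟩
  have hs : ∀ i, Equiv.swap u w (Equiv.swap u w i) = i := fun i => Equiv.swap_apply_self u w i
  have hf : ∀ i, F.testBit (Equiv.swap u w i) = F.testBit i := by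
    intro i
    rw [Equiv.swap_apply_def]
    split_ifs with a b
    · rw [a, hF]
    · rw [b, hF]
    · rfl
  have hE : ∀ i j, swE u w E (Equiv.swap u w i) (Equiv.swap u w j) ↔ E i j := by
    intro i j
    simp only [swE, hs]
  have hE' : ∀ i j, swE u w E (Equiv.swap u w i) j ↔ E i (Equiv.swap u w j) := by
    intro i j
    simp only [swE, hs]
  refine ⟨fun i => Equiv.swap u w (t i), fun i => (swap_lt hu hw).2 (h1 i), ?_, ?_, ?_⟩
  · intro i j hij h
    obtain ⟨a, b, c⟩ := h2 i j hij h
    refine ⟨fun e => a ((Equiv.swap u w).injective e), by rwa [hE], fun k => ?_⟩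
    rw [hE', hE']
    exact c _
  · intro i j hij
    obtain ⟨a, b⟩ := h3 i j hij
    exact ⟨fun e => a ((Equiv.swap u w).injective e), by rwa [hE]⟩
  · rintro ⟨a, v, hv, b, c⟩
    refine h4 ⟨fun i => by rw [← hf]; exact a i, Equiv.swap u w v, (swap_lt hu hw).2 hv, by rw [hf]; exact b, ?_⟩
    intro k hk hkf
    obtain ⟨i, hi⟩ := c (Equiv.swap u w k) (by simpa only [swE, hs] using hk) (by rw [hf]; exact hkf)
    exact ⟨i, (Equiv.swap u w).injective hi⟩

theorem allLt_sound {n : ℕ} {p : ℕ → Bool} (h : allLt n p = true) : ∀ i < n, p i = true := by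
  induction n with
  | zero => intro i hi; omega
  | succ n ih =>
    change bif' (p n) (allLt n p) false = true at h
    obtain ⟨h1, h2⟩ := bif_f h
    intro i hi
    rcases Nat.lt_succ_iff_lt_or_eq.1 hi with h3 | rfl
    · exact ih h2 i h3
    · exact h1

theorem allLt_not {n : ℕ} {p : ℕ → Bool} (h : allLt n (fun i => not (p i)) = false) : ∃ i < n, p i = true := by
  induction n with
  | zero => cases h
  | succ n ih =>
    change bif' (not (p n)) (allLt n fun i => not (p i)) false = false at h
    cases hp : p n
    · rw [hp] at h
      obtain ⟨i, hi, h'⟩ := ih h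
      exact ⟨i, by omega, h'⟩
    · exact ⟨n, by omega, hp⟩

theorem ifB_sound {b c : Bool} (h : ifB b c = true) (hb : b = true) : c = true := by
  subst hb; exact h

theorem beq0_of {n : ℕ} (h : ∀ i, n.testBit i = true → False) : Nat.beq n 0 = true := by
  rw [Nat.beq_eq]
  apply Nat.eq_of_testBit_eq
  intro i
  rw [Nat.zero_testBit, Bool.eq_false_iff]
  exact h i

theorem row_big {A i j : ℕ} (h : 32 ≤ j) : (row A i).testBit j = false := by
  rw [row_eq]
  exact Nat.testBit_lt_two_pow (lt_of_lt_of_le (Nat.mod_lt _ (by norm_num)) (Nat.pow_le_pow_right (by norm_num) h))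

theorem cl_tb {A : ℕ} {E : ℕ → ℕ → Prop} (hE : ∀ i < 32, ∀ j < 32, (E i j ↔ bt A i j)) {a k : ℕ} (ha : a < 24)
    (h : (Nat.lor (row A a) (Nat.shiftLeft 1 a)).testBit k = true) : E a k ∨ k = a := by
  rw [lor_tb, shl1_tb] at h
  rcases h with h | h
  · by_cases hk : k < 32
    · rw [row_bt hk] at h
      exact Or.inl ((hE a (by omega) k hk).2 h)
    · rw [row_big (by omega)] at h; cases h
  · exact Or.inr h

theorem djB_of {A : ℕ} {E : ℕ → ℕ → Prop} (hs : ∀ i j, E i j → E j i)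
    (hE : ∀ i < 32, ∀ j < 32, (E i j ↔ bt A i j)) {a b : ℕ} (ha : a < 24)
    (hb : b < 24) (h : dj E a b) : djB A a b = true := by
  rw [djB]
  apply beq0_of
  intro i hi
  rw [land_tb] at hi
  obtain ⟨h1, h2, h3⟩ := h
  rcases cl_tb hE ha hi.1 with p | p <;> rcases cl_tb hE hb hi.2 with q | q
  · exact h3 i p q
  · exact h2 (q ▸ p)
  · exact h2 (hs _ _ (p ▸ q))
  · exact h1 (p.symm.trans q)

theorem naB_of {A : ℕ} {E : ℕ → ℕ → Prop} 
    (hE : ∀ i < 32, ∀ j < 32, (E i j ↔ bt A i j)) {a b : ℕ} (ha : a < 24)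
    (h : na E a b) : naB A a b = true := by
  rw [naB]
  apply beq0_of
  intro i hi
  rw [land_tb, shl1_tb] at hi
  obtain ⟨h1, h2⟩ := h
  rcases cl_tb hE ha hi.1 with p | p
  · exact h2 (hi.2 ▸ p)
  · exact h1 (p.symm.trans hi.2)

theorem leafB_sound : ∀ F A E, leafB F A = true → GE 24 E → (∀ i < 32, ∀ j < 32, (E i j ↔ bt A i j)) →
    ¬ P24 F E := by
  rintro F A E h g hE ⟨t, h1, h2, h3, h4⟩
  rw [leafB] at h
  have J : ∀ i j : Fin 6, i ≠ j → i.val / 3 = j.val / 3 → djB A (t i) (t j) = true :=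
    fun i j a b => djB_of g.symm hE (h1 i) (h1 j) (h2 i j a b)
  have N : ∀ i j : Fin 6, i.val / 3 ≠ j.val / 3 → naB A (t i) (t j) = true :=
    fun i j a => naB_of hE (h1 i) (h3 i j a)
  have h := allLt_sound (allLt_sound h _ (h1 0)) _ (h1 1)
  have h := allLt_sound (ifB_sound h (J 0 1 (by decide) (by decide))) _ (h1 2)
  have h := ifB_sound (ifB_sound h (J 0 2 (by decide) (by decide))) (J 1 2 (by decide) (by decide))
  have h := allLt_sound h _ (h1 3)
  have h := ifB_sound (ifB_sound (ifB_sound h (N 0 3 (by decide))) (N 1 3 (by decide))) (N 2 3 (by decide))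
  have h := ifB_sound (allLt_sound h _ (h1 4)) (J 3 4 (by decide) (by decide))
  have h := ifB_sound (ifB_sound (ifB_sound h (N 0 4 (by decide))) (N 1 4 (by decide))) (N 2 4 (by decide))
  have h := ifB_sound (allLt_sound h _ (h1 5)) (J 3 5 (by decide) (by decide))
  have h := ifB_sound h (J 4 5 (by decide) (by decide))
  have h := ifB_sound (ifB_sound (ifB_sound h (N 0 5 (by decide))) (N 1 5 (by decide))) (N 2 5 (by decide))
  rw [frc_eq, finB] at h
  obtain ⟨m, hm⟩ : ∃ m, m = (Nat.lor (Nat.lor (Nat.lor (Nat.shiftLeft 1 (t 0)) (Nat.shiftLeft 1 (t 1)))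
          (Nat.lor (Nat.shiftLeft 1 (t 2)) (Nat.shiftLeft 1 (t 3))))
          (Nat.lor (Nat.shiftLeft 1 (t 4)) (Nat.shiftLeft 1 (t 5)))) := ⟨_, rfl⟩
  have mt : ∀ k, m.testBit k = true ↔ ∃ i, k = t i := by
    intro k
    rw [hm]
    simp only [lor_tb, shl1_tb, Fin.exists_fin_succ]
    simp
    tauto
  rw [← hm] at h
  obtain ⟨e1, e2⟩ := bif_f h
  have e1 := beq_t e1
  rw [Bool.not_eq_true'] at e2
  obtain ⟨v, hv, e3⟩ := allLt_not e2
  obtain ⟨e4, e5⟩ := bif_f e3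
  have e4 := beq_t e4
  have e5 := beq_t e5
  refine h4 ⟨fun i => ?_, v, hv, ?_, ?_⟩
  · have : m.testBit (t i) = true := (mt _).2 ⟨i, rfl⟩
    rw [← e1, land_tb] at this
    exact this.2
  · rw [Bool.eq_false_iff]
    intro hf
    have : (Nat.land F (Nat.shiftLeft 1 v)).testBit v = true := by
      rw [land_tb, shl1_tb]; exact ⟨hf, rfl⟩
    rw [e4] at this
    simp at this
  · intro w hw hf
    rw [← mt, ← e5, lor_tb, land_tb]
    have := g.supp2 hw
    refine Or.inl ⟨?_, hf⟩
    rw [row_bt (by omega)]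
    exact (hE v (by omega) w (by omega)).1 hw

end Leaf

def c14a : Cas := ⟨14, 4, 3, 4, 3, 8, false, 0⟩
theorem chk14a : c14a.all noLeaf (c14a.types [3] [0, 1, 2])
  [0x10c42905,
  0xaa2b16549905] = true := by decide +kernel


def c14c : Cas := ⟨14, 4, 3, 4, 4, 8, false, 4⟩
theorem chk14c : c14c.all noLeaf (c14c.types [] [0, 1, 2])
  [0x14b,
  0x12d,
  0x2a0ec3a92b3ace9,
  0x10b,
  0x2a8a84aceb3a4ab2a4a7] = true := by decide +kernel


def c16 : Cas := ⟨16, 4, 3, 4, 1, 6, true, 0⟩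
theorem chk16 : c16.all noLeaf (c16.types [1, 2, 3] [0])
  [0xae,
  0xc8720ce] = true := by decide +kernel


def c21 : Cas := ⟨21, 5, 4, 5, 5, 15, false, 5⟩
theorem chk21 : c21.all noLeaf (c21.types [] [0, 1, 2, 3])
  [0x3ccf03cd4f3b4ea324d233ccc,
  0x330ea3ccf0330c9348cf,
  0x113441135bcca3a4ec3c8ef,
  0x3bcec3bd2e4b4d1338cb340cd329133bcec3a4f2,
  0x10f4490f4311243d12344d05bcce4cd704b9338a55454d52a256f5b55454d52a25705b11243d0c59909] = true := by decide +kernel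


def c22a : Cas := ⟨22, 5, 4, 5, 4, 14, false, 0⟩
theorem chk22a : c22a.all noLeaf (c22a.types [4] [0, 1, 2, 3])
  [0xd4351d36c5a754d5053546,
  0xcd3368eab68d5b56d5c4d494d50539d05c5d05416e535885d16754d46,
  0x335f0334d0336b054db4340d06a0eb91ea654d0d91eb034d4d334d333653ab4eb3d0d4935536c4d334da83aea79190da9cd13d0ce35171351d0338d4934f1338d15d0ce346ad7c1cb54d4d541e7340ebac1535356d5b56da28d3542475b94da996e5364679946,
  0x335f075171335d47457071d6e341d48ba275c594651f35454e5c16d5cd66,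
  0xcd33ccd351f3ab573740d3336539362d750cd334d235114745c833ccd350cf334d4644cd351f0334d4935c75cd705b8ce34d55552b03525364de83b8ed3d0d3799903b5523b5517424d345f064ced3d0f352154645555524d3b4f13b8ed3c5943b8f1ab5f05cd705396d61d66] = true := by decide +kernel


def c22b : Cas := ⟨22, 5, 4, 5, 5, 14, false, 5⟩
theorem chk22b : c22b.all noLeaf (c22b.types [] [0, 1, 2, 3])
  [0x3b4f0428e9749cf330d233ccc348cc330d233cc9,
  0x348cf330d233cd2348cf330c9,
  0x3bccc324d23c8cc324e93c0ed5c96f5494f328cc3b0f03a9d273db26bccd3ccf0330c9348cf,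
  0xcf330cf3b0c93c8cf3a4cf330f333ccc33ccf33153329d371dc633e3389e263b4f333ccc324d2,
  0xcc348cc74dd0749cf324cc348cf,
  0x16f74e8c740d033d2732aa6719c95c96f5b0d233cd2348cf33166,
  0x330cf330c933ccc33cea3ce327497233ccc324d2,
  0x448e93bce93bcea3b0ef3d4ec43ce944cf2,
  0x3c9103b0e93c8ef,
  0x3c8ef3c9505494f5b4ca424f23bcec3c8ef3c8f23bcec3a91243d125415253d6d4490f430ca5494f5495253d4c428e9,
  0x3bcec3bcec3bd133bcec3a4f2,
  0xef3c8ef3b167598f243cf23bd0c424f23bcf232d6d5b56f5c16c44d104350a3c8ef3b0e9] = true := by decide +kernel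


def c23a : Cas := ⟨23, 5, 4, 5, 3, 13, false, 3⟩
theorem chk23a : c23a.all noLeaf (c23a.types [3, 4] [0, 1, 2, 3])
  [0x5b9ae5556e6b9557d1d24c52a4d12e,
  0x4d1314d1559b94fb395053d4fb3a4e72d344c52a7992e,
  0x4b9347d6ce7c9eb4bd314d1f5b464f92d324d1765d152b2d52b29af6d0cfb2ccfb29b26b9344c52e6992a,
  0x4d12a,
  0x53dd2b39cb4c5344b92a,
  0x1eb4bd344c64b4c934aad353add2554eb754f23ae46555527acf0354f0555f27a9e64d1314b92a,
  0x34a8f8d0efa48cc330efa4ab17522b89dd1729c6,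
  0x344ef3be863be744290a5bec7344cc330cc9a8efb19d53450a5be2a8d0cc3326a520ef955d492e477490a5be368d0cc332ca520efacaaba9dd53320833267442c6442667d5f27ade7751d1729c6] = true := by decide +kernel


def c23b : Cas := ⟨23, 5, 4, 5, 4, 13, false, 4⟩
theorem chk23b : c23b.all noLeaf (c23b.types [4] [0, 1, 2, 3])
  [0x6d1a6541535356d6d22d5457459d5054da76cd50344ce6c1b469d516d0eb339b16d1a75415353546,
  0x54d678adb46c553541a6535124424754d0c5c5735418e5b56754dc783aad93553540d1339b46c24a54cd4339b16ceaa3acce935b43acceab4eb348d6339b46c553541a753546,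
  0x85ad4b4d7059e965c1665cd6db2ac6,
  0x16d541535c1735b94d61d665b55054d705cd6e535874451089cceab4ce6ae348a17489e2d545534316d5cd504390d71cd1ac0d182dd47217471dd0545533b8ed4390d71dd3746aa33588445d1751c85d9d471d535414e431705b9733c4f04390d71e338baaa3418843a2e8d2285da3489d535450c5d9735414d59d46,
  0x4390d719d47456e5c10e435c68d22e5c50a551705b567a5970a596d59973b2ac6,
  0x5ccf2429d4745c8752d3745c65cd705b912442465cd1544ea633151521735c18e5b5675cd0a545b65cd705ba76b416d61d66b2ac6,
  0x5cd705cd705b5865cd705cd705b511442275c57345113a1d745cd704390d71d715cd0e435c75d10e435c75cd705b91444e875d1734451089d744451089d735c51444e875d1735c16d61d66,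
  0x10c4297659ea661966859b6b4d0e435c6ab95584d5342d0a59aab85213344d0ac6b0aaad3ab6a79dad0b36136cea6b2ac6] = true := by decide +kernel


def c23c : Cas := ⟨23, 5, 4, 5, 5, 13, false, 5⟩
theorem chk23c : c23c.all noLeaf (c23c.types [] [0, 1, 2, 3])
  [0x3c8cf348d5348cf330d2354d233cd2348cf330c9,
  0x1b291a368d59163e32,
  0xd23c2c6330d233cd2330d233cc9,
  0x348ec718d5348cf3b626354d23b686354ed3b6a6348cf330d2354d233cd5348d5348cf330c9,
  0x73dd2,
  0x749cf,
  0x3a4d5328cf330ec354cd33cef354d03c8cf330c93a4d6354cf3a4d6354e93cccf330ec358d53b0f333cef3cccc324d2,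
  0x340d2354d2798d6354d23c0f233d863b0d6354d23b0d6354ec3b2a6334d233cef358d53ccef348f03c8cf33126,
  0x92a468d5914c58f4be32,
  0x348f0330c9348cf,
  0xcd348cd349e6348d5348cf618d23b0d5348cf3b4d5348ed3c8cf33126,
  0x73dd2,
  0x328d2328d2798d2328d233d86348cf348ea348cf33126,
  0x3bcec3c8ef3b1123a4f643d0c448f643d123d8ef3c90c426a73bcec3c8ef3b1123a4d5,
  0x448ec3a4f53bcec3d4ef44cec3a4f23d4ec3a4f33d4ec3a4f2554ca530c954cca32555531524b4cd4b0cc6cccd6d52c331b253cedb4972549127b0eab49d26c9127a4ef7c8f53a4ef3ccf53bce93c8e93d4f344d123bcd033e1344a32849893b0cd331b363d923d4ef3b0f33d4ef3b0f23d4ef3cd13448ec3a4ca325534bcca325534b13253d6c5cd535bd6c5c94f5315359a156413063d2f849b54b5af4b1b25554f531523a4f333ce93cccc3b0f3324d2,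
  0x3c8ef3c90f3a51243cf243cf23bd0c426a73c8ef3c90f3a4d5,
  0x93572549123c9914c4d163d2f33e32,
  0x7d6ac73e55abeacaa50f3c90f4310f3c90f4310a3c90f3c8ef43109a9cef3c8ef3b0ef3c8ef3b0ea3bcf23bcec3c8ef3c90f3b10a3a4d5] = true := by decide +kernel


def c24a : Cas := ⟨24, 5, 4, 5, 2, 12, false, 0⟩
theorem chk24a : c24a.all leafB (c24a.types [2, 3, 4] [0, 1, 2, 3])
  [0x1134cd93449964421293913641b263d93449964390c64a4a44d906394e82e1344a1644213849525426f9b1a661a8e9324a9ae7644d54ab2ab4b1745b9d674dae638cc4ae864d9334490e42915,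
  0x1964559263ace4555053aca4559365915a39764568a449106555454de69424fb32ca4559279ad0b3db56ca956599664d93ba996a29903c1e66594e539966d570b294ebc9935b9ca74eea53996a298f455124390c5554e59a4c92ed0b391584966b32cb8d54ea55565599354eee55a8e830ec59a165394e85a3563ece53af284d4f53953bb94e85a8e82d154491069a8c619cca2ef2a558684e123428f619964c12f3c0ef69af2a30cc9ba4c330cb3324e7315692a8b4c91561a13848d0bbd8664d304bcf03bda6a56ec35266ab0cc32cccab9cc54eaabad354d9364cd366ca8b4da8a4cd334d9336d6cabacd3ba9924c1366d4d64ccf6a1a779da75bcae66c8d3358f6a2d36a28f6b18d3b99923412f6992c4d8d33dae685536b38d43d8d68553334cd33dace3cec6344cfb9a124c0f36495053d53ab2afaaeceb29513d95053cf6638f68c8f66ca8ea2a66544f35414f3cd8e3ce353cdb5bbaea358f66555053d569324f92e6e9aa863412f3312b455124390a,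
  0x64d96431538d9924b12b9b24bace564390a45512,
  0x196455964568fa39136591564d12639926554e539966d52b4aa6fba98fb2a95bcad2455136d5965399663ed26d58fb298fba91564d124390c54a3532d2b9324b64aefbba95bcad24551332d2bb32cb5558f63a2b6418f639668aeef64d92bb9158cd124b9a654a569b12c4ae4c619cc74a4a9ae753418f619866592f61aebba8cb4ae95b4af29b1a661a8e9318661a8e7315692a6b455134b12b554d561950bbeec619a6ab995baef3552acaad2c5d16e53dd674dae638cc4ae864bd54ab2ab4b0ef5515664ad29a9b53312bb1933455124390a,
  0x1956591564d8f4315354d92619869b99392e5554d536498661a6e64e4b54153931866198e64e4bb491593d0a4490e,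
  0x65656a5655458d0a19ca93996455133426672aae4599063d96455934490c69a6c619cc9ad2c4ae4c92d2c4aeacaae8e9d59561a6c9aeeebc99261accb2e8ea5516349869b0d4348ccb1a4c92a6b9c2869b1324b26b9be764551335586b30d7354cc99aacaaacbb42e6b31354b2cbb3ed34592c5d0d1342955c92b9c18e4b1cbb398e4b1cb9b9364cd154490a4bd0e,
  0x6d9156cdb56d9156cd0e556364563333e2693dd332da692d53954cf5416e856cf93dd332d8e53d95b2e4b54d666396f89a2a92dd3699507ada66ba4f54ed24550e42912,
  0x1166d915459b64568b459364568e459364568a44d164cdb6455b34492e6d656a5655458cb799af939b64551332de66beae459af6d9156cd124392a55656a5655458cf59a2b92a364551333d668aeaa45a2b8d9158cd124b9a672da63bda66b8ef69a4a9ad2b6ba264c12f9bdaf6992c4ae6ba2a7532ccb89acf3bda6baacbbc8cb32e269bcef69a8a9ae95459a6a29a68c9509bda6a39a66c98e4c932899328d4f04ca4a698cc3accc3ad70548f2b1a6f9ae764551369aea69a35542cf69aee699b5639354d6264d6323c135aa9a6330eb330eb5c1543d666b3ecbb4d166ca95751d6342358c8ccb392f4bcef6ba6e4ae864d933455124390a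,
  0x6d5166d9156cdaf4ae666bdaea296eb2d5554286542eeb4d1654d50341d3599505997054e4b9591593d0a4490e,
  0x54153541d3ab25693e4b455124390a,
  0x1366d9356cdb54d9b64d5b34b9554da364d6336bd6e8a9af6be2aba98e53d8ebb98e542ea639d554155b3ecbb4d3633cef5998e5bd6f6ba2a92dd33bda6541eb5be2a6ba4f54e564d52e4a932,
  0x1b3b3aab74e4b54eb09592a93d354c92e] = true := by decide +kernel


def c24b : Cas := ⟨24, 5, 4, 5, 3, 12, false, 3⟩
theorem chk24b : c24b.all noLeaf (c24b.types [3, 4] [0, 1, 2, 3])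
  [0x34a6a929ae71aae8ae2e4d1314a8cf829ea6c626ac5cb745344a9344d12a4c52e,
  0x4a9344c52a4d12a4a9344c52e,
  0x1725c5324d1755d1356d1b16b934699314a92d72934699314d1316d1ae6c5af3c1b453eb2651d5745cb4c9346bcf06c54f95591749d472d353d567b999063db15d4ec3adb56d2ca3b0eb6d5b453dd57c9523ad736c9b1749f57c5d772d344c5a64a92e,
  0x4c5774c5344a934b98cf33ec63accd33dafb48cf33ec6b454f33ec7baef164991919d2755cb4c5344a92e,
  0x4b6ea4c5a64b9775bd6e4bd344c5775c9714c9345dd755d1356b9b16b9a64d1314b92a,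
  0x22b4c5cb4c52e4d12a,
  0x4d12a,
  0x5ddcb4b9344c52a,
  0x43e87b496f548cfa32358ae26751d17298fa2ed23bcd253e888d6278a9d4744d57d5ec7a22fa2e87a45d4349f27b1e8a3e2b89e34442a7b3d525bcd2a32358ad90aaecf348ef54a888d4ef93e4c9229242a4fa4a8c3324fa490fabd353bcefbca4fa4a8ca22358ae27751d1729c6,
  0x18e8adc8330cb3324674ccc32e74755f2330cb32d328a1f5749f17ad758adc832dd57c9ea79cf589dcc331d57c9eb79af1bba97baae6] = true := by decide +kernel


def c24c : Cas := ⟨24, 5, 4, 5, 4, 12, false, 4⟩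
theorem chk24c : c24c.all noLeaf (c24c.types [4] [0, 1, 2, 3])
  [0x64dd33397359a13819b36995351ab7adaa6,
  0x54d7459d5654d46,
  0x54d50599665595154d6655954559a654d50534d15595434a2734a2755953544d135687356875595442d6742d67559535410d5415654157540d63515654d5754cd6541538d50e436338da2e541538d5508ce368da338ba2b350d15354e54d4d5415654157540d63515654d5754cd68da375595054d57542365415754a36541538dd568ad735c10c6c1765cd70431b05dcf6549535563654d508dd565deb66c1745ceb65c0f554d575563654d508dd565de566cd715c2565ccf25dd765ddb65c0f35dd765ddb65ccf03ad4e541538d50e8ce368b95054e35542338da368ce2e8ad4d350d13b68791a8791956551a7541a7542c655e569194d55e3689a6689ea689ea65595169d5369d53b1957adaa653557a5a865c1675b557558d3819535415154d5454d50539535415154d5454d5053ac66c1b3551b054d56539b06cd546c1535595654d4e545b7ad9506c1b3551b054d56539b06cd54445535595654d4e545b7ad95081ea66c1b3555b054d56539b06cd556c1535595654d4e545b7a59506c1b3555b054d56539b06cd55445535595654d4e545b7a595081e866c5b0545b154156539b36c1516cd50559565414e551b7959536c5b0545b154156539b36c15145150559565414e551b79595399e466c9b0549b254156539b36c1526cd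50559565414e551b78d9536c9b0549b254156539b36c15245150559565414e551b78d95399e2655d5655db654157559576d95081cd355d5655db654d57559576d95399cd033546,
  0x64dd333973599b36995351ae6ada1584ea6,
  0x54d7459d5054d46,
  0x94e46,
  0x5414db295654d505595354d765414d598f771d4e54d503de27545534317659d8659950536663ddc753953541675995654cf7a1d5459d6654d505360659d6655953540f789d5154cf7a1d5459d6654d50535a6559735c1565cd53559705b550535b46cd5154d5554d5053a1484d4d541b484db3358d45414d5cd50534d634db16c154541525415353a335354d8cdb0359b16c233541b16c1566c5b054d506c5b05594e8d94d351566c5b034cd154d4d5c153534d6559b46ccd45c156534d3341d05514d53d4d54d5174d5054dd0359d074d4d7415674153535d05595175950351d37414d74d5674d50535d3559547595334556740d3559d3340ce54d505b553540d655a1484cd455a333456d5595034d6d55953340cd59d46,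
  0x64dd333ae6b19735995351a156d6136cea6,
  0x1865c16d559705596d551535c15454d6d551535c15454d6db18d4545505cd515416d545505cd515416db19515cd70545505b4d43454e535735394d5c14e535735394d5c2c6539735b54e535703514e5c16d5394d5ccd13396655951546c66c150345e7539d0534ce61d705b4cb9995655154b19b354cd479d4e74d4d339875cd6d32d56359546cd533510f79d4e74d4d3390c61d735b4cb99cd6338cb99a0655954552c684d533524754633540d161d735c0cb558d65521354cd444a4754633540d1431875cd7032e67558d68cd503451544ea78515484d533510c61d735c0cb81cd632e4689a66358cba9a865c16759dab5c1676a8d3819a66d9b46d2c684db3352476c6336c0d179dd3740ce6d8d66d2136ccd444a476c6336c0d143de774dd033a676d8d68cdb03451544ea7851b484db33510f79dd3740ce81db6359d03391544ea7851b484db335112442476c6336c0d169cd691a26799c6998d6a9a86799c6741c771d4e5c167535d07210e539d07214d69cd3818d6a9a8691a266c5b089e275456d59d506c5b08a111545b18a15081cd36d1b3a1e875516d59d536d1b3a2114551b4a215399cd069946] = true := by decide +kernel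


def c25a : Cas := ⟨25, 5, 4, 5, 1, 9, true, 0⟩
theorem chk25a : c25a.all noLeaf (c25a.types [1, 2, 3, 4] [0])
  [0xf7358cb,
  0x5dd5155d964b12a55d7643cf23b8cb45cf6,
  0x1755db0a6cd0a55576c29b255576ba9b242cea44cf2340cc45cf6,
  0x35d12438cc8195742ad444e97b4ad07dd10649374490f85dd4b3acc332e6550ccb9a0681a17c4af2432328d95454197b2916] = true := by decide +kernel


def c25b : Cas := ⟨25, 5, 4, 5, 2, 9, true, 0⟩
theorem chk25b : c25b.all noLeaf (c25b.types [1, 2, 3, 4] [0])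
  [0x5497355576549926524a5d9735b8d5348cb,
  0x1a774e4f63992659526599365953aa8f33d9966ceaa3d8ea3d8ea6511043f1264da863d966d4f63ad723af0c65948aa9d371eaeac8cc355a775aaf6399564d526599364d56928f63cd936da4a3ccea3ccea65d1043f15659a863d936c8f33ad743af0c64d48929d671e4e954cc55a348d9538ce3644e678da338cd533ccef45cefbacf3ba8f34d8f3b9d88930f35a24b3ce4a95a4e51d143cd4793a4a659173d947abaaa99ec795d9664ccc354d2,
  0xd33c8d63d4d334d9695d9664cec5d5565c98e63a57559533a8f53c8ee,
  0xcd348cd349543b9523d8ea358ef922463bccd7230a3da6e358eb922463acd15230e3d9163bd16438eb9224645112454cd3bf07344d5c191444915c1ccd3570642ae8b9914345306d532351124d514345106d51235132454ef3acf69ba6a99cd635915359153becb458d63acf64550e42a48a1e669d712,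
  0x1868298eac1b67ccd063d2e61aae64eac42decb4e4b439303412b4b90e6392a3320b54eb063933348d2340cc4c8cc6cd7154cf0336469310c92e32542aeaa936ac91561a0a63a506cdf63418f4b98693996930ec5d6c69d90e4c0d04ad2e4398e4a8cc82d569418e4d8d5354d033135331b65c5563c0cda9aac432ab8d55093a4a4ce554cd0c54d0a43a5064ccc9c26f4cd2e7324e95933441534390a65ad333233699b34290e341b3619534390a65e56940cc7cd2a84d10429f343e5633133c4a134413343eea75a4e9313733133b9a509395635933438cc9b26b4ccd1341734b9934310e5cd0b8c8cc3422842e2643e137324e95993430cc64d0b9390c42e6634310938d093b1284d565424a45512,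
  0x10a3d8f3428d3358d64d9b669ab363d3643dae74eae64aac3310b4d9335490c42d333599665a8a74cd65c9ccacaaeaa915428f33d90a358d334d336cda69598f4cd0f6b9d693995930cc42d334d9554310b4d8d364d93ba9d634d757325593a4a34e3634dcc34cd34aa4a95a4e64cd38c8d3698d3c1a4e4a9964a92a4aa57659934390c54d538c8d634d5395a26358f3c1a4e55a4c4da4b93d2f4bd8e4daab331cc559534cf0b93d7454d538a953c2ab35d5735d573ba92f74f0a93e4c4cf0fc3933c495354d938a95155151c2ab3ab24f92e564390a45512] = true := by decide +kernel


def c26x : Cas := ⟨26, 6, 4, 5, 5, 9, true, 0⟩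
theorem chk26x : c26x.all noLeaf (c26x.types [4] [0])
  [0x7c5928e1d5749d263dd88d62f4c2087b292a3e89cb1e9b31e9b462f761d5436087b2358be4c75698a260ca263563f0c4b6097b0ec85dd5a2698a3dd28a1c75dd745c56e651cc72292abe2e53dae4e617bbeee6decfacaa94310e64d926512c6392f4b9e87de4cc26b2abd944b18e4bd2e7a1f4932a9c4b0fb462e8a1785d5716522c8a28fac9d153db14e677bcaf16ded2abea9431116418f6512c645324c64895decc26b2abd944b1914c931922547b2a9c4b0fb39d1721785d5f1931d2755529312f561946d2f26cb2cc3e358a5d264a128be297b22f63e6f851b7bb2177b2d8432d78be29749d5721787c64c749d854a4c4bd5565db7a49b2b32af8e2297499284a2f8a5ec8bd8f9be176d28c851eccd50ccd22f8a5d2761c85d5715b8f73d191731c88d64fa394f6b93985eefbb9b79be559250c439936452c6392f4b9e87deacc265593d914b10f6b9d79b249c570f9d28ea21785c9746468c9222f955d453db44e6d7bd6f46de7593e49431146418f6452c651354d2a8addecc265593d914b1934d534aa2b17b249c570f9b9d4721785c9f1ab1d574955ab12f56158bc9b5cb30fa4a897559264615a3e897b28f63ecf845b7bb2177b27843277a3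e89755d2721787c6ac755d8556ac4bd5265db78d5b59b24fa62897554d531917d64f9252c8bd3545ab7c32494bd30ccb314b2d14318f4598fb5e999264f755d8721725d16e3dd91731c88e24fbb94f6b9368528fa39b49be589250c439936452c43dae746ccaa65893d914b10f6b9d49b249ae2af9deeeba1755c977646ec9222f961d753db74da99a62976d27893e49431176418f6452c659384df08c51ecaa65893d914b1934e137c23117b249ae2af9b9d7721755c9f1c31d874958c312f55555a49b8b32afbcae976192645f8abea94b26f4e1139524caa52f4c2759d12ccd10c63d1963f31bcea9abdd8749c85d5f1c31d875558c312f549528d5b89b24fbd6e97614d531917e24f9252c8bd3845ab1ab2494bd30b4ad14b3314318f4658fcd2f69264f761d5721725dd6e3d0f163a2c7a1d57ca91549b14e677bcaf16de127d5e9431116418e4b1914c93192257ab3097d5f26392c449b18de0c7a715c4a14a46885e16f5d18ea31e8749f58d1526d139b5ef5bd1b7855f27a50c451906392c651354d2a8ade4cc25f57c98e4b1156d297831e9c5712846348a1785bdd2ab2358bd55ab13256158bbdb5cb312a3e898d58f63a75a4a89932924350c63d8eb49cc6deec9de4c8610c85e92a26358be285e1d2b31f58e155ab13253d976ddd56d6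0c7ca98a26355354c63a557c9e94b1d24d516adf0c7a5324cf2fcb92cb390c6391663ad7a65e97ca358e2285bd745c4f763a2c7a1d87caf1549b14da74a4a916d2127e1e9431116418e4b1126c62eb32a97e1f26392c449b18d20c7a6b8aca17bc6e85d56f5dd8ebb1e8749f88dd526dd36a6698a5db4861f27a50c45d906392c659384df08c524caa5f87c98e4b1186def4831e9ae2b2846378a1755bdd2c32388bd58c313255555a3db8b32b2bbee98e18f63a58acaa94b2124e1107d1ecaa5324c2158512ccd10c63d1963b2ebc2a9aca388be285d5d2cb1f88d558c313253d4f755b8831f2bd6e98e14d5318e961f27a52c7493845aaeab1e94c933b3ece4b32e4318e4658ecd2f67a5f28e2358a16f5dd713d18ea31e8761f5bd1556d1338da358d1b1855f87a50c451906392c455b4a3a6c925f87d58e4b1156d291831e99625585ef4ba1725bd7763aec7a1d57e297555b74ce398e2376c6187d5e9431176418e4b1186deee9b2497e1f56392c461b7bc60c7a65895614a5e885c96f7572c9628f5630c4d55254a2f6e26c956efba69863d8eae2559252c85538441f17b2494d53084a114b3314318f4658ecbaf092655a628fa21727572c7e2925630c4d54f53dd26e20c7d6f2ba6985354c63ab87d5e94b1d54e11393a4c7a5354ce6f9b92ccb90c6391963b31bcde97d698a4a885bd775d0f13b967]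 = true := by decide +kernel


def c26 : Cas := ⟨26, 5, 4, 5, 1, 8, true, 1⟩
theorem chk26 : c26.all noLeaf (c26.types [1, 2, 3, 4] [0])
  [0x10c4292b4a9c889ed0b39f75dcf03ba4c920f359d7764973451124310a3ce2c8a9103c10e3c30e920f3c9d677ddf27ad0c92e487c8f751cf05c10c5b8ee3ce4b921f251df77a8d633d104392f4b94869eccb29775dcec3aa50920f379df7849f3451124410e3cdb06b90c3b10a3b30a920f3c9de75dd725bd1093e485c8f771cec7b1107a8ea3ce4f9217271d775b8d66c1ae3dd884410e45d88b4e475416e5ce4795dec3c0ee5c16e64d0c921706396e6224c55d477a9f27d9505418fc9d506bb275418e65d9364eef5430e542ee65cf361e2c3cd478a9f73b0ea3ce0785d177cd347dd13b210c4290c429138210c42913821f88ddf33b0ea3b0ea754ea4b12a3b0ea8db30c3a133b8ec3a9d54310a75913cbe0895e475c15061ed064dec655937a90c429ec8a9ea53d8f8a95053ec87e15053cea4310a83110829f88dab075dc75b9725d9565dd5053d6e5deab5414f5deae5416e5deaa3ccec3ccea81d703ccf363d0a7a9c75b9775416e5416e64d505b9787b1705b9703b0ec429c75b9557a9f77c9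0c42987822473ce078c9f75c288441a8659b33b1933a8f771d1091e50435af5414f3ccec3cdf37b0ea71dd75b90c3c0ee9224751d93b32ca3b0ea45213820ec3a8ea732087e2473cda73aa487b0f37aa07c49705414f4294f429b44350ac29914419063f2f64cec66110828ea3b0ea3b0ea44e08c9e5071e333c1c8438ec430ea3b12a3a8f88218f3b1103a9ea7cf2c3b10a7230e942475b9775c8d633ccb,
  0x3d8d733cf635cf03b8f03b90a3c0ee6dd5053d565c16e6d8ec55e165410c5c16e53cea452c83ccd7430ec42a13821703c1ec3c0ec7a9c85b97735b273b0ea7d2075c1903d0ec850f484e123a9c75b9735df2633ccbcdb32,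
  0xee5d0ee5ccd44cd745cf0b55173c2a575d0d75cd6e3516e661b63b12e3aaaa4d133a1b365b974334cc3aa145b9335cd773b8eecd9b75dcf3b4cee3312a334cc55214351334d12a84f103a9548a8cc4a973c3a5793110448f25c0f05bcd04bd705bf0b5416fc29d75c0d75bd7234172661b63b0cd3312f3aa2a4c12f81b365c970334cc3aa905c92f5bd773c8f2cd9b75dcefb3cf23312a334cc542903412f4c12aa3f143a950aa8cc4a96fc49d7731143b0ea85d743d2173b0ea3d2775cd703c2973b0ea3c1f75d0cc9dcd76da8ca2a963d0cc350cc3ab347dd333c1735bccd331af93276342ab342aa5c0cc3a990330d13b0ea3b0ea648d09c0f04bd6f751543519335133a58d4bcccc3d0f33be5035d506bcf3334cc3c0ef3ccd73a8d04ce86332a63ccccc4ab7332b6334cc5ccea3512f818cd898cd330ef6c99835df656150aad6faa8ec3a9335cdb6941d4731774490e42ccc4496e85d91641b26b99263977a59906c9ae639925de163d0d44ba4c3324cc492e551b33324ccd8cd330cc9a1549325685e57832163c8f034132730cc7330e4c9506bccc73336334cc331e8541cc75a9775e8ca58f443cd0852f384d7044cd4a417443d2c3459664996638cc35ef4bc1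735bd7745113b4d7055114b4d105bd763c8ee3ad0a45a37350d492d0e92e1243a4bcdcd492e573c8d0341cb449cba391272f37341cb75cd442ccc4a8cc4290f5992a331503314881ad442d0f4a90f4290a7510c42a9759974b4ed042d134a9134290a8490c42a1759970b512c4a90c42b303510c4290c42b303511381970b4ecfb2d8e6230e44e37a32b65c56f5b977431715bd6e5c9774310fb4d0f639136228ca5ad38d9926231243eb78319243d88832b6858d4340cbb28f23b9175dccd3332c341b2341925de2735d77898f45c0cd3318f342a743aa65dd74438f4438f43c1775c96e5ce4c5c0d0931c85d0d043ee8b5173b996e5dd51541ae639743318e9a173331113310f331c8333065b9745cf0b545ae63974b4d73c2a5765d745cccc43197334cc5ced46d96e351c85b90a429983510e44db6560cd330d7c430e7220a63db66c1afcd96e5d0cd3310a8516e9a1735de14b38d1439486b9985ded34310a6196e5d2145cd0c42a865b986552144312a4290d429865d213c416f5d22a542145cf0e95e4c3c0f25bdcc5d0d4732485c0d444ee8b416fb99725dd51551b264970331927a16f331153311333248333065c9705bf0b545b264970b3d6fc29d765d705bccc43197334cc5bed06d972342485c90a429983411043db6560cd330d7c53129228a64db66d1b3cd9725c0cd3310a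a41727a16f5de90b48d5449486c9985decf4310a619725c2148496f4310a8197261950a410c4a90a4350a61970a3f145cd70aa950a416fc49d7730f4344d53432885d7444d2c4aa68c4d13c4b3485d735c10f4b12a7a30f43f0ecc2975d0ccb310c8210c43586819977311745e2a35ccc3313744cd7330cc4dd0f522cab52d05cd6f64aab541af932aa43e06aacd034113aa9704b10c4a8ccc4e703310ac20cc42b064c1137a16f751135cd1444d0f6a0d4623064310a6996f9410f5bd1043d13620d0623064350a6197364df6334cc5be0842a068aaab5beaa4310a3310ac23069a32b5cd73adad35ccd0440cc432f9ad90ab4e365be36b3d6f351144350cbe63642acfad9986ca50751cc5dcf23b8eb5de8b45cf45de0b45d114397232ccb8997282e3285d6e63a375c97264ab743d0e85f2b65cd135de8334cc32f304310b61b2c330cb4310bcaf3485e0cb4aceb2ccc3310b4450e5c96682ccc32ccb7220c5ba8bc520b84eaec4a0b334cc32e8e9b17282e18c3a3782d12332a65ca0b86212a2f0e8d9573d0f054557932d44b90e42d665d2d345ed043d0b4bd2b43913554d043eb7a1997341134b99834133721ccb50d043d0f42d0c432ea4330a432f28290f43a2a341665d2d345eceb2d9564d5482d57334cc32cd4ab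2135e1965e193ab993334cc351143326859aae32d0c42d0e89b3064f0e831575510c42f2884cd833537332e69a2b042e6833286ab8cb42d86334cc32eb0330cbab8cc32e13cc20c5521484d0b61a0c45113a18cc32eae334cc32e3383154c2a5792cf03c95155dccb41324490b59970b3d17b511342d334ad1243d51351138de0665cd443d32660d44be48932d03511344d0b4310cba90cc290cbba8a43eaa351665c2cf45ed2b2d9163d50a2d57334cc32cd08b1f45e1965e18f8c98f334cc34110331e859a3232d0c42d12a9b3463f12a31575410c42f287d0d833537332e67a23442de8332068c8cb42d86334cc32e34330cb8c8cc32e8fcd28c5421484a8f42d86a311043e06330cb8c8cd330cbabe8c5430a75dcb3d17742d6634233add57b50d05de14b4e0bb40d45de90a2ed4350d045ccc35d37551175c95065d1545113a99544451043e266c950c330a5dd0bb4ecf342f0bbd97330cb8de50541506b8d04410f6caab4410fa99883418673157a32d443d687a2175c0d0430d77a10c7a1f75bd665d2d3352f4bcd97330cbaddd4551546c8d4451136ba2b451138998835186931578310f42d66621867d21365e0c8328c8a957b50cb42da67315745d68599104511343d883418f61997931b032e2b32daf32dae44e0cc3157552d3b41135a26885d743510c35e084b2089dd735997032d0b619cc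55d175a1664410f4410f44d883419361997731b432eab32db332db243e8cc3157542d44511342e864511342e86bb90b34166941ae42cd059a50639975d11043d0b8191043d0b81af242cd4599d46c90b351667519265d1845e175a11043d0c4321973113822b94410fa23344410f4310ca664c43e888e50f823308a9574410f4410faa2a6c53124412f43d1043f308dcd7599745c2d3b3ecb3c8ee3a8f6,
  0x3cceeb22c6334cb9216eccf323cd6e32d0b429a6658cb42d0a69b2e3c8cd32cf33e598b22c681950ca9ae659d63cd0a429963c8ee3b0d035a273ce265610b5995642d66759cc3b8eac48cd32cee3b0d1340ee3a8cc5b9683b0ea3b9663d50a330eab2918459364c971358f5460ea43ccc3bf273bf263a8d5333264b8cc4c8ef459145b96843cd13b8d689b264590c428ec3a916c990c3b10a4b12a460d63b0ea4310accd16a996e821665cd0c42ac83314859aae3bac6661966d9b23c5986b90a6c9969d9916619532d9432f2b5232a32d5532f2a5d19663cee3b18e5458fca9d85458f559d63430a32d0b561568d8f16b9eb4bcd04d132a98d0865304bd1845b2bca97565a068518882214618ee830ea3cef2bc0cb42d0a61ac63ccf23cd72b42cf730ec3a90ab28f33b0ea3cad0b3cea32cd04bd96460f26a213849a74d8f03b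f27330cbc99505bceac9916698cb5c56f540d0460ef3c0efc9f266c1af64a0b651925bdb6541166990a44ccb3cdb25c4cb6c96f355344cdb645b274ad86c99163a8f03b5163a8ef64d12731c8c490b428ec430ea341663cec8b18ea439585590c859aeaa8d13ab2785ac8c9a0c8290c429e86632a6598f65598cb9756ba338c99654216650ec32d0c42f0c4310b618cc32d926632bca90c42d86658cb4310b5e4cb4310b4310b61aaacaa168520c3a8f33c0ec42cd0599af6b90c42cd0619ec3a973b32ca433333cf3235ab6aa151cad0c42b26b332a32ccc431ec460d085916851686390c4290c42918c3f27c990c429164310a3e50c4290c42aa6c9a1685208599735c0efbcaeebaccc32ccb44d138a96e6210b3cd0a3b966921874412e438eb4cd488990a42a2a5ce57619926410a61d8632cf03bccd32d2e3b4eb3ba5044d883bcf04350b429a63bcd04350b3c0ef428d569ad0b3d365430e720f361d137216f85d334ca364a91342cef429c8545506bf273cd6871db06beeeb2306341866498eb330bbaae74b8ee658ee649906daccb298e330cc3a92e5ceeb332eac3992bb91044977331705bd704b12a3cd6fbacd0ab2ea340d04b0d04cd2a3430b3430a6d92a65d733ccd0c38d075dcc4490e42ccc84cee6498ec2cccc2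8ccbab0ebb9304c9775ccd0354d0b4db23ce575416f75f2c4c92e4ad0ab2307b9b36,
  0x334cc358f23b8ee84a083b8f2818ed3b4f93c8ed3e5ae760cc5c65633155758ed3c8ee829563ca2c342328ae2a3c4f954558341af958d06bd563c4f263955560d48c9d6351b2558f564df445513761d644e2a5572a461f64599564d8f621709b12d4add875a197572e46116a65314bf3284e0b821863c8ee3aaf43b91444d125510c42d554511344ab6751ae3b8ea331d834133c3a96921114410f899d669da63b8d0560cc4cf0aa5a484350c42da655a27899d6433084491261ac8c19f4344d08da8b558cc6d8d94310b8d8d95d50b5d1f43330aab8d964d0b7d174759aea65555550d431994350c4350c822068ab2a6bb2e8d8cdca8cc46111619365c1687d174a58ee3a8f44bd2b920ee3aa338c918759166218e4615645a0882986ac0cc4ada8351a63650b89a483aaae650f3bcaf03c91043d0e5410c42d514410f43a36941b23c8ea332183452fc4a167210ea9a5669da63c8d1560cc4bf0a859c84350c42da655aa7a9a56433084390e61ac8c1a13354d4ada0b558cc6d8d94310bad8d95c50b5c2133330a8c8d963d0b9c170959b2865515450d431994350c4350ca2286aab2a6cb32ad8cdca8cc46115619365d1689c170858f23a8f04cd2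b720f23aa3546256459886491855916a228a61a343312b6a0d0698d942ea6720ea8c9903bef4340ea350cd3310b5410b63d50550ea3cec6352c8b190d4310b6e1b66e1b6332188db0f861748da9634532cab3285aae721ae334cc862b6ccd0d4310bcc90d4310ba610bada16334cc5463642f2ea5a0b3d0ea5510a8610aa5a168520a3ccf04450e340cc6510c42cd0a99863a8f464d10438d4ccccc46116ccf2fccb2e356aecca1634636cba963328881a866510e8998861993640efbcaeebb0f24310b429cc4410a5d10c42d0a6da4c8c8f23b8cd660cd4af126594842aa695a27898f2335983352bc39965210a899d6a9ea695910c210a42a06b230664cd5352b663db6342363651043eb63655142dec64cd0c39b23655142e6c63e568c9996b9ae445108650d42d0a42a88a1aaecba32ccab63472e34118456064d9f47a26c7b1963c8ee3b1334bd483c8ee6d5189591682212461d645a88a3a066d0d04be28332263650fa99483b9b2830ebbd0cc3b8d4334cc42d0a7310f5c1cc750ee3cec6352c8b190b65a36658cd661166db0b4450f89a3633532cbb3265aaa52191344d0662b6ccd114410fcc90d42d1043e9843eb6658d1341ae6d90bcaa9663cf43b9d44399843a9665994638f33b10d428cc3421433179c98d58a9483b8f484d0c428d4cccd046116ccf2b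ccb2a356aacc996335b6caa963428861a868510a69a0881a13830ebbcaf0330f2340cd3310b429cc44d74932503c8efb18d0b22c642df9658cd661166db0b43ea6ad8cd4bb32cb9968a948654d5351988db2f43d0ecb90e8610f43a36658d5351b26d90bcaa1664cf03ca124499844a1665990648ef3b10d428cc3529033179c98d1aa9483c8f0a3d0c428d0cbcd446116cbf2bcbb2a3462acb996335b6caa163520861a06a410a69a88a1a8fa30ebbd0cc35116351c83cccc3ce27342c65520b82b2f6632fcaf2eca9708598f659943c0f37533366333caf32ca974a5993659903d0f33bcec5432f3d0cc3510ab41f9b22c63cd54ccd9865b33cbf32cb9f4a5a1385a0c3d0f33c0cc3410ab5279b22c63d11243919698cc4650ac50cc466c6c9ad4c4f083351433512cbb2ab2306c41b16c111440d0439af445103410e6bb14b430fc31b06bdae8b10d430cc42a2b4350c3310a8ab14c42ccc2cf33bcebbcaeebaae7650d464cee5d0d484cea3370ec2aeeba910449903418f3c9703428f3a8cdc4b0abcaea45193b3eb63be06aa9d49418fb4e363ce868aa507530e334d4334f37525095ccd340cd3be50751d74490e43190638cc82cf263d8e3328b3b8d1c4b0ebcaee451b6b2eb63ad86ab95493170b4db63ce866ba4c5530a344d4334f35524c95ccd330d13ae4c55157449106dacb8d8eb61a32541cc5d2cf6d8ef819b273150c28d1340cd3bd50731d7334cc344eb7315055d1465d334c0d4336ea552a7336a699df43c12f4b0d4346ee5c6a7336a699d744c1755ddec335f74d1334bcec4ad124390ab2307b9b36]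 = true := by decide +kernel



section Basic

set_option linter.unusedSectionVars false

variable {V : Type} [Fintype V] {G : SimpleGraph V}

theorem sum_nb_comm (f : V → V → ℕ) (p q : V → Prop) [DecidablePred p] [DecidablePred q] :
    ∑ v ∈ Finset.univ.filter p, ∑ w ∈ (nb G v).filter q, f v w =
    ∑ w ∈ Finset.univ.filter q, ∑ v ∈ (nb G w).filter p, f v w := by
  apply Finset.sum_comm'
  intro a b
  simp only [Finset.mem_filter, Finset.mem_univ, true_and, mem_nb]
  constructor
  · rintro ⟨h1, h2, h3⟩; exact ⟨⟨h2.symm, h1⟩, h3⟩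
  · rintro ⟨⟨h1, h2⟩, h3⟩; exact ⟨h2, h1.symm, h3⟩

theorem S_le (hG : C4F G) (x : V) : ∑ y ∈ nb G x, dg G y + 1 ≤ Fintype.card V := by
  classical
  have h : ((nb G x).sigma fun y => nb G y).card ≤ (Finset.univ.erase x).card := by
    apply Finset.card_le_card_of_injOn (fun s => if s.2 = x then s.1 else s.2)
    · rintro ⟨y, z⟩ h
      simp only [Finset.coe_sigma, Set.mem_sigma_iff, Finset.mem_coe, mem_nb] at h
      simp only [Finset.coe_erase, Finset.coe_univ, Set.mem_sdiff, Set.mem_univ, Set.mem_singleton_iff, true_and]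
      split_ifs with hz
      · exact h.1.ne'
      · exact hz
    · rintro ⟨y, z⟩ h ⟨y', z'⟩ h' e
      simp only [Finset.coe_sigma, Set.mem_sigma_iff, Finset.mem_coe, mem_nb] at h h'
      simp only at e
      split_ifs at e with h1 h2 h2
      · rw [e, h1, h2]
      · subst e
        exact (hG.tri x y y' h.1 h'.2.symm h'.1.symm).elim
      · rw [← e] at h'
        exact (hG.tri x y z h.1 h.2 h'.1.symm).elim
      · subst e
        rcases hG.c4 x y z y' h.1 h.2 h'.2.symm h'.1.symm with h3 | h3
        · exact (h1 h3.symm).elim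
        · subst h3; rfl
  rw [Finset.card_sigma, Finset.card_erase_of_mem (Finset.mem_univ _), Finset.card_univ] at h
  have : 0 < Fintype.card V := Fintype.card_pos_iff.2 ⟨x⟩
  simp only [dg]
  omega

theorem sum_sq (hG : C4F G) : ∑ v, dg G v * dg G v ≤ Fintype.card V * (Fintype.card V - 1) := by
  have h1 : ∑ v, dg G v * dg G v = ∑ v, ∑ y ∈ nb G v, dg G y := by
    have := sum_nb_comm (G := G) (fun v _ => dg G v) (fun _ => True) (fun _ => True)
    simp only [Finset.filter_true] at this
    rw [← this]
    apply Finset.sum_congr rfl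
    intro v _
    rw [Finset.sum_const, smul_eq_mul]; rfl
  rw [h1]
  calc _ ≤ ∑ v : V, (Fintype.card V - 1) := Finset.sum_le_sum fun v _ => by have := S_le hG v; omega
    _ = _ := by simp

def ind (G : SimpleGraph V) (p : V → Prop) : SimpleGraph {v // p v} := G.comap Subtype.val

theorem ind_C4F (hG : C4F G) (p : V → Prop) : C4F (ind G p) := by
  refine ⟨fun a b c h1 h2 h3 => hG.tri a.1 b.1 c.1 h1 h2 h3, fun a b c d h1 h2 h3 h4 => ?_⟩
  rcases hG.c4 a.1 b.1 c.1 d.1 h1 h2 h3 h4 with h | h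
  · exact Or.inl (Subtype.ext h)
  · exact Or.inr (Subtype.ext h)

theorem dg_ind (p : V → Prop) [DecidablePred p] [Fintype {v // p v}] (v : {v // p v}) :
    dg (ind G p) v = ((nb G v.1).filter p).card := by
  classical
  rw [dg]
  refine Finset.card_bij (fun w _ => w.1) ?_ ?_ ?_
  · intro a ha
    rw [mem_nb] at ha
    rw [Finset.mem_filter, mem_nb]
    exact ⟨ha, a.2⟩
  · intro a _ b _ h; exact Subtype.ext h
  · intro b hb
    rw [Finset.mem_filter, mem_nb] at hb
    exact ⟨⟨b, hb.2⟩, mem_nb.2 hb.1, rfl⟩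

theorem sum_ind (p : V → Prop) [DecidablePred p] [Fintype {v // p v}] (f : V → ℕ) :
    ∑ v : {v // p v}, f v.1 = ∑ v ∈ Finset.univ.filter p, f v := by
  symm
  apply Finset.sum_subtype
  simp

theorem card_ind (p : V → Prop) [DecidablePred p] [Fintype {v // p v}] :
    Fintype.card {v // p v} = (Finset.univ.filter p).card := by
  rw [Finset.card_eq_sum_ones, ← sum_ind]; simp

theorem sd_ind (p : V → Prop) [DecidablePred p] [Fintype {v // p v}] :
    sd (ind G p) + ∑ v ∈ Finset.univ.filter (fun v => ¬ p v), dg G v +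
      ∑ v ∈ Finset.univ.filter (fun v => ¬ p v), ((nb G v).filter p).card = sd G := by
  have h0 : sd (ind G p) = ∑ v ∈ Finset.univ.filter p, ((nb G v).filter p).card := by
    rw [sd, ← sum_ind]
    exact Finset.sum_congr rfl fun v _ => dg_ind p v
  have h1 : sd G = ∑ v ∈ Finset.univ.filter p, dg G v + ∑ v ∈ Finset.univ.filter (fun v => ¬ p v), dg G v :=
    (Finset.sum_filter_add_sum_filter_not _ _ _).symm
  have h2 : ∑ v ∈ Finset.univ.filter p, dg G v = ∑ v ∈ Finset.univ.filter p, ((nb G v).filter p).card +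
      ∑ v ∈ Finset.univ.filter p, ((nb G v).filter fun w => ¬ p w).card := by
    rw [← Finset.sum_add_distrib]
    apply Finset.sum_congr rfl
    intro v _
    rw [Finset.card_filter_add_card_filter_not, dg]
  have h3 := sum_nb_comm (G := G) (fun _ _ => 1) p fun w => ¬ p w
  simp only [Finset.sum_const, smul_eq_mul, mul_one] at h3
  omega

theorem card_del (u : V) [Fintype {v // v ≠ u}] : Fintype.card {v // v ≠ u} + 1 = Fintype.card V := by
  classical
  rw [card_ind]
  rw [Finset.filter_ne', Finset.card_erase_add_one (Finset.mem_univ _), Finset.card_univ]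

theorem sd_del (u : V) [Fintype {v // v ≠ u}] : sd (ind G fun v => v ≠ u) + 2 * dg G u = sd G := by
  classical
  have h := sd_ind (G := G) fun v => v ≠ u
  have e : (Finset.univ.filter fun v : V => ¬ v ≠ u) = {u} := by ext v; simp
  rw [e, Finset.sum_singleton, Finset.sum_singleton] at h
  have e2 : ((nb G u).filter fun v => v ≠ u) = nb G u := by
    apply Finset.filter_true_of_mem
    intro v hv
    exact (mem_nb.1 hv).ne'
  rw [e2] at h
  change _ + _ + dg G u = _ at h
  omega

theorem dg_del_of_not {u : V} [Fintype {v // v ≠ u}] (v : {v // v ≠ u}) (h : ¬ G.Adj v.1 u) :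
    dg (ind G fun v => v ≠ u) v = dg G v.1 := by
  classical
  rw [dg_ind, dg]
  congr 1
  apply Finset.filter_true_of_mem
  rintro w hw rfl
  exact h (mem_nb.1 hw)

theorem dg_del_of {u : V} [Fintype {v // v ≠ u}] (v : {v // v ≠ u}) (h : G.Adj v.1 u) :
    dg (ind G fun v => v ≠ u) v + 1 = dg G v.1 := by
  classical
  rw [dg_ind, dg, Finset.filter_ne', Finset.card_erase_add_one (mem_nb.2 h)]

theorem sd_edges [DecidableRel G.Adj] [DecidableEq V] : sd G = 2 * G.edgeFinset.card := by
  rw [← G.sum_degrees_eq_twice_card_edges, sd]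
  apply Finset.sum_congr rfl
  intro v _
  rw [dg, ← G.card_neighborFinset_eq_degree]
  congr 1
  ext w
  rw [mem_nb, mem_neighborFinset]

theorem sd_eq_of {T : Finset (Sym2 V)} (h : ∀ e, e ∈ G.edgeSet ↔ e ∈ T) : sd G = 2 * T.card := by
  classical
  rw [sd_edges]
  congr 2
  ext e
  rw [SimpleGraph.mem_edgeFinset, h]

def Bd (n e : ℕ) : Prop := ∀ (V : Type) [Fintype V] (G : SimpleGraph V), C4F G → Fintype.card V = n → sd G ≤ 2 * e

theorem C4F.mono {G H : SimpleGraph V} (hG : C4F G) (h : H ≤ G) : C4F H :=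
  ⟨fun a b c h1 h2 h3 => hG.tri a b c (h h1) (h h2) (h h3),
    fun a b c d h1 h2 h3 h4 => hG.c4 a b c d (h h1) (h h2) (h h3) (h h4)⟩

theorem bd_of {n e : ℕ} (h : ∀ (V : Type) [Fintype V] (G : SimpleGraph V), C4F G → Fintype.card V = n →
    sd G = 2 * (e + 1) → False) : Bd n e := by
  classical
  intro V _ G hG hn
  by_contra hlt
  have h1 := sd_edges (G := G)
  obtain ⟨T, hT, hc⟩ := Finset.exists_subset_card_eq (s := G.edgeFinset) (n := e + 1) (by omega)
  have hle : SimpleGraph.fromEdgeSet (T : Set (Sym2 V)) ≤ G := by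
    intro a b hab
    rw [SimpleGraph.fromEdgeSet_adj] at hab
    have := hT (Finset.mem_coe.1 hab.1)
    rwa [SimpleGraph.mem_edgeFinset, SimpleGraph.mem_edgeSet] at this
  refine h V (SimpleGraph.fromEdgeSet (T : Set (Sym2 V))) (hG.mono hle) hn ?_
  rw [sd_eq_of (T := T), hc]
  intro e
  rw [SimpleGraph.edgeSet_fromEdgeSet, Set.mem_sdiff, Finset.mem_coe]
  refine ⟨fun h => h.1, fun h => ⟨h, ?_⟩⟩
  have := hT h
  rw [SimpleGraph.mem_edgeFinset] at this
  exact G.not_isDiag_of_mem_edgeSet this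

theorem Bd.min {n e d : ℕ} (hB : Bd n e) (hG : C4F G) (hn : Fintype.card V = n + 1)
    (hs : 2 * (e + d) ≤ sd G) (u : V) : d ≤ dg G u := by
  classical
  have h1 := hB _ (ind G fun v => v ≠ u) (ind_C4F hG _) (by have := card_del u; omega)
  have h2 := sd_del (G := G) u
  omega

theorem sum_ge {d : ℕ} (h : ∀ v, d ≤ dg G v) : Fintype.card V * d ≤ sd G := by
  rw [sd, ← smul_eq_mul, ← Finset.card_univ]
  exact Finset.card_nsmul_le_sum _ _ _ fun v _ => h v

theorem S_ge {d : ℕ} (h : ∀ v, d ≤ dg G v) (x : V) : dg G x * d ≤ ∑ y ∈ nb G x, dg G y := by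
  rw [dg, ← smul_eq_mul]
  exact Finset.card_nsmul_le_sum _ _ _ fun v _ => h v

theorem exists_gt {d : ℕ} (h : Fintype.card V * d < sd G) : ∃ v, d < dg G v := by
  by_contra! hc
  have : sd G ≤ Fintype.card V * d := by
    rw [sd, ← smul_eq_mul, ← Finset.card_univ]
    exact Finset.sum_le_card_nsmul _ _ _ fun v _ => hc v
  omega

theorem stepA {n e' d e : ℕ} (hB : Bd n e') (h1 : e' + d = e + 1) (h2 : 2 * (e + 1) < (n + 1) * d) :
    Bd (n + 1) e := by
  apply bd_of
  intro V _ G hG hn hs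
  have := sum_ge (hB.min (d := d) hG hn (by omega))
  rw [hn] at this
  omega

theorem dle {n d D : ℕ} (hG : C4F G) (hn : Fintype.card V = n + 1) (hd : ∀ v, d ≤ dg G v)
    (h : n < (D + 1) * d) (v : V) : dg G v ≤ D := by
  by_contra! hc
  have h1 := S_le hG v
  have h2 := S_ge hd v
  have h3 : (D + 1) * d ≤ dg G v * d := Nat.mul_le_mul_right _ hc
  omega

theorem stepB {n e' d e : ℕ} (hB : Bd n e') (h1 : e' + d = e + 1) (h2 : (n + 1) * d < 2 * (e + 1))
    (h3 : n < (d + 1) * d) : Bd (n + 1) e := by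
  apply bd_of
  intro V _ G hG hn hs
  obtain ⟨v, hv⟩ := exists_gt (G := G) (d := d) (by rw [hn]; omega)
  have := dle hG hn (hB.min (d := d) hG hn (by omega)) h3 v
  omega

theorem bd10 : Bd 10 15 := by
  apply bd_of
  intro V _ G hG hn hs
  have h1 := sum_sq hG
  rw [hn] at h1
  have h2 := sq_sum_le_card_mul_sum_sq (s := Finset.univ) (f := dg G)
  rw [Finset.card_univ, hn] at h2
  simp only [pow_two] at h2
  change sd G * sd G ≤ _ at h2
  rw [hs] at h2
  omega

theorem bd11 : Bd 11 16 := by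
  apply bd_of
  intro V _ G hG hn hs
  classical
  have h2 : ∀ v, 2 ≤ dg G v := bd10.min hG hn (by omega)
  by_cases h3 : ∀ v, 3 ≤ dg G v
  · obtain ⟨v, hv⟩ := exists_gt (G := G) (d := 3) (by rw [hn]; omega)
    have := dle hG hn h3 (D := 3) (by norm_num) v
    omega
  push Not at h3
  obtain ⟨u, hu⟩ := h3
  have hu : dg G u = 2 := by have := h2 u; omega
  have c1 := card_del u
  have c2 := sd_del (G := G) u
  have hH := ind_C4F hG fun v => v ≠ u
  obtain ⟨H, eH⟩ : ∃ H, H = ind G fun v => v ≠ u := ⟨_, rfl⟩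
  rw [← eH] at c2 hH
  have hd3 : ∀ v, dg H v = 3 := by
    have h1 := sum_sq hH
    have e9 : Fintype.card {v // v ≠ u} = 10 := by omega
    rw [e9] at h1
    have hz : ∑ v, ((dg H v : ℤ) - 3) ^ 2 ≤ 0 := by
      have : ∀ v, ((dg H v : ℤ) - 3) ^ 2 = (dg H v * dg H v : ℕ) - 6 * (dg H v : ℕ) + 9 := by
        intro v; push_cast; ring
      simp only [this]
      rw [Finset.sum_add_distrib, Finset.sum_sub_distrib, ← Finset.mul_sum, ← Nat.cast_sum, ← Nat.cast_sum,
        Finset.sum_const, Finset.card_univ, e9]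
      change ((_ : ℕ) : ℤ) - 6 * ((sd H : ℕ) : ℤ) + _ ≤ 0
      have : sd H = 30 := by omega
      rw [this]
      simp only [nsmul_eq_mul]
      push_cast
      have : ((∑ v, dg H v * dg H v : ℕ) : ℤ) ≤ 90 := by exact_mod_cast h1
      push_cast at this
      linarith
    intro v
    have h0 : ((dg H v : ℤ) - 3) ^ 2 = 0 := by
      apply le_antisymm _ (sq_nonneg _)
      exact le_trans (Finset.single_le_sum (f := fun v => ((dg H v : ℤ) - 3) ^ 2)
        (fun i _ => sq_nonneg _) (Finset.mem_univ v)) hz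
    have := pow_eq_zero_iff (two_ne_zero) |>.1 h0
    omega
  obtain ⟨p, q, hpq, hnb⟩ := Finset.card_eq_two.1 hu
  have hp : G.Adj u p := mem_nb.1 (by rw [hnb]; simp)
  have hq : G.Adj u q := mem_nb.1 (by rw [hnb]; simp)
  -- add to the neighbourhood sum at p
  have hSp : ∑ y ∈ nb G p, dg G y + 1 ≤ 11 := by rw [← hn]; exact S_le hG p
  have dgG : ∀ v, v ≠ u → G.Adj v u → dg G v = 4 := by
    intro v hv h
    have : _ = dg G v := dg_del_of (G := G) (⟨v, hv⟩ : {v // v ≠ u}) h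
    have h3 := hd3 ⟨v, hv⟩
    rw [eH] at h3
    omega
  have dgG' : ∀ v, v ≠ u → 3 ≤ dg G v := by
    intro v hv
    have h3 := hd3 ⟨v, hv⟩
    rw [eH, dg_ind] at h3
    rw [dg, ← h3]
    exact Finset.card_filter_le _ _
  have h4 : dg G p = 4 := dgG p hp.ne' hp.symm
  have hmem : u ∈ nb G p := mem_nb.2 hp.symm
  rw [← Finset.add_sum_erase _ _ hmem, hu] at hSp
  have h5 : ((nb G p).erase u).card • 3 ≤ ∑ y ∈ (nb G p).erase u, dg G y :=
    Finset.card_nsmul_le_sum _ _ _ fun y hy => dgG' y (Finset.ne_of_mem_erase hy)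
  rw [Finset.card_erase_of_mem hmem, show (nb G p).card = 4 from h4, smul_eq_mul] at h5
  omega

theorem bd12 : Bd 12 18 := stepB bd11 (d := 3) (by norm_num) (by norm_num) (by norm_num)
theorem bd13 : Bd 13 21 := stepA bd12 (d := 4) (by norm_num) (by norm_num)

end Basic

section Steps

set_option linter.unusedSectionVars false

variable {V : Type} [Fintype V] {G : SimpleGraph V}

theorem lonb_le (lo : ℕ) (v : V) : lonb G lo v ≤ dg G v := Finset.card_filter_le _ _

theorem lonb_lt {lo : ℕ} {v w : V} (h : G.Adj v w) (hw : dg G w ≠ lo) : lonb G lo v < dg G v := by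
  apply Finset.card_lt_card
  rw [Finset.filter_ssubset]
  exact ⟨w, mem_nb.2 h, hw⟩

theorem ite_eqn {lo d : ℕ} (h : d = lo ∨ d = lo + 1) : d + (if d = lo then 1 else 0) = lo + 1 := by
  rcases h with h | h
  · simp [h]
  · simp [h]

theorem S_eq {lo : ℕ} (hd : ∀ v, dg G v = lo ∨ dg G v = lo + 1) (x : V) :
    ∑ y ∈ nb G x, dg G y + lonb G lo x = (lo + 1) * dg G x := by
  rw [lonb, Finset.card_filter, ← Finset.sum_add_distrib, Finset.sum_congr rfl fun y _ => ite_eqn (hd y),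
    Finset.sum_const, smul_eq_mul, mul_comm]; rfl

theorem sd_eq {lo : ℕ} (hd : ∀ v, dg G v = lo ∨ dg G v = lo + 1) :
    sd G + (Finset.univ.filter fun v => dg G v = lo).card = (lo + 1) * Fintype.card V := by
  rw [sd, Finset.card_filter, ← Finset.sum_add_distrib, Finset.sum_congr rfl fun y _ => ite_eqn (hd y),
    Finset.sum_const, smul_eq_mul, mul_comm]; rfl

theorem lo_sum {lo k : ℕ} (h : ∀ v, dg G v ≠ lo → k ≤ lonb G lo v) :
    k * (Fintype.card V - (Finset.univ.filter fun v => dg G v = lo).card) ≤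
      lo * (Finset.univ.filter fun v => dg G v = lo).card := by
  have h1 := sum_nb_comm (G := G) (fun _ _ => 1) (fun v => ¬ dg G v = lo) fun w => dg G w = lo
  simp only [Finset.sum_const, smul_eq_mul, mul_one] at h1
  have h2 : (Finset.univ.filter fun v => ¬ dg G v = lo).card • k ≤
      ∑ v ∈ Finset.univ.filter (fun v => ¬ dg G v = lo), ((nb G v).filter fun w => dg G w = lo).card := by
    apply Finset.card_nsmul_le_sum
    intro v hv
    exact h v (Finset.mem_filter.1 hv).2
  have h3 : ∑ w ∈ Finset.univ.filter (fun v => dg G v = lo), ((nb G w).filter fun v => ¬ dg G v = lo).card ≤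
      (Finset.univ.filter fun v => dg G v = lo).card • lo := by
    apply Finset.sum_le_card_nsmul
    intro v hv
    rw [Finset.mem_filter] at hv
    exact (Finset.card_filter_le _ _).trans hv.2.le
  have h4 := Finset.card_filter_add_card_filter_not (s := (Finset.univ : Finset V)) (fun v => dg G v = lo)
  rw [Finset.card_univ] at h4
  rw [smul_eq_mul] at h2 h3
  rw [mul_comm k, mul_comm lo]
  rw [show Fintype.card V - (Finset.univ.filter fun v => dg G v = lo).card =
    (Finset.univ.filter fun v => ¬ dg G v = lo).card by omega]
  omega

/-- the numeric side conditions of a search -/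
def okC (c : Cas) (k : ℕ) (hk lk : List ℕ) : Prop :=
  c.n ≤ 32 ∧ 1 ≤ c.lo ∧ c.lo < 30 ∧ c.hi = c.lo + 1 ∧ c.D = c.hi ∧ c.ar ≤ c.D ∧ c.k0 ≤ k ∧
  (∀ j < c.hi, k ≤ j → j ∈ hk) ∧ ((∀ j < c.lo, j ∈ lk) ∨ c.noll = true ∧ 0 ∈ lk)

theorem no2 (c : Cas) (leaf : ℕ → ℕ → Bool) (P : ℕ → (ℕ → ℕ → Prop) → Prop) (k : ℕ) (hk lk : List ℕ)
    (hs : List ℕ) (hall : c.all leaf (c.types hk lk) hs = true) (hok : okC c k hk lk)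
    (hP : ∀ F E u w, u < c.n → w < c.n → F.testBit u = F.testBit w → P F E → P F (swE u w E))
    (hleaf : ∀ F A E, leaf F A = true → GE c.n E → (∀ i < 32, ∀ j < 32, (E i j ↔ bt A i j)) → ¬ P F E)
    (hG : C4F G) (hV : Fintype.card V = c.n) (hd : ∀ v, dg G v = c.lo ∨ dg G v = c.lo + 1)
    (hsd : sd G + c.nl = (c.lo + 1) * c.n)
    (hno : c.noll = true → ∀ v w, G.Adj v w → dg G v = c.lo → dg G w = c.lo → False)
    (hkk : ∀ v, dg G v = c.lo + 1 → k ≤ lonb G c.lo v)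
    (x : V) (hx : dg G x = c.lo + 1) (hax : lonb G c.lo x = c.ar)
    (hP0 : ∀ Ls : List V, Ls.Nodup → (∀ v, v ∈ Ls) → ∀ F : ℕ,
      (∀ i v, Ls[i]? = some v → (F.testBit i = true ↔ dg G v = c.lo)) → P F (EL G Ls)) : False := by
  obtain ⟨h1, h2, h3, h4, h5, h6, h7, h8, h9⟩ := hok
  have hnl := sd_eq hd
  rw [hV] at hnl
  refine no_graph c leaf P hk lk hs hall h1 (by omega) h6 h2 (by omega) (by omega) (by omega) hP hleaf hG hV x
    (by omega) (fun v _ => by rw [h4]; exact hd v) hax (by omega) hno ?_ ?_ ?_ hP0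
  · intro v hv
    exact h7.trans (hkk v ((hd v).resolve_left hv))
  · intro v hv hv'
    refine h8 _ ?_ (hkk v (by omega))
    rw [← hv']
    exact lonb_lt hv.symm (by omega)
  · intro v hv hv'
    rcases h9 with h9 | h9
    · refine h9 _ ?_
      rw [← hv']
      exact lonb_lt hv.symm (by omega)
    · have : lonb G c.lo v = 0 := by
        rw [lonb, Finset.card_eq_zero, Finset.eq_empty_iff_forall_notMem]
        intro w hw
        rw [Finset.mem_filter, mem_nb] at hw
        exact hno h9.1 v w hw.1 hv' hw.2
      rw [this]; exact h9.2

/-- the outcome of a search without leaves -/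
def Eng (n lo s : ℕ) (noll : Bool) (k ar : ℕ) : Prop :=
  ∀ (V : Type) [Fintype V] (G : SimpleGraph V), C4F G → Fintype.card V = n →
    (∀ v, dg G v = lo ∨ dg G v = lo + 1) → sd G = s →
    (noll = true → ∀ v w, G.Adj v w → dg G v = lo → dg G w = lo → False) →
    (∀ v, dg G v = lo + 1 → k ≤ lonb G lo v) → ∀ x, dg G x = lo + 1 → lonb G lo x = ar → False

theorem eng_of (c : Cas) (k : ℕ) (hk lk : List ℕ) (hs : List ℕ) (s : ℕ)
    (hall : c.all noLeaf (c.types hk lk) hs = true) (hok : okC c k hk lk)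
    (hsd : s + c.nl = (c.lo + 1) * c.n) : Eng c.n c.lo s c.noll k c.ar := by
  intro V _ G hG hV hd hs hno hkk x hx hax
  exact no2 c noLeaf (fun _ _ => True) k hk lk _ hall hok (fun _ _ _ _ _ _ _ _ => trivial)
    (fun _ _ _ h => by cases h) hG hV hd (by rw [hs]; exact hsd) hno hkk x hx hax (fun _ _ _ _ _ => trivial)

theorem a_ge {n lo : ℕ} (hG : C4F G) (hV : Fintype.card V = n + 1)
    (hd : ∀ v, dg G v = lo ∨ dg G v = lo + 1) (v : V) (hv : dg G v = lo + 1) :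
    (lo + 1) * (lo + 1) - n ≤ lonb G lo v := by
  have h1 := S_eq hd v
  have h2 := S_le hG v
  rw [hv] at h1
  omega

theorem twoDeg {n e' lo : ℕ} (hB : Bd n e') (hG : C4F G) (hV : Fintype.card V = n + 1)
    (hs : sd G = 2 * (e' + lo)) (h : n < (lo + 2) * lo) (v : V) : dg G v = lo ∨ dg G v = lo + 1 := by
  have h1 := hB.min (d := lo) hG hV (by omega)
  have h2 := dle hG hV h1 (D := lo + 1) h v
  have := h1 v
  omega

/-- one step up in the number of missing low neighbours -/
theorem a_step {lo k : ℕ} (hk : ∀ v, dg G v = lo + 1 → k ≤ lonb G lo v)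
    (h : ∀ x, dg G x = lo + 1 → lonb G lo x = k → False) :
    ∀ v, dg G v = lo + 1 → k + 1 ≤ lonb G lo v := by
  intro v hv
  exact lt_of_le_of_ne (hk v hv) fun e => h v hv e.symm

theorem e14a : Eng 14 3 48 false 3 3 := eng_of c14a 3 _ _ _ 48 chk14a (by unfold okC; decide) rfl
theorem e14c : Eng 14 3 48 false 4 4 := eng_of c14c 4 _ _ _ 48 chk14c (by unfold okC; decide) rfl
theorem e16 : Eng 16 3 58 true 1 1 := eng_of c16 1 _ _ _ 58 chk16 (by unfold okC; decide) rfl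
theorem e21 : Eng 21 4 90 false 5 5 := eng_of c21 5 _ _ _ 90 chk21 (by unfold okC; decide) rfl
theorem e22a : Eng 22 4 96 false 4 4 := eng_of c22a 4 _ _ _ 96 chk22a (by unfold okC; decide) rfl
theorem e22b : Eng 22 4 96 false 5 5 := eng_of c22b 5 _ _ _ 96 chk22b (by unfold okC; decide) rfl
theorem e23a : Eng 23 4 102 false 3 3 := eng_of c23a 3 _ _ _ 102 chk23a (by unfold okC; decide) rfl
theorem e23b : Eng 23 4 102 false 4 4 := eng_of c23b 4 _ _ _ 102 chk23b (by unfold okC; decide) rfl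
theorem e23c : Eng 23 4 102 false 5 5 := eng_of c23c 5 _ _ _ 102 chk23c (by unfold okC; decide) rfl
theorem e24b : Eng 24 4 108 false 3 3 := eng_of c24b 3 _ _ _ 108 chk24b (by unfold okC; decide) rfl
theorem e24c : Eng 24 4 108 false 4 4 := eng_of c24c 4 _ _ _ 108 chk24c (by unfold okC; decide) rfl
theorem e25a : Eng 25 4 116 true 1 1 := eng_of c25a 1 _ _ _ 116 chk25a (by unfold okC; decide) rfl
theorem e25b : Eng 25 4 116 true 1 2 := eng_of c25b 1 _ _ _ 116 chk25b (by unfold okC; decide) rfl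
theorem e26 : Eng 26 4 122 true 1 1 := eng_of c26 1 _ _ _ 122 chk26 (by unfold okC; decide) rfl

theorem Eng.kill {n lo s k : ℕ} (E : Eng n lo s false k k) (hG : C4F G) (hV : Fintype.card V = n)
    (hd : ∀ v, dg G v = lo ∨ dg G v = lo + 1) (hs : sd G = s)
    (hk : ∀ v, dg G v = lo + 1 → k ≤ lonb G lo v) : ∀ v, dg G v = lo + 1 → k + 1 ≤ lonb G lo v :=
  a_step hk (E V G hG hV hd hs (fun h => by cases h) hk)

theorem top {n lo s : ℕ} (hV : Fintype.card V = n) (hs : sd G = s) (h : n * lo < s)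
    (hd : ∀ v, dg G v = lo ∨ dg G v = lo + 1)
    (hk : ∀ v, dg G v = lo + 1 → lo + 2 ≤ lonb G lo v) : False := by
  obtain ⟨v, hv⟩ := exists_gt (G := G) (d := lo) (by rw [hV, hs]; exact h)
  have hv' : dg G v = lo + 1 := by have := hd v; omega
  have h1 := hk v hv'
  have h2 := lonb_le (G := G) lo v
  omega

theorem bd14 : Bd 14 23 := by
  apply bd_of
  intro V _ G hG hn hs
  have hd := twoDeg (lo := 3) bd13 hG hn (by omega) (by norm_num)
  exact top hn hs (by norm_num) hd (e14c.kill hG hn hd hs (e14a.kill hG hn hd hs (a_ge hG hn hd)))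

theorem bd15 : Bd 15 26 := stepA bd14 (d := 4) (by norm_num) (by norm_num)

end Steps

section Steps2

set_option linter.unusedSectionVars false

variable {V : Type} [Fintype V] {G : SimpleGraph V}

open Classical in
theorem del2 {u w : V} (huw : G.Adj u w) :
    Fintype.card {v // v ≠ u ∧ v ≠ w} + 2 = Fintype.card V ∧
    sd (ind G fun v => v ≠ u ∧ v ≠ w) + 2 * (dg G u + dg G w) = sd G + 2 := by
  have e : (Finset.univ.filter fun v : V => ¬ (v ≠ u ∧ v ≠ w)) = {u, w} := by
    ext v; simp; tauto
  constructor
  · rw [card_ind]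
    have := Finset.card_filter_add_card_filter_not (s := (Finset.univ : Finset V)) (fun v => v ≠ u ∧ v ≠ w)
    rw [e, Finset.card_pair huw.ne, Finset.card_univ] at this
    exact this
  · have h := sd_ind (G := G) fun v => v ≠ u ∧ v ≠ w
    rw [e, Finset.sum_pair huw.ne, Finset.sum_pair huw.ne] at h
    have h1 : ∀ a b : V, G.Adj a b → (∀ v, (v ≠ u ∧ v ≠ w) ↔ (v ≠ a ∧ v ≠ b)) →
        ((nb G a).filter fun v => v ≠ u ∧ v ≠ w).card + 1 = dg G a := by
      intro a b hab hh
      have : ((nb G a).filter fun v => v ≠ u ∧ v ≠ w) = (nb G a).erase b := by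
        ext v
        rw [Finset.mem_filter, Finset.mem_erase, hh, mem_nb]
        exact ⟨fun h => ⟨h.2.2, h.1⟩, fun h => ⟨h.2, h.2.ne', h.1⟩⟩
      rw [this, Finset.card_erase_add_one (mem_nb.2 hab)]; rfl
    have h2 := h1 u w huw fun v => Iff.rfl
    have h3 := h1 w u huw.symm fun v => and_comm
    omega

theorem noAdj {n e d : ℕ} (hB : Bd n e) (hG : C4F G) (hn : Fintype.card V = n + 2)
    (hs : 2 * (e + 1) + 4 * d ≤ sd G + 2) (u w : V) (huw : G.Adj u w) (hu : dg G u = d) (hw : dg G w = d) :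
    False := by
  classical
  obtain ⟨h1, h2⟩ := del2 huw
  have := hB _ (ind G fun v => v ≠ u ∧ v ≠ w) (ind_C4F hG _) (by omega)
  omega

/-- neighbours in the graph with a vertex deleted -/
theorem S_del {d n : ℕ} {u : V} [Fintype {v // v ≠ u}] (hG : C4F G) (hn : Fintype.card V = n + 1)
    (hd : ∀ v, d ≤ dg (ind G fun v => v ≠ u) v) (x : V) (hxu : x ≠ u) (h : ¬ G.Adj x u) : dg G x * d + 1 ≤ n := by
  have h1 := S_le (ind_C4F hG fun v => v ≠ u) ⟨x, hxu⟩
  have h2 := S_ge hd ⟨x, hxu⟩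
  have h3 := dg_del_of_not (G := G) (⟨x, hxu⟩ : {v // v ≠ u}) h
  have h4 := card_del u
  simp only at h3
  rw [h3] at h2
  omega

theorem step16 {n d f0 f1 : ℕ} (hB0 : Bd n f0) (hB1 : Bd (n + 1) f1) (hf : f1 = f0 + d) (hd1 : 1 ≤ d)
    (hD : n + 1 < (d + 3) * d) (hD2 : n + 1 ≤ (d + 2) * d)
    (hS : 2 * (f1 + d) < d * (d + 2) + (d + 2) + (n + 2 - (d + 3)) * (d + 1)) 
    (hG : C4F G) (hV : Fintype.card V = n + 2) (hs : sd G = 2 * (f1 + d)) :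
    (∀ v, dg G v = d ∨ dg G v = d + 1) ∧ ∀ v w, G.Adj v w → dg G v = d → dg G w = d → False := by
  classical
  have hno : ∀ v w, G.Adj v w → dg G v = d → dg G w = d → False :=
    fun v w h => noAdj hB0 hG hV (by omega) v w h
  have hmin := hB1.min (d := d) hG hV (by omega)
  have hmax := dle hG hV hmin (D := d + 2) hD
  refine ⟨fun x => ?_, hno⟩
  by_contra hx
  have hx : dg G x = d + 2 := by
    have := hmin x; have := hmax x; omega
  have hnb : ∀ y, G.Adj x y → dg G y = d := by
    intro y hy
    by_contra hyd
    have h1 := S_le hG x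
    have h2 : ∑ z ∈ nb G x, d < ∑ z ∈ nb G x, dg G z :=
      Finset.sum_lt_sum (fun z _ => hmin z) ⟨y, mem_nb.2 hy, lt_of_le_of_ne (hmin y) fun h => hyd h.symm⟩
    rw [Finset.sum_const, smul_eq_mul] at h2
    change dg G x * d < _ at h2
    rw [hx] at h2
    omega
  have hall : ∀ u, dg G u = d → G.Adj x u := by
    intro u hu
    by_contra hxu
    have h1 := sd_del (G := G) u
    have h2 := card_del u
    have h3 := hB0.min (d := d) (ind_C4F hG fun v => v ≠ u) (by omega) (by omega)
    have h4 := S_del hG hV h3 x (by rintro rfl; omega) hxu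
    rw [hx] at h4
    omega
  have e : (Finset.univ.filter fun v => dg G v = d) = nb G x := by
    ext v
    rw [Finset.mem_filter, mem_nb]
    exact ⟨fun h => hall v h.2, fun h => ⟨Finset.mem_univ _, hnb v h⟩⟩
  have hlow : ∀ v, (d + 1) + (if v = x then 1 else 0) ≤ dg G v + (if dg G v = d then 1 else 0) := by
    intro v
    by_cases hv : v = x
    · subst hv; simp [hx]
    · have := hmin v
      simp only [hv, if_false]
      split_ifs <;> omega
  have h5 := Finset.sum_le_sum fun v (_ : v ∈ Finset.univ) => hlow v
  have hL : ∑ v : V, ((d + 1) + if v = x then 1 else 0) = (n + 2) * (d + 1) + 1 := by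
    rw [Finset.sum_add_distrib (f := fun _ => d + 1), Finset.sum_const, Finset.card_univ, hV]
    simp
  have hR : ∑ v : V, (dg G v + if dg G v = d then 1 else 0) = sd G + dg G x := by
    rw [Finset.sum_add_distrib, ← Finset.card_filter, e]; rfl
  rw [hL, hR] at h5
  rw [hx, hs] at h5
  have hnd : d + 3 ≤ n + 2 := by
    have := Finset.card_lt_univ_of_notMem (s := nb G x) (x := x) (by rw [mem_nb]; exact G.loopless.irrefl x)
    change dg G x < _ at this
    omega
  have e7 : (n + 2) * (d + 1) = (n + 2 - (d + 3)) * (d + 1) + (d + 3) * (d + 1) := by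
    rw [← Nat.add_mul]; congr 1; omega
  nlinarith

theorem bd16 : Bd 16 28 := by
  apply bd_of
  intro V _ G hG hn hs
  obtain ⟨hd, hno⟩ := step16 (n := 14) (d := 3) bd14 bd15 (by norm_num) (by norm_num) (by norm_num) (by norm_num)
    (by norm_num) hG hn hs
  have ha := a_ge hG hn hd
  have h2 := a_step ha fun x hx hax => e16 V G hG hn hd hs (fun _ => hno) ha x hx hax
  have h3 := lo_sum (G := G) (lo := 3) (k := 2) fun v hv => h2 v ((hd v).resolve_left hv)
  have h4 := sd_eq hd
  rw [hn] at h3 h4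
  omega

theorem bd17 : Bd 17 31 := stepA bd16 (d := 4) (by norm_num) (by norm_num)
theorem bd18 : Bd 18 34 := stepA bd17 (d := 4) (by norm_num) (by norm_num)
theorem bd19 : Bd 19 38 := stepA bd18 (d := 5) (by norm_num) (by norm_num)
theorem bd20 : Bd 20 41 := stepB bd19 (d := 4) (by norm_num) (by norm_num) (by norm_num)

theorem bd21 : Bd 21 44 := by
  apply bd_of
  intro V _ G hG hn hs
  have hd := twoDeg (lo := 4) bd20 hG hn (by omega) (by norm_num)
  exact top hn hs (by norm_num) hd (e21.kill hG hn hd hs (a_ge hG hn hd))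

theorem bd22 : Bd 22 47 := by
  apply bd_of
  intro V _ G hG hn hs
  have hd := twoDeg (lo := 4) bd21 hG hn (by omega) (by norm_num)
  exact top hn hs (by norm_num) hd (e22b.kill hG hn hd hs (e22a.kill hG hn hd hs (a_ge hG hn hd)))

theorem bd23 : Bd 23 50 := by
  apply bd_of
  intro V _ G hG hn hs
  have hd := twoDeg (lo := 4) bd22 hG hn (by omega) (by norm_num)
  exact top hn hs (by norm_num) hd (e23c.kill hG hn hd hs (e23b.kill hG hn hd hs
    (e23a.kill hG hn hd hs (a_ge hG hn hd))))

theorem bd24 : Bd 24 54 := stepA bd23 (d := 5) (by norm_num) (by norm_num)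

theorem bd25 : Bd 25 57 := by
  apply bd_of
  intro V _ G hG hn hs
  obtain ⟨hd, hno⟩ := step16 (n := 23) (d := 4) bd23 bd24 (by norm_num) (by norm_num) (by norm_num) (by norm_num)
    (by norm_num) hG hn hs
  have ha := a_ge hG hn hd
  have h2 := a_step ha fun x hx hax => e25a V G hG hn hd hs (fun _ => hno) ha x hx hax
  have h3 := a_step h2 fun x hx hax => e25b V G hG hn hd hs (fun _ => hno) ha x hx hax
  have h3 := lo_sum (G := G) (lo := 4) (k := 3) fun v hv => h3 v ((hd v).resolve_left hv)
  have h4 := sd_eq hd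
  rw [hn] at h3 h4
  omega

end Steps2

section Final

set_option linter.unusedSectionVars false

variable {V : Type} [Fintype V] {G : SimpleGraph V}

theorem enumS {n : ℕ} (S : Finset V) (h : S.card = n) :
    ∃ f : Fin n → V, Function.Injective f ∧ ∀ v, v ∈ S ↔ ∃ i, v = f i := by
  have e := S.equivFinOfCardEq h
  refine ⟨fun i => (e.symm i).1, fun i j hij => e.symm.injective (Subtype.ext hij), fun v => ?_⟩
  constructor
  · intro hv
    exact ⟨e ⟨v, hv⟩, by simp⟩
  · rintro ⟨i, rfl⟩
    exact (e.symm i).2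

theorem enumT (hG : C4F G) {u w : V} (huw : G.Adj u w) (hu : dg G u = 4) (hw : dg G w = 4) :
    ∃ t : Fin 6 → V, Function.Injective t ∧ (∀ i, i.val / 3 = 0 → G.Adj u (t i) ∧ t i ≠ w) ∧
      (∀ i, i.val / 3 ≠ 0 → G.Adj w (t i) ∧ t i ≠ u) ∧
      (∀ v, v ≠ u → v ≠ w → (G.Adj v u ∨ G.Adj v w) → ∃ i, v = t i) := by
  classical
  obtain ⟨f, f1, f2⟩ := enumS ((nb G u).erase w) (n := 3)
    (by rw [Finset.card_erase_of_mem (mem_nb.2 huw)]; change dg G u - 1 = 3; omega)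
  obtain ⟨g, g1, g2⟩ := enumS ((nb G w).erase u) (n := 3)
    (by rw [Finset.card_erase_of_mem (mem_nb.2 huw.symm)]; change dg G w - 1 = 3; omega)
  have f3 : ∀ i, G.Adj u (f i) ∧ f i ≠ w := fun i => by
    have := (f2 (f i)).2 ⟨i, rfl⟩
    rw [Finset.mem_erase, mem_nb] at this; exact this.symm
  have g3 : ∀ i, G.Adj w (g i) ∧ g i ≠ u := fun i => by
    have := (g2 (g i)).2 ⟨i, rfl⟩
    rw [Finset.mem_erase, mem_nb] at this; exact this.symm
  have hfg : ∀ i j, f i ≠ g j := fun i j e =>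
    hG.tri u (f i) w (f3 i).1 (by rw [e]; exact (g3 j).1.symm) huw.symm
  refine ⟨fun i => if h : i.val < 3 then f ⟨i.val, h⟩ else g ⟨i.val - 3, by omega⟩, ?_, ?_, ?_, ?_⟩
  · intro i j hij
    simp only at hij
    split_ifs at hij with a b b
    · have := congrArg Fin.val (f1 hij); simp only at this; exact Fin.ext this
    · exact (hfg _ _ hij).elim
    · exact (hfg _ _ hij.symm).elim
    · have := congrArg Fin.val (g1 hij); simp only at this; apply Fin.ext; omega
  · intro i hi
    simp only
    rw [dif_pos (show i.val < 3 by omega)]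
    exact f3 _
  · intro i hi
    simp only
    rw [dif_neg (show ¬ i.val < 3 by omega)]
    exact g3 _
  · intro v h1 h2 h
    rcases h with h | h
    · obtain ⟨i, hi⟩ := (f2 v).1 (Finset.mem_erase.2 ⟨h2, mem_nb.2 h.symm⟩)
      refine ⟨⟨i.val, by omega⟩, ?_⟩
      simp only [i.2, dif_pos]; exact hi
    · obtain ⟨i, hi⟩ := (g2 v).1 (Finset.mem_erase.2 ⟨h1, mem_nb.2 h.symm⟩)
      refine ⟨⟨i.val + 3, by omega⟩, ?_⟩
      simp only [show ¬ i.val + 3 < 3 by omega, dif_neg, not_false_eq_true, Nat.add_sub_cancel]; exact hi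

open Classical in
theorem dg_del2 (hG : C4F G) {u w : V} (huw : G.Adj u w) (v : {v // v ≠ u ∧ v ≠ w}) :
    ((G.Adj v.1 u ∨ G.Adj v.1 w) → dg (ind G fun v => v ≠ u ∧ v ≠ w) v + 1 = dg G v.1) ∧
    (¬ (G.Adj v.1 u ∨ G.Adj v.1 w) → dg (ind G fun v => v ≠ u ∧ v ≠ w) v = dg G v.1) := by
  rw [dg_ind]
  constructor
  · intro h
    obtain ⟨a, ha, hb⟩ : ∃ a, G.Adj v.1 a ∧ ((nb G v.1).filter fun v => v ≠ u ∧ v ≠ w) = (nb G v.1).erase a := by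
      rcases h with h | h
      · refine ⟨u, h, ?_⟩
        ext z
        rw [Finset.mem_filter, Finset.mem_erase, mem_nb]
        refine ⟨fun k => ⟨k.2.1, k.1⟩, fun k => ⟨k.2, k.1, ?_⟩⟩
        rintro rfl
        exact hG.tri _ _ _ h huw k.2.symm
      · refine ⟨w, h, ?_⟩
        ext z
        rw [Finset.mem_filter, Finset.mem_erase, mem_nb]
        refine ⟨fun k => ⟨k.2.2, k.1⟩, fun k => ⟨k.2, ?_, k.1⟩⟩
        rintro rfl
        exact hG.tri _ _ _ h huw.symm k.2.symm
    rw [hb, Finset.card_erase_add_one (mem_nb.2 ha)]; rfl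
  · intro h
    rw [Finset.filter_true_of_mem]
    · rfl
    · intro z hz
      rw [mem_nb] at hz
      exact ⟨fun e => h (Or.inl (e ▸ hz)), fun e => h (Or.inr (e ▸ hz))⟩

theorem adjCase (hG : C4F G) (hV : Fintype.card V = 26) (hs : sd G = 122) {u w : V} (huw : G.Adj u w)
    (hu : dg G u = 4) (hw : dg G w = 4) :
    (∀ v, dg G v ≤ 5) ∧ ∃ x, dg G x = 5 ∧ ∀ y, G.Adj x y → 5 ≤ dg G y := by
  classical
  by_contra hcon
  obtain ⟨t, t1, t2, t3, t4⟩ := enumT hG huw hu hw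
  obtain ⟨c1, c2⟩ := del2 huw
  have hdel := dg_del2 hG huw
  have hC := ind_C4F hG fun v => v ≠ u ∧ v ≠ w
  have hHadj : ∀ a b : {v // v ≠ u ∧ v ≠ w}, (ind G fun v => v ≠ u ∧ v ≠ w).Adj a b ↔ G.Adj a.1 b.1 :=
    fun a b => Iff.rfl
  obtain ⟨H, eH⟩ : ∃ H, H = ind G fun v => v ≠ u ∧ v ≠ w := ⟨_, rfl⟩
  rw [← eH] at c2 hdel hC hHadj
  have hn : Fintype.card {v // v ≠ u ∧ v ≠ w} = 24 := by omega
  have hsH : sd H = 108 := by omega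
  have hd := twoDeg (lo := 4) bd23 hC hn (by omega) (by norm_num)
  have ha := a_ge hC hn hd
  have tm : ∀ i, t i ≠ u ∧ t i ≠ w := by
    intro i
    by_cases h : i.val / 3 = 0
    · exact ⟨(t2 i h).1.ne', (t2 i h).2⟩
    · exact ⟨(t3 i h).2, (t3 i h).1.ne'⟩
  have tQ : ∀ i, G.Adj (t i) u ∨ G.Adj (t i) w := by
    intro i
    by_cases h : i.val / 3 = 0
    · exact Or.inl (t2 i h).1.symm
    · exact Or.inr (t3 i h).1.symm
  have key : ∀ x, dg H x = 4 + 1 → lonb H 4 x = 2 → False := by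
    intro x hx hax
    refine no2 c24a leafB P24 2 _ _ _ chk24a (by unfold okC; decide) P24_sw leafB_sound hC hn hd
      (by rw [hsH]; rfl) (fun h => by cases h) ha x hx hax ?_
    intro Ls hnd hc F hF
    have hlen : Ls.length ≤ 24 := hn ▸ hnd.length_le_card
    have hex : ∀ v, ∃ i, Ls[i]? = some v := fun v => List.mem_iff_getElem?.1 (hc v)
    choose ix hix using hex
    have hixl : ∀ v, ix v < 24 := fun v => by
      have := (List.getElem?_eq_some_iff.1 (hix v)).1
      omega
    have hEL : ∀ a j, EL H Ls (ix a) j → ∃ b, Ls[j]? = some b ∧ H.Adj a b := by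
      rintro a j ⟨a', b, h1, h2, h3⟩
      rw [hix] at h1
      obtain rfl := Option.some_injective _ h1
      exact ⟨b, h2, h3⟩
    have hEL2 : ∀ a b, EL H Ls (ix a) (ix b) → H.Adj a b := by
      intro a b h
      obtain ⟨b', h2, h3⟩ := hEL _ _ h
      rw [hix] at h2
      obtain rfl := Option.some_injective _ h2
      exact h3
    have hinj : ∀ i j, i ≠ j → ix ⟨t i, tm i⟩ ≠ ix ⟨t j, tm j⟩ := by
      intro i j hij e
      have h1 := hix ⟨t i, tm i⟩
      rw [e, hix] at h1
      have := Option.some_injective _ h1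
      exact hij (t1 (Subtype.mk.inj this).symm)
    have hcm : ∀ i j : Fin 6, i.val / 3 = j.val / 3 → ∃ z, (z = u ∨ z = w) ∧ G.Adj z (t i) ∧ G.Adj z (t j) := by
      intro i j hij
      by_cases h : i.val / 3 = 0
      · exact ⟨u, Or.inl rfl, (t2 i h).1, (t2 j (by omega)).1⟩
      · exact ⟨w, Or.inr rfl, (t3 i h).1, (t3 j (by omega)).1⟩
    have hcr : ∀ i j : Fin 6, i.val / 3 = 0 → j.val / 3 ≠ 0 → ¬ G.Adj (t i) (t j) := by
      intro i j hi hj h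
      rcases hG.c4 u (t i) (t j) w (t2 i hi).1 h (t3 j hj).1.symm huw.symm with e | e
      · exact (tm j).1 e.symm
      · exact (tm i).2 e
    refine ⟨fun i => ix ⟨t i, tm i⟩, fun i => hixl _, ?_, ?_, ?_⟩
    · intro i j hij h
      obtain ⟨z, hz, z1, z2⟩ := hcm i j h
      refine ⟨hinj i j hij, fun h1 => ?_, fun k h1 h2 => ?_⟩
      · have h1 := hEL2 _ _ h1
        rw [hHadj] at h1
        exact hG.tri z _ _ z1 h1 z2.symm
      · obtain ⟨a, a1, a2⟩ := hEL _ _ h1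
        obtain ⟨b, b1, b2⟩ := hEL _ _ h2
        rw [a1] at b1
        obtain rfl := Option.some_injective _ b1
        rw [hHadj] at a2 b2
        rcases hG.c4 z (t i) a.1 (t j) z1 a2 b2.symm z2.symm with e | e
        · rcases hz with rfl | rfl
          · exact a.2.1 e.symm
          · exact a.2.2 e.symm
        · exact hij (t1 e)
    · intro i j hij
      refine ⟨hinj i j (fun e => hij (by rw [e])), fun h1 => ?_⟩
      have h1 := hEL2 _ _ h1
      rw [hHadj] at h1
      by_cases hi : i.val / 3 = 0
      · exact hcr i j hi (by omega) h1
      · exact hcr j i (by omega) hi h1.symm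
    · rintro ⟨g1, k, hk, g2, g3⟩
      apply hcon
      have tlo : ∀ i, dg H ⟨t i, tm i⟩ = 4 := fun i => (hF _ _ (hix _)).1 (g1 i)
      have d5 : ∀ v, v ≠ u → v ≠ w → dg G v ≤ 5 := by
        intro v v1 v2
        obtain ⟨p, q⟩ := hdel ⟨v, v1, v2⟩
        simp only at p q
        by_cases h : G.Adj v u ∨ G.Adj v w
        · obtain ⟨i, rfl⟩ := t4 v v1 v2 h
          have := p h
          have := tlo i
          omega
        · have := q h
          have := hd ⟨v, v1, v2⟩
          omega
      have hk' : k < Ls.length := by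
        have : Ls.length = 24 := by
          rw [← hn]
          exact le_antisymm hnd.length_le_card (by
            rw [← List.toFinset_card_of_nodup hnd, ← Finset.card_univ]
            exact Finset.card_le_card fun v _ => List.mem_toFinset.2 (hc v))
        omega
      obtain ⟨z, hz⟩ : ∃ z, Ls[k]? = some z := ⟨Ls[k], List.getElem?_eq_getElem hk'⟩
      have zhi : dg H z = 5 := by
        refine (hd z).resolve_left fun h => ?_
        rw [(hF _ _ hz).2 h] at g2
        cases g2
      have zQ : ¬ (G.Adj z.1 u ∨ G.Adj z.1 w) := by
        intro h
        obtain ⟨i, hi⟩ := t4 z.1 z.2.1 z.2.2 h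
        have := tlo i
        have e : (⟨t i, tm i⟩ : {v // v ≠ u ∧ v ≠ w}) = z := Subtype.ext hi.symm
        rw [e] at this
        omega
      refine ⟨fun v => ?_, z.1, ?_, ?_⟩
      · by_cases v1 : v = u
        · rw [v1]; omega
        by_cases v2 : v = w
        · rw [v2]; omega
        exact d5 v v1 v2
      · rw [← (hdel z).2 zQ]; exact zhi
      · intro y hy
        have y1 : y ≠ u := fun e => zQ (Or.inl (e ▸ hy))
        have y2 : y ≠ w := fun e => zQ (Or.inr (e ▸ hy))
        obtain ⟨p, q⟩ := hdel ⟨y, y1, y2⟩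
        simp only at p q
        rcases hd ⟨y, y1, y2⟩ with h | h
        · obtain ⟨i, hi⟩ := g3 (ix ⟨y, y1, y2⟩) ⟨z, ⟨y, y1, y2⟩, hz, hix _, (hHadj _ _).2 hy⟩
            ((hF _ _ (hix _)).2 h)
          have h1 := hix ⟨y, y1, y2⟩
          rw [hi, hix] at h1
          have e := Subtype.mk.inj (Option.some_injective _ h1)
          have := p (e ▸ tQ i)
          omega
        · by_cases hh : G.Adj y u ∨ G.Adj y w
          · have := p hh; omega
          · have := q hh; omega
  have h5 := e24c.kill hC hn hd hsH (e24b.kill hC hn hd hsH (a_step ha key))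
  have h3 := lo_sum (G := H) (lo := 4) (k := 5) fun v hv => h5 v ((hd v).resolve_left hv)
  have h4 := sd_eq hd
  rw [hn] at h3 h4
  omega


end Final

section Final2

set_option linter.unusedSectionVars false

variable {V : Type} [Fintype V] {G : SimpleGraph V}

theorem S_le2 (hG : C4F G) (x : V) (B : Finset V)
    (hB : ∀ b ∈ B, b ≠ x ∧ ¬ G.Adj x b ∧ ∀ y, G.Adj x y → ¬ G.Adj y b) :
    ∑ y ∈ nb G x, dg G y + 1 + B.card ≤ Fintype.card V := by
  classical
  have hBs : B ⊆ Finset.univ.erase x := fun b hb => Finset.mem_erase.2 ⟨(hB b hb).1, Finset.mem_univ _⟩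
  have h : ((nb G x).sigma fun y => nb G y).card ≤ (Finset.univ.erase x \ B).card := by
    apply Finset.card_le_card_of_injOn (fun s => if s.2 = x then s.1 else s.2)
    · rintro ⟨y, z⟩ h
      simp only [Finset.coe_sigma, Set.mem_sigma_iff, Finset.mem_coe, mem_nb] at h
      rw [Finset.mem_coe, Finset.mem_sdiff, Finset.mem_erase]
      simp only
      split_ifs with hz
      · exact ⟨⟨h.1.ne', Finset.mem_univ _⟩, fun hb => (hB _ hb).2.1 h.1⟩
      · exact ⟨⟨hz, Finset.mem_univ _⟩, fun hb => (hB _ hb).2.2 y h.1 h.2⟩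
    · rintro ⟨y, z⟩ h ⟨y', z'⟩ h' e
      simp only [Finset.coe_sigma, Set.mem_sigma_iff, Finset.mem_coe, mem_nb] at h h'
      simp only at e
      split_ifs at e with h1 h2 h2
      · rw [e, h1, h2]
      · subst e
        exact (hG.tri x y y' h.1 h'.2.symm h'.1.symm).elim
      · rw [← e] at h'
        exact (hG.tri x y z h.1 h.2 h'.1.symm).elim
      · subst e
        rcases hG.c4 x y z y' h.1 h.2 h'.2.symm h'.1.symm with h3 | h3
        · exact (h1 h3.symm).elim
        · subst h3; rfl
  rw [Finset.card_sigma, Finset.card_sdiff_of_subset hBs, Finset.card_erase_of_mem (Finset.mem_univ _),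
    Finset.card_univ] at h
  have h2 := Finset.card_le_card hBs
  rw [Finset.card_erase_of_mem (Finset.mem_univ _), Finset.card_univ] at h2
  have : 0 < Fintype.card V := Fintype.card_pos_iff.2 ⟨x⟩
  simp only [dg]
  omega

theorem six (hG : C4F G) (hV : Fintype.card V = 26) (hs : sd G = 122)
    (hmin : ∀ v, 4 ≤ dg G v) (hmax : ∀ v, dg G v ≤ 6)
    (hno : ∀ v w, G.Adj v w → dg G v = 4 → dg G w = 4 → False) (x : V) (hx : dg G x = 6) : False := by
  classical
  have hc : (Finset.univ.filter fun v => dg G v = 4).card = 8 + (Finset.univ.filter fun v => dg G v = 6).card := by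
    have h1 : ∑ v : V, (dg G v + if dg G v = 4 then 1 else 0) = ∑ v : V, (5 + if dg G v = 6 then 1 else 0) := by
      apply Finset.sum_congr rfl
      intro v _
      have := hmin v
      have := hmax v
      split_ifs <;> omega
    rw [Finset.sum_add_distrib, Finset.sum_add_distrib, ← Finset.card_filter, ← Finset.card_filter,
      Finset.sum_const, Finset.card_univ, hV] at h1
    change sd G + _ = _ at h1
    rw [hs, smul_eq_mul] at h1
    omega
  have h6 : 1 ≤ (Finset.univ.filter fun v => dg G v = 6).card :=
    Finset.card_pos.2 ⟨x, Finset.mem_filter.2 ⟨Finset.mem_univ _, hx⟩⟩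
  have hS : 5 * 6 ≤ ∑ y ∈ nb G x, dg G y + lonb G 4 x := by
    rw [lonb, Finset.card_filter, ← Finset.sum_add_distrib]
    have : (nb G x).card • 5 ≤ ∑ y ∈ nb G x, (dg G y + if dg G y = 4 then 1 else 0) := by
      apply Finset.card_nsmul_le_sum
      intro y _
      have := hmin y
      split_ifs <;> omega
    change dg G x • 5 ≤ _ at this
    rw [hx, smul_eq_mul] at this
    omega
  have hS1 := S_le hG x
  have hle := lonb_le (G := G) 4 x
  have hsp : lonb G 4 x + ((nb G x).filter fun v => ¬ dg G v = 4).card = 6 := by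
    rw [← hx, lonb, Finset.card_filter_add_card_filter_not]; rfl
  -- the low vertices away from `x`
  have hB0 : (Finset.univ.filter fun v => dg G v = 4).card ≤ lonb G 4 x +
      (Finset.univ.filter fun v => dg G v = 4 ∧ ¬ G.Adj x v).card := by
    rw [lonb]
    refine (Finset.card_le_card ?_).trans (Finset.card_union_le _ _)
    intro v hv
    rw [Finset.mem_filter] at hv
    rw [Finset.mem_union, Finset.mem_filter, Finset.mem_filter, mem_nb]
    by_cases h : G.Adj x v
    · exact Or.inl ⟨h, hv.2⟩
    · exact Or.inr ⟨Finset.mem_univ _, hv.2, h⟩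
  by_cases h : lonb G 4 x = 6
  · have hall : ∀ y, G.Adj x y → dg G y = 4 := by
      intro y hy
      by_contra hy4
      have := lonb_lt (lo := 4) hy hy4
      omega
    have h1 := S_le2 hG x (Finset.univ.filter fun v => dg G v = 4 ∧ ¬ G.Adj x v) (by
      intro b hb
      rw [Finset.mem_filter] at hb
      refine ⟨fun e => ?_, hb.2.2, fun y hy hyb => hno y b hyb (hall y hy) hb.2.1⟩
      have := hb.2.1
      rw [e] at this
      omega)
    omega
  · have h5 : lonb G 4 x = 5 := by omega
    obtain ⟨y, hy⟩ := Finset.card_eq_one.1 (show ((nb G x).filter fun v => ¬ dg G v = 4).card = 1 by omega)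
    have hyu : ∀ z, G.Adj x z → dg G z ≠ 4 → z = y := by
      intro z h1 h2
      have : z ∈ ((nb G x).filter fun v => ¬ dg G v = 4) := Finset.mem_filter.2 ⟨mem_nb.2 h1, h2⟩
      rw [hy] at this
      exact Finset.mem_singleton.1 this
    have hym : y ∈ ((nb G x).filter fun v => ¬ dg G v = 4) := by rw [hy]; simp
    rw [Finset.mem_filter, mem_nb] at hym
    have hyd : dg G y = 5 := by
      have e1 := Finset.sum_filter_add_sum_filter_not (nb G x) (fun v => dg G v = 4) (dg G)
      rw [hy, Finset.sum_singleton, Finset.sum_congr rfl fun v hv => (Finset.mem_filter.1 hv).2,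
        Finset.sum_const] at e1
      change lonb G 4 x • 4 + _ = _ at e1
      rw [h5, smul_eq_mul] at e1
      have := hmin y
      omega
    have hall : ∀ u, dg G u = 4 → ¬ G.Adj x u → G.Adj y u := by
      intro u h1 h2
      by_contra h3
      have := S_le2 hG x {u} (by
        intro b hb
        rw [Finset.mem_singleton] at hb
        subst hb
        refine ⟨fun e => by rw [e] at h1; omega, h2, fun z hz hzb => ?_⟩
        by_cases hz4 : dg G z = 4
        · exact hno z b hzb hz4 h1
        · rw [hyu z hz hz4] at hzb
          exact h3 hzb)
      rw [Finset.card_singleton] at this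
      omega
    have hB1 : (Finset.univ.filter fun v => dg G v = 4 ∧ ¬ G.Adj x v).card ≤ lonb G 4 y := by
      apply Finset.card_le_card
      intro v hv
      rw [Finset.mem_filter] at hv
      exact Finset.mem_filter.2 ⟨mem_nb.2 (hall v hv.2.1 hv.2.2), hv.2.1⟩
    have hy5 := lonb_lt (lo := 4) hym.1.symm (show dg G x ≠ 4 by omega)
    have h61 : (Finset.univ.filter fun v => dg G v = 6).card = 1 := by omega
    have hly : lonb G 4 y = 4 := by omega
    refine no_graph c26x noLeaf (fun _ _ => True) _ _ _ chk26x (by decide) (by decide) (by decide) (by decide)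
      (by decide) (by decide) (by decide) (fun _ _ _ _ _ _ _ _ => trivial)
      (fun _ _ _ h => by cases h) hG hV x hx ?_ h5 ?_ (fun _ => hno) ?_ ?_ ?_ (fun _ _ _ _ _ => trivial)
    · intro v hv
      have : dg G v ≠ 6 := by
        intro h
        exact hv (Finset.card_le_one.1 h61.le v (Finset.mem_filter.2 ⟨Finset.mem_univ _, h⟩) x
          (Finset.mem_filter.2 ⟨Finset.mem_univ _, hx⟩))
      have := hmin v
      have := hmax v
      change dg G v = 4 ∨ dg G v = 5
      omega
    · change _ = 9
      change (Finset.univ.filter fun v => dg G v = 4).card = 9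
      omega
    · intro v _
      exact Nat.zero_le _
    · intro v hv hv5
      change dg G v = 5 at hv5
      obtain rfl := hyu v hv (by omega)
      exact List.mem_singleton.2 hly
    · intro v hv hv4
      refine List.mem_singleton.2 ?_
      rw [lonb, Finset.card_eq_zero, Finset.eq_empty_iff_forall_notMem]
      intro z hz
      rw [Finset.mem_filter, mem_nb] at hz
      exact hno v z hz.1 hv4 hz.2

theorem main26 (hG : C4F G) (hV : Fintype.card V = 26) (hs : sd G = 122) :
    (∀ v, 4 ≤ dg G v) ∧ (∀ v, dg G v ≤ 5) ∧ ∃ x, dg G x = 5 ∧ ∀ y, G.Adj x y → 5 ≤ dg G y := by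
  have hmin : ∀ v, 4 ≤ dg G v := bd25.min hG hV (by omega)
  have hmax : ∀ v, dg G v ≤ 6 := dle hG hV hmin (D := 6) (by norm_num)
  refine ⟨hmin, ?_⟩
  by_cases hno : ∀ v w, G.Adj v w → dg G v = 4 → dg G w = 4 → False
  · have h5 : ∀ v, dg G v ≤ 5 := by
      intro v
      by_contra h
      exact six hG hV hs hmin hmax hno v (by have := hmax v; omega)
    refine ⟨h5, ?_⟩
    by_contra hst
    have hd : ∀ v, dg G v = 4 ∨ dg G v = 4 + 1 := by
      intro v
      have := hmin v
      have := h5 v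
      omega
    have h1 : ∀ v, dg G v = 4 + 1 → 1 ≤ lonb G 4 v := by
      intro v hv
      by_contra h0
      have h0 : lonb G 4 v = 0 := by omega
      rw [lonb, Finset.card_eq_zero, Finset.eq_empty_iff_forall_notMem] at h0
      refine hst ⟨v, hv, fun y hy => ?_⟩
      have h2 := h0 y
      rw [Finset.mem_filter, mem_nb] at h2
      have := hd y
      have : dg G y ≠ 4 := fun e => h2 ⟨hy, e⟩
      omega
    have h2 := a_step h1 fun x hx hax => e26 V G hG hV hd hs (fun _ => hno) h1 x hx hax
    have h3 := lo_sum (G := G) (lo := 4) (k := 2) fun v hv => h2 v ((hd v).resolve_left hv)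
    have h4 := sd_eq hd
    rw [hV] at h3 h4
    omega
  · push Not at hno
    obtain ⟨u, w, huw, hu, hw, -⟩ := hno
    exact adjCase hG hV hs huw hu hw

end Final2

theorem c4f_of_girth (G : SimpleGraph (Fin 26)) (hg : GirthAtLeast5 G) : C4F G := by
  constructor
  · intro a b c h1 h2 h3
    have := hg (Walk.cons h1 (Walk.cons h2 (Walk.cons h3 Walk.nil))) (by
      rw [Walk.isCycle_def]
      refine ⟨?_, by simp, ?_⟩
      · rw [Walk.isTrail_def]
        have := h1.ne; have := h2.ne; have := h3.ne
        simp
        tauto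
      · have := h1.ne; have := h2.ne; have := h3.ne
        simp
        tauto)
    simp at this
  · intro a b c d h1 h2 h3 h4
    by_contra hne
    push Not at hne
    have := hg (Walk.cons h1 (Walk.cons h2 (Walk.cons h3 (Walk.cons h4 Walk.nil)))) (by
      rw [Walk.isCycle_def]
      have := h1.ne; have := h2.ne; have := h3.ne; have := h4.ne
      refine ⟨?_, by simp, ?_⟩
      · rw [Walk.isTrail_def]
        simp
        tauto
      · simp
        tauto)
    simp at this

theorem dg_degree (G : SimpleGraph (Fin 26)) [DecidableRel G.Adj] (v : Fin 26) : G.degree v = dg G v := by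
  rw [dg, ← G.card_neighborFinset_eq_degree]
  congr 1
  ext w
  rw [mem_nb, mem_neighborFinset]

theorem stmt13 (G : SimpleGraph (Fin 26)) [DecidableRel G.Adj]
    (hg : GirthAtLeast5 G) (he : G.edgeFinset.card = 61) :
    (G.minDegree, G.maxDegree) = (4, 5) ∧ HasEmbeddedStar G 5 ![4, 4, 4, 4, 4] := by
  have hG := c4f_of_girth G hg
  have hs : sd G = 122 := by rw [sd_edges, he]
  have hV : Fintype.card (Fin 26) = 26 := Fintype.card_fin 26
  obtain ⟨h1, h2, x, hx, hy⟩ := main26 hG hV hs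
  have hmin : ∃ v, dg G v = 4 := by
    by_contra! hc
    have := sum_ge (G := G) (d := 5) fun v => by
      have := h1 v
      have := hc v
      omega
    rw [hV] at this
    omega
  obtain ⟨u, hu⟩ := hmin
  refine ⟨?_, ?_⟩
  · rw [Prod.mk.injEq]
    refine ⟨?_, ?_⟩
    · apply le_antisymm
      · have := G.minDegree_le_degree u
        rw [dg_degree, hu] at this
        exact this
      · apply G.le_minDegree_of_forall_le_degree
        intro v
        rw [dg_degree]
        exact h1 v
    · apply le_antisymm
      · apply G.maxDegree_le_of_forall_degree_le
        intro v
        rw [dg_degree]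
        exact h2 v
      · have := G.degree_le_maxDegree x
        rw [dg_degree, hx] at this
        exact this
  · obtain ⟨f, f1, f2⟩ := enumS (nb G x) hx
    have fa : ∀ i, G.Adj x (f i) := fun i => mem_nb.1 ((f2 _).2 ⟨i, rfl⟩)
    refine ⟨x, f, ?_, f1, fa, ?_⟩
    · rw [dg_degree, hx]
    · intro i
      have h := hy _ (fa i)
      rw [dg_degree]
      fin_cases i <;> exact h
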